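/- arXiv:1308.5173 — 9 statements merged into one kernel-verified Lean document; each statement's English description precedes it below -/
import Mathlib

section
/- Let G be a finite, 3-regular, vertex-transitive simple graph that contains an odd cycle, let λ_min be the least eigenvalue of its adjacency matrix, and let g be the odd-girth of G. Then the independence ratio of G is at least (5g−3)/(16g) + ((g+1)/(2g))·(3/(4π))·arcsin((λ_min² − 3)/6). -/
open Matrix

section GaussianSeparation

open MeasureTheory ProbabilityTheory Real

variable {E : Type*} [NormedAddCommGroup E] [InnerProductSpace ℝ E]

/-- The vectors whose inner products with `a` and `b` have strictly opposite signs. -/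
def oppositeSigns (a b : E) : Set E := {z | inner ℝ a z * inner ℝ b z < 0}

lemma oppositeSigns_smul {r s : ℝ} (hr : 0 < r) (hs : 0 < s) (a b : E) :
    oppositeSigns (r • a) (s • b) = oppositeSigns a b := by
  ext z
  simp only [oppositeSigns, Set.mem_ofPred_eq, inner_smul_left, conj_trivial]
  rw [show r * inner ℝ a z * (s * inner ℝ b z) = (r * s) * (inner ℝ a z * inner ℝ b z) by ring]
  exact ⟨fun h => by_contra fun h' => absurd h (mul_nonneg (mul_pos hr hs).le (not_lt.1 h')).not_gt,
    fun h => mul_neg_of_pos_of_neg (mul_pos hr hs) h⟩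

lemma oppositeSigns_self (a : E) : oppositeSigns a a = ∅ := by
  ext z
  simp only [oppositeSigns, Set.mem_ofPred_eq, Set.mem_empty_iff_false, iff_false, not_lt]
  exact mul_self_nonneg _

lemma oppositeSigns_comm (a b : E) : oppositeSigns a b = oppositeSigns b a := by
  ext z
  simp only [oppositeSigns, Set.mem_ofPred_eq, mul_comm]

lemma le_of_additive_on_unitInterval {F : ℝ → ℝ}
    (hadd : ∀ s t, 0 ≤ s → 0 ≤ t → s + t ≤ 1 → F (s + t) = F s + F t)
    (hnonneg : ∀ t, 0 ≤ F t) (hone : F 1 = 1) {t : ℝ} (ht0 : 0 ≤ t) (ht1 : t ≤ 1) :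
    F t ≤ t := by
  refine le_of_forall_pos_le_add fun ε hε => ?_
  obtain ⟨n, hn⟩ := exists_nat_one_div_lt hε
  set N : ℝ := (n : ℝ) + 1 with hN
  have hNpos : 0 < N := by positivity
  have hzero : F 0 = 0 := by
    have := hadd 0 0 le_rfl le_rfl (by norm_num)
    simp only [add_zero] at this
    linarith
  have hmul : ∀ k : ℕ, (k : ℝ) ≤ N → F (k / N) = k * F (1 / N) := by
    intro k
    induction k with
    | zero => intro _; simp [hzero]
    | succ k ih =>
      intro hk
      push_cast at hk ⊢
      rw [add_div, hadd _ _ (by positivity) (by positivity)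
        (by rw [← add_div]; exact div_le_one_of_le₀ hk hNpos.le), ih (by linarith)]
      ring
  have hunit : F (1 / N) = 1 / N := by
    have := hmul (n + 1) (by push_cast; exact le_rfl)
    push_cast at this
    rw [← hN, div_self hNpos.ne', hone] at this
    field_simp
    linarith
  have hceil : (⌈t * N⌉₊ : ℝ) ≤ N := by
    have : ⌈t * N⌉₊ ≤ n + 1 := Nat.ceil_le.2 (by push_cast; nlinarith)
    calc (⌈t * N⌉₊ : ℝ) ≤ ((n + 1 : ℕ) : ℝ) := by exact_mod_cast this
      _ = N := by push_cast; rfl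
  have hle : t ≤ ⌈t * N⌉₊ / N := (le_div_iff₀ hNpos).2 (Nat.le_ceil _)
  have hdiv1 : (⌈t * N⌉₊ : ℝ) / N ≤ 1 := div_le_one_of_le₀ hceil hNpos.le
  have hmono := hadd t (⌈t * N⌉₊ / N - t) ht0 (by linarith) (by linarith)
  rw [add_sub_cancel, hmul _ hceil, hunit] at hmono
  have hlt : (⌈t * N⌉₊ : ℝ) < t * N + 1 := Nat.ceil_lt_add_one (by positivity)
  have hlt' : (⌈t * N⌉₊ : ℝ) * (1 / N) ≤ t + 1 / N := by
    rw [mul_one_div, div_le_iff₀ hNpos]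
    field_simp
    linarith
  linarith [hnonneg (⌈t * N⌉₊ / N - t)]

variable [FiniteDimensional ℝ E] [MeasurableSpace E] [BorelSpace E]

lemma measurableSet_oppositeSigns (a b : E) : MeasurableSet (oppositeSigns a b) :=
  measurableSet_lt (by fun_prop) measurable_const

lemma stdGaussian_inner_eq_zero {a : E} (ha : a ≠ 0) :
    stdGaussian E {z | inner ℝ a z = 0} = 0 := by
  have hmap := IsGaussian.map_eq_gaussianReal (μ := stdGaussian E) (innerSL ℝ a)
  have hvar : Var[innerSL ℝ a; stdGaussian E].toNNReal ≠ 0 := by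
    rw [variance_dual_stdGaussian]
    simpa using ha
  have : NullSingletonClass (gaussianReal (∫ x, innerSL ℝ a x ∂(stdGaussian E))
      Var[innerSL ℝ a; stdGaussian E].toNNReal) := nullSingletonClass_gaussianReal hvar
  rw [← hmap] at this
  have h0 := this.measure_singleton 0
  rwa [Measure.map_apply (by fun_prop) (measurableSet_singleton 0)] at h0

lemma stdGaussian_oppositeSigns_map (L : E ≃ₗᵢ[ℝ] E) (a b : E) :
    (stdGaussian E).real (oppositeSigns (L a) (L b)) =
      (stdGaussian E).real (oppositeSigns a b) := by
  conv_lhs => rw [← stdGaussian_map L]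
  rw [map_measureReal_apply (by fun_prop) (measurableSet_oppositeSigns _ _)]
  congr 1
  ext z
  simp [oppositeSigns]

lemma stdGaussian_oppositeSigns_add {a b c : E} (ha : a ≠ 0) (hb : b ≠ 0) (hc : c ≠ 0)
    {r s t : ℝ} (hr : 0 < r) (hs : 0 < s) (ht : 0 ≤ t) (h : r • a + s • c = t • b) :
    (stdGaussian E).real (oppositeSigns a c) =
      (stdGaussian E).real (oppositeSigns a b) + (stdGaussian E).real (oppositeSigns b c) := by
  have hdisj : Disjoint (oppositeSigns a b) (oppositeSigns b c) := by
    rw [Set.disjoint_left]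
    intro z h1 h2
    simp only [oppositeSigns, Set.mem_ofPred_eq] at h1 h2
    have hz : r * inner ℝ a z + s * inner ℝ c z = t * inner ℝ b z := by
      have := congrArg (fun v => inner ℝ v z) h
      simpa [inner_add_left, inner_smul_left] using this
    rcases mul_neg_iff.1 h1 with ⟨h3, h4⟩ | ⟨h3, h4⟩
    · have h5 : 0 < inner ℝ c z := by nlinarith
      nlinarith [mul_pos hr h3, mul_pos hs h5]
    · have h5 : inner ℝ c z < 0 := by nlinarith
      nlinarith [mul_pos hr (neg_pos.2 h3), mul_pos hs (neg_pos.2 h5)]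
  rw [← measureReal_union hdisj (measurableSet_oppositeSigns _ _)]
  refine measureReal_congr ?_
  have h0 : ∀ v : E, v ≠ 0 → ∀ᵐ z ∂(stdGaussian E), inner ℝ v z ≠ 0 := fun v hv => by
    rw [ae_iff]; simpa using stdGaussian_inner_eq_zero hv
  filter_upwards [h0 a ha, h0 b hb, h0 c hc] with z hza hzb hzc
  have hz : r * inner ℝ a z + s * inner ℝ c z = t * inner ℝ b z := by
    have := congrArg (fun v => inner ℝ v z) h
    simpa [inner_add_left, inner_smul_left] using this
  apply propext
  change inner ℝ a z * inner ℝ c z < 0 ↔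
    inner ℝ a z * inner ℝ b z < 0 ∨ inner ℝ b z * inner ℝ c z < 0
  generalize inner ℝ a z = A at *
  generalize inner ℝ b z = B at *
  generalize inner ℝ c z = C at *
  rcases lt_or_gt_of_ne hza with h1 | h1 <;> rcases lt_or_gt_of_ne hzb with h2 | h2 <;>
    rcases lt_or_gt_of_ne hzc with h3 | h3 <;>
    simp only [mul_neg_iff, h1, h2, h3, h1.not_gt, h2.not_gt, h3.not_gt, and_true,
      and_false, or_true, or_false, iff_true] <;>
    linarith [mul_lt_mul_of_pos_left h1 hr, mul_lt_mul_of_pos_left h3 hs,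
      mul_le_mul_of_nonneg_left h2.le ht]

lemma stdGaussian_oppositeSigns_orthonormal {u w : E} (hu : ‖u‖ = 1) (hw : ‖w‖ = 1)
    (huw : inner ℝ u w = 0) {θ : ℝ} (h0 : 0 ≤ θ) (h1 : θ ≤ π) :
    (stdGaussian E).real (oppositeSigns u (cos θ • u + sin θ • w)) ≤ θ / π := by
  set arc : ℝ → E := fun x => cos x • u + sin x • w with harc
  have hinner : ∀ x y, inner ℝ (arc x) (arc y) = cos (x - y) := by
    intro x y
    simp only [harc, inner_add_left, inner_add_right, inner_smul_left, inner_smul_right,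
      conj_trivial, real_inner_self_eq_norm_sq, hu, hw, huw, 
      real_inner_comm u w, cos_sub]
    ring
  have hne : ∀ x, arc x ≠ 0 := by
    intro x hx
    have := hinner x x
    simp [hx] at this
  have hzero : arc 0 = u := by simp [harc]
  set F : ℝ → ℝ := fun t => (stdGaussian E).real (oppositeSigns (arc 0) (arc (t * π))) with hF
  have hrefl : ∀ x y, (stdGaussian E).real (oppositeSigns (arc x) (arc y)) =
      (stdGaussian E).real (oppositeSigns (arc 0) (arc (y - x))) := by
    intro x y
    rw [← stdGaussian_oppositeSigns_map (Submodule.reflection (ℝ ∙ arc (y / 2))) (arc x) (arc y)]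
    have hr : ∀ s, Submodule.reflection (ℝ ∙ arc (y / 2)) (arc s) = arc (y - s) := by
      intro s
      rw [Submodule.reflection_singleton_apply, hinner]
      have hn : ‖arc (y / 2)‖ = 1 := by
        have := hinner (y / 2) (y / 2)
        rw [real_inner_self_eq_norm_sq] at this
        simpa [pow_eq_one_iff_of_nonneg] using this
      have e1 : cos (y - s) = 2 * (cos (y / 2 - s) * cos (y / 2)) - cos s := by
        rw [show y - s = (y / 2 - s) + y / 2 by ring, cos_add]
        have := cos_sub (y / 2 - s) (y / 2)
        rw [show y / 2 - s - y / 2 = -s by ring, cos_neg] at this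
        linarith
      have e2 : sin (y - s) = 2 * (cos (y / 2 - s) * sin (y / 2)) - sin s := by
        rw [show y - s = (y / 2 - s) + y / 2 by ring, sin_add]
        have := sin_sub (y / 2 - s) (y / 2)
        rw [show y / 2 - s - y / 2 = -s by ring, sin_neg] at this
        linarith
      rw [hn]
      simp only [harc, e1, e2]
      norm_num
      module
    rw [hr, hr, sub_self, oppositeSigns_comm]
  have hadd : ∀ s t, 0 ≤ s → 0 ≤ t → s + t ≤ 1 → F (s + t) = F s + F t := by
    intro s t hs ht hst
    rcases hs.eq_or_lt with rfl | hs
    · simp [hF, oppositeSigns_self]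
    rcases ht.eq_or_lt with rfl | ht
    · simp [hF, oppositeSigns_self]
    have e : F t = (stdGaussian E).real (oppositeSigns (arc (s * π)) (arc ((s + t) * π))) := by
      rw [hrefl, hF]
      ring_nf
    rw [e]
    refine stdGaussian_oppositeSigns_add (hne _) (hne _) (hne _) (r := sin (t * π))
      (s := sin (s * π)) (t := sin ((s + t) * π)) ?_ ?_ ?_ ?_
    · exact sin_pos_of_pos_of_lt_pi (by positivity) (by nlinarith [pi_pos])
    · exact sin_pos_of_pos_of_lt_pi (by positivity) (by nlinarith [pi_pos])
    · exact sin_nonneg_of_nonneg_of_le_pi (by positivity) (by nlinarith [pi_pos])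
    · simp only [harc, cos_zero, sin_zero, add_mul, sin_add, cos_add]
      have e1 := sin_sq_add_cos_sq (s * π)
      have e2 := sin_sq_add_cos_sq (t * π)
      match_scalars
      · linear_combination (-sin (t * π)) * e1
      · ring
  have hone : F 1 = 1 := by
    have : (oppositeSigns (arc 0) (arc (1 * π)))ᶜ = {z | inner ℝ u z = 0} := by
      ext z
      simp only [oppositeSigns, harc, cos_zero, sin_zero, one_mul, cos_pi, sin_pi, one_smul,
        zero_smul, add_zero, neg_smul, inner_neg_left, Set.mem_compl_iff, Set.mem_ofPred_eq]
      rw [mul_neg, neg_lt_zero, not_lt]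
      exact ⟨fun h => by nlinarith [mul_self_nonneg (inner ℝ u z)], fun h => by simp [h]⟩
    have hc := probReal_add_probReal_compl (μ := stdGaussian E)
      (measurableSet_oppositeSigns (arc 0) (arc (1 * π)))
    rw [this, measureReal_def (s := {z | inner ℝ u z = 0}), stdGaussian_inner_eq_zero] at hc
    · simpa [hF] using hc
    · rintro rfl; simp at hu
  have := le_of_additive_on_unitInterval hadd (fun t => measureReal_nonneg) hone
    (t := θ / π) (by positivity) (div_le_one_of_le₀ h1 pi_pos.le)
  simpa [hF, div_mul_cancel₀ _ pi_pos.ne', hzero] using this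

lemma stdGaussian_oppositeSigns_le {a b : E} (ha : a ≠ 0) (hb : b ≠ 0) :
    (stdGaussian E).real (oppositeSigns a b) ≤ InnerProductGeometry.angle a b / π := by
  have hπ := pi_pos
  have hna : 0 < ‖a‖ := norm_pos_iff.2 ha
  have hnb : 0 < ‖b‖ := norm_pos_iff.2 hb
  set θ := InnerProductGeometry.angle a b with hθ
  have hθ0 : 0 ≤ θ := InnerProductGeometry.angle_nonneg a b
  have hθ1 : θ ≤ π := InnerProductGeometry.angle_le_pi a b
  rcases hθ0.eq_or_lt with h | h
  · obtain ⟨-, r, hr, rfl⟩ := InnerProductGeometry.angle_eq_zero_iff.1 h.symm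
    rw [← one_smul ℝ a, smul_smul, mul_one, oppositeSigns_smul one_pos hr, oppositeSigns_self,
      measureReal_empty]
    positivity
  rcases hθ1.eq_or_lt with h' | h'
  · rw [h', div_self hπ.ne']
    exact measureReal_le_one
  have hsin : 0 < sin θ := sin_pos_of_pos_of_lt_pi h h'
  obtain ⟨u, hu⟩ : ∃ u, u = ‖a‖⁻¹ • a := ⟨_, rfl⟩
  obtain ⟨v, hv⟩ : ∃ v, v = ‖b‖⁻¹ • b := ⟨_, rfl⟩
  have hnu : ‖u‖ = 1 := hu ▸ norm_smul_inv_norm ha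
  have hnv : ‖v‖ = 1 := hv ▸ norm_smul_inv_norm hb
  have huv : inner ℝ u v = cos θ := by
    rw [hθ, InnerProductGeometry.cos_angle, hu, hv, inner_smul_left, inner_smul_right]
    simp only [conj_trivial]
    field_simp
  have hw : ‖(sin θ)⁻¹ • (v - cos θ • u)‖ = 1 := by
    rw [norm_smul, norm_inv, norm_of_nonneg hsin.le, inv_mul_eq_one₀ hsin.ne',
      ← sq_eq_sq₀ hsin.le (norm_nonneg _), norm_sub_sq_real, norm_smul, hnu, hnv,
      inner_smul_right, real_inner_comm u v, huv]
    simp only [norm_eq_abs, mul_one, sq_abs]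
    nlinarith [sin_sq_add_cos_sq θ]
  have huw : inner ℝ u ((sin θ)⁻¹ • (v - cos θ • u)) = 0 := by
    rw [inner_smul_right, inner_sub_right, inner_smul_right, huv, real_inner_self_eq_norm_sq, hnu]
    simp
  have := stdGaussian_oppositeSigns_orthonormal hnu hw huw hθ0 hθ1
  rwa [smul_smul (sin θ), mul_inv_cancel₀ hsin.ne', one_smul, add_sub_cancel, hu, hv,
    oppositeSigns_smul (inv_pos.2 hna) (inv_pos.2 hnb)] at this

end GaussianSeparation

section ArcsineInequalities

open Real

lemma two_mul_arcsin_half_add_le {x y : ℝ} (hx : -1 ≤ x) (hx' : x ≤ 1) (hy : -1 ≤ y)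
    (hy' : y ≤ 1) (hxy : 0 ≤ x + y) : 2 * arcsin ((x + y) / 2) ≤ arcsin x + arcsin y := by
  have hsum : 0 ≤ arcsin x + arcsin y := by
    have := monotone_arcsin (show -y ≤ x by linarith)
    rw [arcsin_neg] at this
    linarith
  have hx1 := arcsin_le_pi_div_two x
  have hy1 := arcsin_le_pi_div_two y
  have hsin : 0 ≤ sin ((arcsin x + arcsin y) / 2) :=
    sin_nonneg_of_nonneg_of_le_pi (by linarith) (by linarith [pi_pos])
  have hprod : x + y = 2 * sin ((arcsin x + arcsin y) / 2) * cos ((arcsin x - arcsin y) / 2) := by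
    have h1 := sin_add ((arcsin x + arcsin y) / 2) ((arcsin x - arcsin y) / 2)
    have h2 := sin_sub ((arcsin x + arcsin y) / 2) ((arcsin x - arcsin y) / 2)
    rw [show (arcsin x + arcsin y) / 2 + (arcsin x - arcsin y) / 2 = arcsin x by ring,
      sin_arcsin hx hx'] at h1
    rw [show (arcsin x + arcsin y) / 2 - (arcsin x - arcsin y) / 2 = arcsin y by ring,
      sin_arcsin hy hy'] at h2
    linarith
  have hle : (x + y) / 2 ≤ sin ((arcsin x + arcsin y) / 2) := by
    nlinarith [cos_le_one ((arcsin x - arcsin y) / 2)]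
  have := monotone_arcsin hle
  rw [arcsin_sin (by linarith [pi_pos]) (by linarith)] at this
  linarith

lemma three_mul_arcsin_mean_le_of_add_nonneg {x y z : ℝ} (hx : -1 ≤ x) (hx' : x ≤ 1)
    (hy : -1 ≤ y) (hy' : y ≤ 1)
    (hz' : z ≤ 1) (hxy : 0 ≤ x + y) (hz : (x + y + z) / 3 ≤ z) :
    3 * arcsin ((x + y + z) / 3) ≤ arcsin x + arcsin y + arcsin z := by
  have h1 := two_mul_arcsin_half_add_le hx hx' hy hy' hxy
  have h2 := two_mul_arcsin_half_add_le (x := z) (y := (x + y + z) / 3) (by linarith) hz'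
    (by linarith) (by linarith) (by linarith)
  have h3 := two_mul_arcsin_half_add_le (x := (x + y) / 2) (y := (z + (x + y + z) / 3) / 2)
    (by linarith) (by linarith) (by linarith) (by linarith) (by linarith)
  rw [show ((x + y) / 2 + (z + (x + y + z) / 3) / 2) / 2 = (x + y + z) / 3 by ring] at h3
  linarith

lemma arcsin_half : arcsin (1 / 2) = π / 6 := by
  rw [← sin_pi_div_six, arcsin_sin (by linarith [pi_pos]) (by linarith [pi_pos])]

lemma sub_le_mul_arcsin_sub_of_half_le {x y : ℝ} (hx : 1 / 2 ≤ x) (hxy : x ≤ y) (hy : y ≤ 1) :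
    y - x ≤ √3 / 2 * (arcsin y - arcsin x) := by
  have h := (convex_Icc (π / 6) (π / 2)).image_sub_le_mul_sub_of_deriv_le (f := sin)
    (C := √3 / 2) continuous_sin.continuousOn differentiable_sin.differentiableOn
    (fun t ht => by
      rw [interior_Icc] at ht
      rw [Real.deriv_sin, ← cos_pi_div_six]
      exact cos_le_cos_of_nonneg_of_le_pi (by positivity) (by linarith [ht.2, pi_pos]) ht.1.le)
    (arcsin x) ⟨arcsin_half ▸ monotone_arcsin hx, arcsin_le_pi_div_two x⟩
    (arcsin y) ⟨arcsin_half ▸ monotone_arcsin (hx.trans hxy), arcsin_le_pi_div_two y⟩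
    (monotone_arcsin hxy)
  rwa [sin_arcsin (by linarith) hy, sin_arcsin (by linarith) (by linarith)] at h

lemma mul_arcsin_sub_le_sub_of_abs_le_half {x y : ℝ} (hx : -(1 / 2) ≤ x) (hxy : x ≤ y)
    (hy : y ≤ 1 / 2) : √3 / 2 * (arcsin y - arcsin x) ≤ y - x := by
  have hl : ∀ z, -(1 / 2) ≤ z → -(π / 6) ≤ arcsin z := fun z hz => by
    have := monotone_arcsin hz
    rwa [arcsin_neg, arcsin_half] at this
  have h := (convex_Icc (-(π / 6)) (π / 6)).mul_sub_le_image_sub_of_le_deriv (f := sin)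
    (C := √3 / 2) continuous_sin.continuousOn differentiable_sin.differentiableOn
    (fun t ht => by
      rw [interior_Icc] at ht
      rw [Real.deriv_sin, ← cos_pi_div_six, ← cos_abs t]
      exact cos_le_cos_of_nonneg_of_le_pi (abs_nonneg t) (by linarith [pi_pos])
        (abs_le.2 ⟨ht.1.le, ht.2.le⟩))
    (arcsin x) ⟨hl x hx, arcsin_half ▸ monotone_arcsin (hxy.trans hy)⟩
    (arcsin y) ⟨hl y (hx.trans hxy), arcsin_half ▸ monotone_arcsin hy⟩
    (monotone_arcsin hxy)
  rwa [sin_arcsin (by linarith) (by linarith), sin_arcsin (by linarith) (by linarith)] at h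

lemma three_mul_arcsin_mean_le_of_sum_lt {x y z : ℝ} (hx' : x ≤ 1) (hy : -(1 / 2) ≤ y)
    (hz : -(1 / 2) ≤ z) (hs : 1 / 2 ≤ x + y + z) (hlt : y + z < 0) :
    3 * arcsin ((x + y + z) / 3) ≤ arcsin x + arcsin y + arcsin z := by
  have h1 := sub_le_mul_arcsin_sub_of_half_le hs (by linarith : x + y + z ≤ x) hx'
  have h2 := mul_arcsin_sub_le_sub_of_abs_le_half hy (by linarith : y ≤ -z) (by linarith)
  have h3 := three_mul_arcsin_mean_le_of_add_nonneg (x := 0) (y := 0) (z := x + y + z) (by norm_num)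
    (by norm_num) (by norm_num) (by norm_num) (by linarith) (by norm_num) (by linarith)
  simp only [arcsin_zero, zero_add, arcsin_neg] at h2 h3
  have h4 : 0 < √3 / 2 := by positivity
  have h5 := le_of_mul_le_mul_left (show √3 / 2 * (-arcsin z - arcsin y) ≤
    √3 / 2 * (arcsin x - arcsin (x + y + z)) by linarith) h4
  linarith

lemma three_mul_arcsin_mean_le {x y z : ℝ} (hx : -(1 / 2) ≤ x) (hx' : x ≤ 1) (hy : -(1 / 2) ≤ y)
    (hy' : y ≤ 1) (hz : -(1 / 2) ≤ z) (hz' : z ≤ 1) (hs : 1 / 2 ≤ x + y + z) :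
    3 * arcsin ((x + y + z) / 3) ≤ arcsin x + arcsin y + arcsin z := by
  have exyz : x + y + z = y + z + x := by ring
  have exzy : x + y + z = x + z + y := by ring
  by_cases h1 : y + z < 0
  · exact three_mul_arcsin_mean_le_of_sum_lt hx' hy hz hs h1
  by_cases h2 : x + z < 0
  · have := three_mul_arcsin_mean_le_of_sum_lt hy' hx hz (by linarith) h2
    rw [show y + x + z = x + y + z by ring] at this
    linarith
  by_cases h3 : x + y < 0
  · have := three_mul_arcsin_mean_le_of_sum_lt hz' hx hy (by linarith) h3
    rw [show z + x + y = x + y + z by ring] at this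
    linarith
  by_cases hz1 : (x + y + z) / 3 ≤ z
  · exact three_mul_arcsin_mean_le_of_add_nonneg (by linarith) hx' (by linarith) hy' hz'
      (by linarith) hz1
  by_cases hy1 : (x + y + z) / 3 ≤ y
  · have := three_mul_arcsin_mean_le_of_add_nonneg (x := x) (y := z) (z := y) (by linarith) hx'
      (by linarith)
      hz' hy' (by linarith) (by linarith)
    rw [← exzy] at this
    linarith
  · have := three_mul_arcsin_mean_le_of_add_nonneg (x := y) (y := z) (z := x) (by linarith) hy'
      (by linarith)
      hz' hx' (by linarith) (by linarith)
    rw [← exyz] at this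
    linarith

lemma angle_add_angle_add_angle_le {E : Type*} [NormedAddCommGroup E] [InnerProductSpace ℝ E]
    {a b c o : E} {r lam : ℝ} (hr : 0 < r) (ha : ‖a‖ = r) (hb : ‖b‖ = r) (hc : ‖c‖ = r)
    (ho : ‖o‖ = r) (hlam : lam ≤ -2) (h : a + b + c = lam • o) :
    InnerProductGeometry.angle a b + InnerProductGeometry.angle b c +
      InnerProductGeometry.angle a c ≤ 3 * arccos ((lam ^ 2 - 3) / 6) := by
  have hrr : 0 < r * r := mul_pos hr hr
  have lower : ∀ x y z : E, ‖x‖ = r → ‖y‖ = r → ‖z‖ = r → x + y + z = lam • o →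
      -(1 / 2) ≤ inner ℝ x y / (r * r) := by
    intro x y z hx hy hz hxyz
    have h1 : ‖lam • o‖ ≤ ‖x + y‖ + ‖z‖ := hxyz ▸ norm_add_le _ _
    rw [norm_smul, ho, hz, norm_eq_abs, abs_of_neg (by linarith)] at h1
    have h2 : r ≤ ‖x + y‖ := by nlinarith
    have h3 := norm_add_sq_real x y
    rw [hx, hy] at h3
    rw [le_div_iff₀ hrr]
    nlinarith
  have upper : ∀ x y : E, ‖x‖ = r → ‖y‖ = r → inner ℝ x y / (r * r) ≤ 1 := by
    intro x y hx hy
    rw [div_le_one hrr]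
    have := real_inner_le_norm x y
    rwa [hx, hy] at this
  have hsum : inner ℝ a b / (r * r) + inner ℝ b c / (r * r) + inner ℝ a c / (r * r) =
      (lam ^ 2 - 3) / 2 := by
    have h1 := norm_add_sq_real (a + b) c
    rw [h, norm_add_sq_real, norm_smul, ha, hb, hc, ho, inner_add_left, mul_pow, norm_eq_abs,
      sq_abs] at h1
    field_simp
    linarith
  have key := three_mul_arcsin_mean_le (lower a b c ha hb hc h) (upper a b ha hb)
    (lower b c a hb hc ha (by rw [← h]; abel)) (upper b c hb hc)
    (lower a c b ha hc hb (by rw [← h]; abel)) (upper a c ha hc) (by rw [hsum]; nlinarith)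
  rw [hsum, show (lam ^ 2 - 3) / 2 / 3 = (lam ^ 2 - 3) / 6 by ring] at key
  simp only [InnerProductGeometry.angle, ha, hb, hc, arccos]
  linarith

end ArcsineInequalities

section SignPatterns

open MeasureTheory ProbabilityTheory Real

lemma one_sub_half_indicator_le {E : Type*} [NormedAddCommGroup E] [InnerProductSpace ℝ E]
    {a b c z : E} (ha : inner ℝ a z ≠ 0) (hb : inner ℝ b z ≠ 0) (hc : inner ℝ c z ≠ 0) :
    1 - ((oppositeSigns a b).indicator 1 z + (oppositeSigns b c).indicator 1 z
      + (oppositeSigns a c).indicator 1 z) / 2 ≤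
    if 0 < inner ℝ a z * inner ℝ b z ∧ 0 < inner ℝ a z * inner ℝ c z then (1 : ℝ) else 0 := by
  have hm : ∀ p q : E, (oppositeSigns p q).indicator (1 : E → ℝ) z =
      if inner ℝ p z * inner ℝ q z < 0 then 1 else 0 := fun p q => rfl
  rw [hm, hm, hm]
  generalize inner ℝ a z = x at *
  generalize inner ℝ b z = y at *
  generalize inner ℝ c z = w at *
  rcases ha.lt_or_gt with ha | ha <;> rcases hb.lt_or_gt with hb | hb <;>
    rcases hc.lt_or_gt with hc | hc <;>
    simp [mul_pos_iff, mul_neg_iff, ha, hb, hc, ha.not_gt, hb.not_gt, hc.not_gt]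

variable {V : Type*} [Fintype V] {E : Type*} [NormedAddCommGroup E] [InnerProductSpace ℝ E]
  [FiniteDimensional ℝ E] [MeasurableSpace E] [BorelSpace E]

/-- Rounding a family of vectors of equal norm along a random direction. -/
lemma exists_generic_direction {p : V → E} {r lam : ℝ} (hr : 0 < r) (hp : ∀ v, ‖p v‖ = r)
    (hlam : lam ≤ -2) (a b c : V → V) (h : ∀ v, p (a v) + p (b v) + p (c v) = lam • p v) :
    ∃ z : E, (∀ v, inner ℝ (p v) z ≠ 0) ∧
      Fintype.card V * (1 - 3 / (2 * π) * arccos ((lam ^ 2 - 3) / 6)) ≤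
      (Finset.univ.filter fun v => 0 < inner ℝ (p (a v)) z * inner ℝ (p (b v)) z ∧
        0 < inner ℝ (p (a v)) z * inner ℝ (p (c v)) z).card := by
  have hp0 : ∀ v, p v ≠ 0 := fun v => norm_pos_iff.1 ((hp v).symm ▸ hr)
  let f : E → ℝ := fun z => ∑ v, (1 - ((oppositeSigns (p (a v)) (p (b v))).indicator 1 z +
    (oppositeSigns (p (b v)) (p (c v))).indicator 1 z
      + (oppositeSigns (p (a v)) (p (c v))).indicator 1 z) / 2)
  have hind : ∀ u v, Integrable ((oppositeSigns (p u) (p v)).indicator (1 : E → ℝ))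
      (stdGaussian E) := fun u v =>
    (integrable_const (1 : ℝ)).indicator (measurableSet_oppositeSigns _ _)
  have hfv : ∀ v, Integrable (fun z => 1 - ((oppositeSigns (p (a v)) (p (b v))).indicator 1 z +
    (oppositeSigns (p (b v)) (p (c v))).indicator 1 z
      + (oppositeSigns (p (a v)) (p (c v))).indicator (1 : E → ℝ) z) / 2) (stdGaussian E) :=
    fun v => (integrable_const _).sub ((((hind _ _).add (hind _ _)).add (hind _ _)).div_const _)
  have hnull : stdGaussian E (⋃ v, {z | inner ℝ (p v) z = 0}) = 0 :=
    measure_iUnion_null fun v => stdGaussian_inner_eq_zero (hp0 v)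
  obtain ⟨z, hz, hle⟩ := exists_notMem_null_integral_le (f := f)
    (integrable_finsetSum _ fun v _ => hfv v) hnull
  have hz' : ∀ v, inner ℝ (p v) z ≠ 0 := by simpa using hz
  refine ⟨z, hz', ?_⟩
  have hbound : f z ≤ (Finset.univ.filter fun v => 0 < inner ℝ (p (a v)) z * inner ℝ (p (b v)) z ∧
        0 < inner ℝ (p (a v)) z * inner ℝ (p (c v)) z).card := by
    rw [Finset.card_filter, Nat.cast_sum]
    refine Finset.sum_le_sum fun v _ => ?_
    push_cast
    exact one_sub_half_indicator_le (hz' _) (hz' _) (hz' _)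
  refine le_trans ?_ (hle.trans hbound)
  rw [integral_finsetSum _ fun v _ => hfv v, ← nsmul_eq_mul, ← Finset.card_univ]
  refine Finset.card_nsmul_le_sum _ _ _ fun v _ => ?_
  have hsum : Integrable (fun z => (oppositeSigns (p (a v)) (p (b v))).indicator (1 : E → ℝ) z +
    (oppositeSigns (p (b v)) (p (c v))).indicator 1 z) (stdGaussian E) := (hind _ _).add (hind _ _)
  have hsum' : Integrable (fun z => (oppositeSigns (p (a v)) (p (b v))).indicator (1 : E → ℝ) z +
    (oppositeSigns (p (b v)) (p (c v))).indicator 1 z +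
    (oppositeSigns (p (a v)) (p (c v))).indicator 1 z) (stdGaussian E) := hsum.add (hind _ _)
  rw [integral_sub (integrable_const _) (hsum'.div_const _), integral_div,
    integral_add hsum (hind _ _), integral_add (hind _ _) (hind _ _),
    integral_indicator_one (measurableSet_oppositeSigns _ _),
    integral_indicator_one (measurableSet_oppositeSigns _ _),
    integral_indicator_one (measurableSet_oppositeSigns _ _), integral_const]
  have h1 := stdGaussian_oppositeSigns_le (hp0 (a v)) (hp0 (b v))
  have h2 := stdGaussian_oppositeSigns_le (hp0 (b v)) (hp0 (c v))
  have h3 := stdGaussian_oppositeSigns_le (hp0 (a v)) (hp0 (c v))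
  have h4 := angle_add_angle_add_angle_le hr (hp _) (hp _) (hp _) (hp _) hlam (h v)
  have h5 := div_le_div_of_nonneg_right h4 pi_pos.le
  rw [add_div, add_div] at h5
  rw [show 3 / (2 * π) * arccos ((lam ^ 2 - 3) / 6) = (3 * arccos ((lam ^ 2 - 3) / 6) / π) / 2 by
    field_simp]
  simp only [probReal_univ, smul_eq_mul, mul_one]
  linarith

end SignPatterns

namespace SimpleGraph

variable {V : Type*} [DecidableEq V] {G : SimpleGraph V} [DecidableRel G.Adj]

lemma Walk.IsCycle.exists_isIndepSet_of_isCycles [Finite V] {H : SimpleGraph V} {v : V}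
    {p : H.Walk v v} (hp : p.IsCycle) (hH : H.IsCycles) :
    ∃ S : Finset V, S.card = p.length / 2 ∧ (∀ u ∈ S, u ∈ p.support) ∧
      ∀ u ∈ S, ∀ w ∈ S, ¬ H.Adj u w := by
  classical
  have : LocallyFinite H := fun v => Fintype.ofFinite _
  have h3 := hp.three_le_length
  refine ⟨(Finset.range (p.length / 2)).image fun i => p.getVert (2 * i + 1), ?_, ?_, ?_⟩
  · rw [Finset.card_image_of_injOn, Finset.card_range]
    intro i hi j hj hij
    simp only [Finset.coe_range, Set.mem_Iio] at hi hj
    have := hp.getVert_injOn (by simp; lia) (by simp; lia) hij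
    lia
  · intro u hu
    obtain ⟨i, -, rfl⟩ := Finset.mem_image.1 hu
    exact p.getVert_mem_support _
  · intro u hu w hw hadj
    obtain ⟨i, hi, rfl⟩ := Finset.mem_image.1 hu
    obtain ⟨j, hj, rfl⟩ := Finset.mem_image.1 hw
    rw [Finset.mem_range] at hi hj
    rw [← hp.adj_toSubgraph_iff_of_isCycles hH (by simp), Walk.toSubgraph_adj_iff] at hadj
    obtain ⟨k, hk, hkl⟩ := hadj
    have key : ∀ a b : ℕ, a < p.length / 2 → b < p.length / 2 →
        p.getVert k = p.getVert (2 * a + 1) → p.getVert (k + 1) ≠ p.getVert (2 * b + 1) := by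
      intro a b ha hb h1 h2
      have e2 := hp.getVert_injOn (by simp; lia) (by simp; lia) h2
      rcases Nat.eq_zero_or_pos k with rfl | hk0
      · rw [Walk.getVert_zero] at h1
        have := (hp.getVert_endpoint_iff (i := 2 * a + 1) (by lia)).1 h1.symm
        lia
      · have e1 := hp.getVert_injOn (by simp; lia) (by simp; lia) h1
        lia
    rcases Sym2.eq_iff.1 hk with ⟨h1, h2⟩ | ⟨h1, h2⟩
    · exact key i j hi hj h1 h2
    · exact key j i hj hi h1 h2

lemma exists_isIndepSet_subset_of_degree_le_two [Fintype V] {g : ℕ}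
    (hodd : ∀ (v : V) (p : G.Walk v v), p.IsCycle → Odd p.length → g ≤ p.length) (W : Finset V)
    (hW : ∀ v ∈ W, (W.filter (G.Adj v)).card ≤ 2) :
    ∃ S ⊆ W, (∀ u ∈ S, ∀ w ∈ S, ¬ G.Adj u w) ∧
      g * W.card + (g + 1) * (W.filter fun v => ∀ u ∈ W, ¬ G.Adj v u).card ≤
        2 * g * S.card + W.card := by
  induction W using Finset.strongInduction with
  | H W ih =>
  have hdeg : ∀ W' ⊆ W, ∀ v ∈ W', (W'.filter (G.Adj v)).card ≤ 2 := fun W' h v hv =>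
    (Finset.card_le_card (Finset.filter_subset_filter _ h)).trans (hW v (h hv))
  by_cases h0 : ∃ v ∈ W, (W.filter (G.Adj v)).card ≤ 1
  · obtain ⟨v, hv, hv1⟩ := h0
    rcases Finset.eq_empty_or_nonempty (W.filter (G.Adj v)) with he | ⟨u, hu⟩
    · have hvi : ∀ u ∈ W, ¬ G.Adj v u := fun u hu h => by
        simpa [he] using Finset.mem_filter.2 ⟨hu, h⟩
      obtain ⟨S, hSW, hS, hle⟩ := ih (W.erase v) (Finset.erase_ssubset hv)
        (hdeg _ (Finset.erase_subset _ _))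
      have hvS : v ∉ S := fun h => Finset.notMem_erase v W (hSW h)
      have hSW' : S ⊆ W := hSW.trans (Finset.erase_subset _ _)
      refine ⟨insert v S, Finset.insert_subset hv hSW', ?_, ?_⟩
      · intro a ha b hb hab
        rcases Finset.mem_insert.1 ha with rfl | ha' <;>
          rcases Finset.mem_insert.1 hb with rfl | hb'
        · exact hab.ne rfl
        · exact hvi _ (hSW' hb') hab
        · exact hvi _ (hSW' ha') hab.symm
        · exact hS a ha' b hb' hab
      · have hi : (W.filter fun v => ∀ u ∈ W, ¬ G.Adj v u).card ≤
            ((W.erase v).filter fun w => ∀ u ∈ W.erase v, ¬ G.Adj w u).card + 1 := by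
          rw [← Finset.card_insert_of_notMem (a := v) (by simp)]
          refine Finset.card_le_card fun w hw => ?_
          simp only [Finset.mem_filter, Finset.mem_insert, Finset.mem_erase] at hw ⊢
          by_cases hwv : w = v
          · exact Or.inl hwv
          · exact Or.inr ⟨⟨hwv, hw.1⟩, fun u hu => hw.2 u hu.2⟩
        rw [Finset.card_insert_of_notMem hvS]
        have hc := Finset.card_erase_add_one hv
        nlinarith
    · obtain ⟨huW, huv⟩ := Finset.mem_filter.1 hu
      have hun : ∀ w ∈ W, G.Adj v w → w = u := fun w hw h =>
        Finset.card_le_one.1 hv1 _ (Finset.mem_filter.2 ⟨hw, h⟩) _ hu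
      have hsub : (W.erase v).erase u ⊆ W :=
        (Finset.erase_subset _ _).trans (Finset.erase_subset _ _)
      have hu' : u ∈ W.erase v := Finset.mem_erase.2 ⟨huv.ne', huW⟩
      obtain ⟨S, hSW, hS, hle⟩ := ih ((W.erase v).erase u)
        ((Finset.erase_ssubset hu').trans (Finset.erase_ssubset hv)) (hdeg _ hsub)
      have hvS : v ∉ S := fun h => by simpa using hSW h
      have huS : u ∉ S := fun h => by simpa using hSW h
      refine ⟨insert v S, Finset.insert_subset hv (hSW.trans hsub), ?_, ?_⟩
      · have hvi : ∀ w ∈ S, ¬ G.Adj v w := fun w hw h =>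
          huS (hun w (hsub (hSW hw)) h ▸ hw)
        intro a ha b hb hab
        rcases Finset.mem_insert.1 ha with rfl | ha' <;>
          rcases Finset.mem_insert.1 hb with rfl | hb'
        · exact hab.ne rfl
        · exact hvi _ hb' hab
        · exact hvi _ ha' hab.symm
        · exact hS a ha' b hb' hab
      · have hi : (W.filter fun v => ∀ u ∈ W, ¬ G.Adj v u).card ≤
            (((W.erase v).erase u).filter
              fun w => ∀ x ∈ (W.erase v).erase u, ¬ G.Adj w x).card := by
          refine Finset.card_le_card fun w hw => ?_
          simp only [Finset.mem_filter, Finset.mem_erase] at hw ⊢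
          refine ⟨⟨?_, ?_, hw.1⟩, fun x hx => hw.2 x hx.2.2⟩
          · rintro rfl
            exact hw.2 v hv huv.symm
          · rintro rfl
            exact hw.2 u huW huv
        rw [Finset.card_insert_of_notMem hvS]
        have hc := Finset.card_erase_add_one hv
        have hc' := Finset.card_erase_add_one hu'
        nlinarith
  · push Not at h0
    have h2 : ∀ v ∈ W, (W.filter (G.Adj v)).card = 2 := fun v hv =>
      le_antisymm (hW v hv) (h0 v hv)
    rcases W.eq_empty_or_nonempty with rfl | ⟨v, hv⟩
    · exact ⟨∅, by simp⟩
    let H : SimpleGraph V :=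
      { Adj := fun a b => G.Adj a b ∧ a ∈ W ∧ b ∈ W
        symm := ⟨fun a b h => ⟨h.1.symm, h.2.2, h.2.1⟩⟩
        loopless := ⟨fun a h => h.1.ne rfl⟩ }
    have hHG : H ≤ G := fun a b h => h.1
    have hnb : ∀ v ∈ W, H.neighborSet v = (W.filter (G.Adj v) : Finset V) := by
      intro v hv
      ext w
      simp [H, hv, and_comm]
    have hH : H.IsCycles := by
      rintro v ⟨w, hw⟩
      rw [hnb v hw.2.1, Set.ncard_coe_finset, h2 v hw.2.1]
    have hne : (H.neighborSet v).Nonempty := by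
      rw [hnb v hv, Finset.coe_nonempty, ← Finset.card_pos, h2 v hv]
      norm_num
    obtain ⟨p, hp, hpc⟩ := hH.exists_cycle_toSubgraph_verts_eq_connectedComponentSupp
      (c := H.connectedComponentMk v) rfl hne
    obtain ⟨T, hTc, hTp, hT⟩ := hp.exists_isIndepSet_of_isCycles hH
    have hpW : ∀ u ∈ p.support, u ∈ W := by
      intro u hu
      have hnc := hp.ncard_neighborSet_toSubgraph_eq_two hu
      obtain ⟨w, hw⟩ : (p.toSubgraph.neighborSet u).Nonempty :=
        Set.nonempty_of_ncard_ne_zero (by lia)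
      exact (p.toSubgraph.adj_sub hw).2.1
    have hclosed : ∀ u ∈ p.support, ∀ w ∈ W, G.Adj u w → w ∈ p.support := by
      intro u hu w hw huw
      have hadj : H.Adj u w := ⟨huw, hpW u hu, hw⟩
      rw [← Walk.mem_verts_toSubgraph, hpc] at hu ⊢
      exact (ConnectedComponent.connectedComponentMk_eq_of_adj hadj).symm.trans hu
    let P := p.support.toFinset
    have hPW : P ⊆ W := fun u hu => hpW u (List.mem_toFinset.1 hu)
    have hPc : P.card = p.length := by
      have htail : P = p.support.tail.toFinset := by
        ext u
        rw [List.mem_toFinset, List.mem_toFinset, p.mem_support_iff]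
        refine or_iff_right_of_imp ?_
        rintro rfl
        exact p.end_mem_tail_support hp.not_nil
      rw [htail, List.toFinset_card_of_nodup hp.support_nodup, List.length_tail,
        Walk.length_support, Nat.add_sub_cancel]
    have hvP : v ∈ P := by simp [P]
    obtain ⟨S, hSW, hS, hle⟩ := ih (W \ P) (Finset.sdiff_ssubset hPW ⟨v, hvP⟩)
      (hdeg _ Finset.sdiff_subset)
    have hlen : g * p.length ≤ 2 * g * (p.length / 2) + p.length := by
      have hgc := hodd v (p.mapLe hHG) (hp.mapLe hHG)
      rw [Walk.length_mapLe] at hgc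
      rcases Nat.even_or_odd' p.length with ⟨k, hk | hk⟩
      · rw [hk, Nat.mul_div_cancel_left k two_pos]
        nlinarith
      · have := hgc ⟨k, hk⟩
        rw [show p.length / 2 = k by lia]
        rw [hk] at this ⊢
        nlinarith
    have hTP : T ⊆ P := fun u hu => List.mem_toFinset.2 (hTp u hu)
    have hST : Disjoint T S := Finset.disjoint_left.2 fun u hu hu' =>
      (Finset.mem_sdiff.1 (hSW hu')).2 (hTP hu)
    have hcross : ∀ a ∈ T, ∀ b ∈ S, ¬ G.Adj a b := fun a ha b hb hab =>
      (Finset.mem_sdiff.1 (hSW hb)).2 (List.mem_toFinset.2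
        (hclosed a (hTp a ha) b (Finset.mem_sdiff.1 (hSW hb)).1 hab))
    refine ⟨T ∪ S, Finset.union_subset (hTP.trans hPW) (hSW.trans Finset.sdiff_subset), ?_, ?_⟩
    · intro a ha b hb hab
      rcases Finset.mem_union.1 ha with ha | ha <;> rcases Finset.mem_union.1 hb with hb | hb
      · exact hT a ha b hb ⟨hab, hPW (hTP ha), hPW (hTP hb)⟩
      · exact hcross a ha b hb hab
      · exact hcross b hb a ha hab.symm
      · exact hS a ha b hb hab
    · have hi : (W.filter fun v => ∀ u ∈ W, ¬ G.Adj v u) = ∅ := by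
        refine Finset.filter_eq_empty_iff.2 fun w hw hw' => ?_
        have := h2 w hw
        rw [Finset.filter_eq_empty_iff.2 fun {u} hu => hw' u hu] at this
        simp at this
      have hc := Finset.card_sdiff_add_card_eq_card hPW
      rw [hi, Finset.card_union_of_disjoint hST, hTc, Finset.card_empty]
      rw [hPc] at hc
      nlinarith

end SimpleGraph

section LeastEigenvalue

variable {V : Type*} [Fintype V] [DecidableEq V]

lemma Matrix.IsHermitian.mul_dotProduct_self_le {A : Matrix V V ℝ} (hA : A.IsHermitian) {lam : ℝ}
    (hlam : lam ∈ lowerBounds {μ : ℝ | ∃ x : V → ℝ, x ≠ 0 ∧ A *ᵥ x = μ • x}) (x : V → ℝ) :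
    lam * (x ⬝ᵥ x) ≤ x ⬝ᵥ (A *ᵥ x) := by
  have hB : (A - lam • 1).IsHermitian :=
    hA.sub (by simp [Matrix.IsHermitian])
  have hpos : (A - lam • 1).PosSemidef := by
    rw [hB.posSemidef_iff_eigenvalues_nonneg]
    intro i
    have h1 := hB.mulVec_eigenvectorBasis i
    have h2 : A *ᵥ (hB.eigenvectorBasis i) =
        (hB.eigenvalues i + lam) • (hB.eigenvectorBasis i : V → ℝ) := by
      rw [Matrix.sub_mulVec, Matrix.smul_mulVec, Matrix.one_mulVec] at h1
      rw [add_smul, ← h1, sub_add_cancel]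
    have h3 : (hB.eigenvectorBasis i : V → ℝ) ≠ 0 := fun h =>
      hB.eigenvectorBasis.orthonormal.ne_zero i (by ext j; exact congrFun h j)
    have := hlam ⟨_, h3, h2⟩
    simpa using this
  have := hpos.dotProduct_mulVec_nonneg x
  rw [star_trivial, Matrix.sub_mulVec, Matrix.smul_mulVec, Matrix.one_mulVec, dotProduct_sub,
    dotProduct_smul, smul_eq_mul] at this
  linarith

lemma Matrix.mul_finrank_ker_toLin'_of_mul_self {P : Matrix V V ℝ} {k : ℝ} (hk : k ≠ 0)
    (hP : P * P = k • P) :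
    k * Module.finrank ℝ (LinearMap.ker (Matrix.toLin' P)) = k * Fintype.card V - P.trace := by
  have hproj : LinearMap.IsProj (LinearMap.ker (Matrix.toLin' P))
      (Matrix.toLin' (1 - k⁻¹ • P)) := by
    constructor
    · intro x
      rw [LinearMap.mem_ker, Matrix.toLin'_apply, Matrix.toLin'_apply, Matrix.mulVec_mulVec,
        mul_sub, mul_one, Matrix.mul_smul, hP, smul_smul, inv_mul_cancel₀ hk, one_smul, sub_self,
        Matrix.zero_mulVec]
    · intro x hx
      rw [LinearMap.mem_ker, Matrix.toLin'_apply] at hx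
      rw [Matrix.toLin'_apply, Matrix.sub_mulVec, Matrix.smul_mulVec, hx, smul_zero, sub_zero,
        Matrix.one_mulVec]
  rw [← hproj.trace, Matrix.trace_toLin'_eq, Matrix.trace_sub, Matrix.trace_one, Matrix.trace_smul,
    smul_eq_mul]
  field_simp

end LeastEigenvalue
namespace SimpleGraph

section Cubic

variable {V : Type*} [Fintype V] [DecidableEq V] {G : SimpleGraph V} [DecidableRel G.Adj]

lemma IsRegularOfDegree.exists_adj_iff (hreg : G.IsRegularOfDegree 3) (v : V) :
    ∃ a b c : V, a ≠ b ∧ a ≠ c ∧ b ≠ c ∧ ∀ w, G.Adj v w ↔ w = a ∨ w = b ∨ w = c := by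
  obtain ⟨a, b, c, hab, hac, hbc, h⟩ := Finset.card_eq_three.1 (hreg v)
  refine ⟨a, b, c, hab, hac, hbc, fun w => ?_⟩
  rw [← mem_neighborFinset, h]
  simp

lemma IsRegularOfDegree.adj_iff (hreg : G.IsRegularOfDegree 3) {v a b c : V} (ha : G.Adj v a)
    (hb : G.Adj v b) (hc : G.Adj v c) (hab : a ≠ b) (hac : a ≠ c) (hbc : b ≠ c) (w : V) :
    G.Adj v w ↔ w = a ∨ w = b ∨ w = c := by
  obtain ⟨x, y, z, hxy, hxz, hyz, h⟩ := hreg.exists_adj_iff v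
  rw [h] at *
  grind

lemma adjMatrix_mulVec_apply_of_adj_iff {v a b c : V} (hab : a ≠ b) (hac : a ≠ c) (hbc : b ≠ c)
    (h : ∀ w, G.Adj v w ↔ w = a ∨ w = b ∨ w = c) (x : V → ℝ) :
    (G.adjMatrix ℝ *ᵥ x) v = x a + x b + x c := by
  have : G.neighborFinset v = {a, b, c} := by ext w; simp [h]
  rw [adjMatrix_mulVec_apply, this, Finset.sum_insert (by simp [hab, hac]),
    Finset.sum_insert (by simp [hbc]), Finset.sum_singleton, add_assoc]

/-- The Rayleigh quotient bound coming from the vector `e_u - e_v` at an edge. -/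
lemma le_neg_one_of_rayleigh {lam : ℝ}
    (hlam : ∀ x : V → ℝ, lam * (x ⬝ᵥ x) ≤ x ⬝ᵥ (G.adjMatrix ℝ *ᵥ x)) {u v : V}
    (huv : G.Adj u v) : lam ≤ -1 := by
  have := hlam (Pi.single u 1 - Pi.single v 1)
  simp [Matrix.mulVec_sub, huv, huv.symm, huv.ne, huv.ne'] at this
  linarith

lemma le_neg_two_of_rayleigh_of_triangleFree (hreg : G.IsRegularOfDegree 3) {lam : ℝ}
    (hlam : ∀ x : V → ℝ, lam * (x ⬝ᵥ x) ≤ x ⬝ᵥ (G.adjMatrix ℝ *ᵥ x))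
    (hG : ∀ u v w, G.Adj u v → G.Adj v w → ¬ G.Adj u w) (u : V) : lam ≤ -2 := by
  obtain ⟨v, a, b, hva, hvb, hab, hu⟩ := hreg.exists_adj_iff u
  have huv : G.Adj u v := by simp [hu]
  have hua : G.Adj u a := by simp [hu]
  have hub : G.Adj u b := by simp [hu]
  obtain ⟨c, d, hcu, hdu, hcd, hvc, hvd⟩ :
      ∃ c d, c ≠ u ∧ d ≠ u ∧ c ≠ d ∧ G.Adj v c ∧ G.Adj v d := by
    obtain ⟨x, y, z, hxy, hxz, hyz, hv⟩ := hreg.exists_adj_iff v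
    have := (hv u).1 huv.symm
    rcases this with rfl | rfl | rfl
    · exact ⟨y, z, hxy.symm, hxz.symm, hyz, by simp [hv], by simp [hv]⟩
    · exact ⟨x, z, hxy, hyz.symm, hxz, by simp [hv], by simp [hv]⟩
    · exact ⟨x, y, hxz, hyz, hxy, by simp [hv], by simp [hv]⟩
  have n1 : ¬ G.Adj a b := hG _ _ _ hua.symm hub
  have n2 : ¬ G.Adj c d := hG _ _ _ hvc.symm hvd
  have n3 : ¬ G.Adj u c := hG _ _ _ huv hvc
  have n4 : ¬ G.Adj u d := hG _ _ _ huv hvd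
  have n5 : ¬ G.Adj v a := hG _ _ _ huv.symm hua
  have n6 : ¬ G.Adj v b := hG _ _ _ huv.symm hub
  have d1 : a ≠ c := by rintro rfl; exact n5 hvc
  have d2 : a ≠ d := by rintro rfl; exact n5 hvd
  have d3 : b ≠ c := by rintro rfl; exact n6 hvc
  have d4 : b ≠ d := by rintro rfl; exact n6 hvd
  have := hlam ((2 : ℝ) • Pi.single u 1 - (2 : ℝ) • Pi.single v 1 - Pi.single a 1 - Pi.single b 1
    + Pi.single c 1 + Pi.single d 1)
  have e : ∀ i j : V, Pi.single i 1 ⬝ᵥ (G.adjMatrix ℝ *ᵥ Pi.single j 1) =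
    if G.Adj i j then 1 else 0 := by simp
  have e' : ∀ i j : V, (Pi.single i 1 : V → ℝ) ⬝ᵥ Pi.single j 1 = if i = j then 1 else 0 := by
    simp [Pi.single_apply, eq_comm]
  simp only [Matrix.mulVec_sub, Matrix.mulVec_add, Matrix.mulVec_smul, dotProduct_add,
    dotProduct_sub, add_dotProduct, sub_dotProduct, smul_dotProduct, dotProduct_smul, e, e',
    huv, hua, hub, hvc, hvd, n1, n2, n3, n4, n5, n6, huv.ne, hua.ne, hub.ne, hvc.ne, hvd.ne,
    huv.ne', hua.ne', hub.ne', hvc.ne', hvd.ne', hcu, hdu, hcu.symm, hdu.symm, hab, hab.symm, hva,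
    hva.symm, hvb, hvb.symm, hcd, hcd.symm, d1, d1.symm, d2, d2.symm, d3, d3.symm, d4, d4.symm,
    G.adj_comm a u, G.adj_comm a v, G.adj_comm b u, G.adj_comm b v, G.adj_comm c u, G.adj_comm c v,
    G.adj_comm d u, G.adj_comm d v, G.adj_comm b a, G.adj_comm c a, G.adj_comm c b, G.adj_comm d a,
    G.adj_comm d b, G.adj_comm d c, G.adj_comm v u, SimpleGraph.irrefl, if_true, if_false,
    smul_eq_mul] at this
  split_ifs at this <;> linarith

end Cubic

section Triangles

variable {V : Type*} [Fintype V] [DecidableEq V] {G : SimpleGraph V} [DecidableRel G.Adj]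

/-- If every neighbourhood in a cubic graph contains a path of length two, then all closed
neighbourhoods are copies of `K₄`. -/
lemma IsRegularOfDegree.closedNeighborhood_eq (hreg : G.IsRegularOfDegree 3)
    (h : ∀ v, ∃ a b c, a ≠ b ∧ a ≠ c ∧ b ≠ c ∧ G.Adj v a ∧ G.Adj v b ∧ G.Adj v c ∧
      G.Adj a b ∧ G.Adj b c) (v : V) :
    ∃ a b c, a ≠ b ∧ a ≠ c ∧ b ≠ c ∧ G.Adj v a ∧ G.Adj v b ∧ G.Adj v c ∧
      G.Adj a b ∧ G.Adj b c ∧ G.Adj a c := by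
  obtain ⟨a, b, c, hab, hac, hbc, hva, hvb, hvc, eab, ebc⟩ := h v
  refine ⟨a, b, c, hab, hac, hbc, hva, hvb, hvc, eab, ebc, ?_⟩
  have hv := hreg.adj_iff hva hvb hvc hab hac hbc
  have hb := hreg.adj_iff hvb.symm eab.symm ebc hva.ne hvc.ne hac
  obtain ⟨x, y, z, hxy, hxz, hyz, hax, hay, haz, exy, eyz⟩ := h a
  have ha := hreg.adj_iff hax hay haz hxy hxz hyz
  have h1 := (ha v).1 hva.symm
  have h2 := (ha b).1 eab
  have s := G.adj_comm
  have i : ∀ v, ¬ G.Adj v v := fun _ => G.irrefl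
  grind

lemma IsRegularOfDegree.sq_le_three_of_closedNeighborhood (hreg : G.IsRegularOfDegree 3)
    (h : ∀ v, ∃ a b c, a ≠ b ∧ a ≠ c ∧ b ≠ c ∧ G.Adj v a ∧ G.Adj v b ∧ G.Adj v c ∧
      G.Adj a b ∧ G.Adj b c ∧ G.Adj a c) {lam : ℝ} (hlam : lam ≤ -1) {x : V → ℝ}
    (hx : x ≠ 0) (hAx : G.adjMatrix ℝ *ᵥ x = lam • x) : lam ^ 2 ≤ 3 := by
  obtain ⟨v, hv⟩ := Function.ne_iff.1 hx
  obtain ⟨a, b, c, hab, hac, hbc, hva, hvb, hvc, eab, ebc, eac⟩ := h v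
  have e : ∀ {v a b c : V}, a ≠ b → a ≠ c → b ≠ c → G.Adj v a → G.Adj v b → G.Adj v c →
      x a + x b + x c = lam * x v := by
    intro v a b c hab hac hbc hva hvb hvc
    rw [← adjMatrix_mulVec_apply_of_adj_iff hab hac hbc (hreg.adj_iff hva hvb hvc hab hac hbc),
      hAx, Pi.smul_apply, smul_eq_mul]
  have e1 := e hab hac hbc hva hvb hvc
  have e2 := e hvb.ne hvc.ne hbc hva.symm eab eac
  have e3 := e hva.ne hvc.ne hac hvb.symm eab.symm ebc
  have e4 := e hva.ne hvb.ne hab hvc.symm eac.symm ebc.symm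
  by_contra hlt
  have hl : lam + 1 ≠ 0 := by
    intro h0
    exact hlt (by rw [show lam = -1 by linarith]; norm_num)
  have f1 : x a = x v := mul_left_cancel₀ hl (by linarith)
  have f2 : x b = x v := mul_left_cancel₀ hl (by linarith)
  have f3 : x c = x v := mul_left_cancel₀ hl (by linarith)
  rw [f1, f2, f3] at e1
  have : lam = 3 := mul_right_cancel₀ (show x v ≠ 0 from hv) (by linarith)
  linarith

/-- The edges that lie in no triangle, together with the diagonal, as a `0-1` matrix. -/
def mateMatrix (G : SimpleGraph V) [DecidableRel G.Adj] : Matrix V V ℝ :=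
  Matrix.of fun u v => if u = v ∨ (G.Adj u v ∧ ¬ ∃ w, G.Adj u w ∧ G.Adj v w) then 1 else 0

/-- The edges that lie in a triangle, together with the diagonal, as a `0-1` matrix. -/
def triangleMatrix (G : SimpleGraph V) [DecidableRel G.Adj] : Matrix V V ℝ :=
  Matrix.of fun u v => if u = v ∨ (G.Adj u v ∧ ∃ w, G.Adj u w ∧ G.Adj v w) then 1 else 0

lemma adjMatrix_eq_mateMatrix_add_triangleMatrix :
    G.adjMatrix ℝ + (2 : ℝ) • 1 = G.mateMatrix + G.triangleMatrix := by
  ext u v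
  by_cases h : u = v
  · subst h
    norm_num [mateMatrix, triangleMatrix]
  · by_cases h1 : G.Adj u v <;> by_cases h2 : ∃ w, G.Adj u w ∧ G.Adj v w <;>
      simp [mateMatrix, triangleMatrix, h, h1, h2, -not_exists, -not_and]

lemma trace_mateMatrix : G.mateMatrix.trace = Fintype.card V := by
  simp [mateMatrix, Matrix.trace]

lemma trace_triangleMatrix : G.triangleMatrix.trace = Fintype.card V := by
  simp [triangleMatrix, Matrix.trace]

lemma triangle_edge_iff (hreg : G.IsRegularOfDegree 3)
    (hno : ∀ v a b c, a ≠ b → a ≠ c → b ≠ c → G.Adj v a → G.Adj v b → G.Adj v c →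
      G.Adj a b → ¬ G.Adj b c)
    {v a b : V} (hva : G.Adj v a) (hvb : G.Adj v b) (hab : G.Adj a b) (u : V) :
    (v = u ∨ (G.Adj v u ∧ ∃ w, G.Adj v w ∧ G.Adj u w)) ↔ (u = v ∨ u = a ∨ u = b) := by
  have k := hno v
  constructor
  · rintro (rfl | ⟨h, w, hw, hwu⟩)
    · exact Or.inl rfl
    · by_contra! hne
      have k1 := k a b u hab.ne hne.2.1.symm hne.2.2.symm hva hvb h hab
      have k2 := k b a u hab.ne' hne.2.2.symm hne.2.1.symm hvb hva h hab.symm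
      have := (hreg.adj_iff hva hvb h hab.ne hne.2.1.symm hne.2.2.symm w).1 hw
      rcases this with rfl | rfl | rfl
      · exact k2 hwu.symm
      · exact k1 hwu.symm
      · exact hwu.ne rfl
  · rintro (rfl | rfl | rfl)
    · exact Or.inl rfl
    · exact Or.inr ⟨hva, b, hvb, hab⟩
    · exact Or.inr ⟨hvb, a, hva, hab.symm⟩

lemma triangleMatrix_mul_self (hreg : G.IsRegularOfDegree 3)
    (hno : ∀ v a b c, a ≠ b → a ≠ c → b ≠ c → G.Adj v a → G.Adj v b → G.Adj v c →
      G.Adj a b → ¬ G.Adj b c)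
    (htri : ∀ v, ∃ a b, G.Adj v a ∧ G.Adj v b ∧ G.Adj a b) :
    G.triangleMatrix * G.triangleMatrix = (3 : ℝ) • G.triangleMatrix := by
  ext v u
  obtain ⟨a, b, hva, hvb, hab⟩ := htri v
  have hv := triangle_edge_iff hreg hno hva hvb hab
  have ha := fun u => (triangle_edge_iff hreg hno hva.symm hab hvb u).trans
    (show _ ↔ (u = v ∨ u = a ∨ u = b) by tauto)
  have hb := fun u => (triangle_edge_iff hreg hno hvb.symm hab.symm hva u).trans
    (show _ ↔ (u = v ∨ u = a ∨ u = b) by tauto)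
  simp only [Matrix.mul_apply, triangleMatrix, Matrix.of_apply, hv, Matrix.smul_apply, ite_mul,
    one_mul, zero_mul]
  rw [← Finset.sum_filter,
    show (Finset.univ.filter fun j => j = v ∨ j = a ∨ j = b) = {v, a, b} by ext; simp,
    Finset.sum_insert (by simp [hva.ne, hvb.ne]), Finset.sum_insert (by simp [hab.ne]),
    Finset.sum_singleton]
  simp only [hv, ha, hb]
  split_ifs <;> norm_num

lemma exists_mate (hreg : G.IsRegularOfDegree 3)
    (hno : ∀ v a b c, a ≠ b → a ≠ c → b ≠ c → G.Adj v a → G.Adj v b → G.Adj v c →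
      G.Adj a b → ¬ G.Adj b c)
    (htri : ∀ v, ∃ a b, G.Adj v a ∧ G.Adj v b ∧ G.Adj a b)
    (v : V) : ∃ c, G.Adj v c ∧ (¬ ∃ w, G.Adj v w ∧ G.Adj c w) ∧
    ∀ u, G.Adj v u → (¬ ∃ w, G.Adj v w ∧ G.Adj u w) → u = c := by
  obtain ⟨a, b, hva, hvb, hab⟩ := htri v
  have hv := triangle_edge_iff hreg hno hva hvb hab
  obtain ⟨c, hvc, hca, hcb⟩ : ∃ c, G.Adj v c ∧ c ≠ a ∧ c ≠ b := by
    obtain ⟨x, y, z, hxy, hxz, hyz, h⟩ := hreg.exists_adj_iff v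
    by_contra! hne
    have := hne x; have := hne y; have := hne z
    grind
  have hn := hreg.adj_iff hva hvb hvc hab.ne hca.symm hcb.symm
  refine ⟨c, hvc, fun hw => ?_, fun u hu hw => ?_⟩
  · rcases (hv c).1 (Or.inr ⟨hvc, hw⟩) with h | h | h
    · exact hvc.ne h.symm
    · exact hca h
    · exact hcb h
  · rcases (hn u).1 hu with rfl | rfl | rfl
    · exact absurd ⟨b, hvb, hab⟩ hw
    · exact absurd ⟨a, hva, hab.symm⟩ hw
    · rfl

lemma mateMatrix_mul_self (hreg : G.IsRegularOfDegree 3)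
    (hno : ∀ v a b c, a ≠ b → a ≠ c → b ≠ c → G.Adj v a → G.Adj v b → G.Adj v c →
      G.Adj a b → ¬ G.Adj b c)
    (htri : ∀ v, ∃ a b, G.Adj v a ∧ G.Adj v b ∧ G.Adj a b) :
    G.mateMatrix * G.mateMatrix = (2 : ℝ) • G.mateMatrix := by
  ext v u
  obtain ⟨c, hvc, hc, hcu⟩ := exists_mate hreg hno htri v
  obtain ⟨d, hcd, hd, hdu⟩ := exists_mate hreg hno htri c
  have hc' : ¬ ∃ w, G.Adj c w ∧ G.Adj v w := fun ⟨w, h1, h2⟩ => hc ⟨w, h2, h1⟩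
  obtain rfl : v = d := hdu v hvc.symm hc'
  have e1 : ∀ u, (v = u ∨ (G.Adj v u ∧ ¬ ∃ w, G.Adj v w ∧ G.Adj u w)) ↔ (u = v ∨ u = c) := by
    intro u
    constructor
    · rintro (rfl | ⟨h1, h2⟩)
      · exact Or.inl rfl
      · exact Or.inr (hcu u h1 h2)
    · rintro (rfl | rfl)
      · exact Or.inl rfl
      · exact Or.inr ⟨hvc, hc⟩
  have e2 : ∀ u, (c = u ∨ (G.Adj c u ∧ ¬ ∃ w, G.Adj c w ∧ G.Adj u w)) ↔ (u = v ∨ u = c) := by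
    intro u
    constructor
    · rintro (rfl | ⟨h1, h2⟩)
      · exact Or.inr rfl
      · exact Or.inl (hdu u h1 h2)
    · rintro (rfl | rfl)
      · exact Or.inr ⟨hcd, hd⟩
      · exact Or.inl rfl
  simp only [Matrix.mul_apply, mateMatrix, Matrix.of_apply, e1, Matrix.smul_apply, ite_mul,
    one_mul, zero_mul]
  rw [← Finset.sum_filter, show (Finset.univ.filter fun j => j = v ∨ j = c) = {v, c} by ext; simp,
    Finset.sum_insert (by simp [hvc.ne]), Finset.sum_singleton]
  simp only [e1, e2]
  split_ifs <;> norm_num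

/-- A cubic graph in which every vertex lies in exactly one triangle has eigenvalue `-2`. -/
lemma exists_eigenvector_neg_two [Nonempty V] (hreg : G.IsRegularOfDegree 3)
    (hno : ∀ v a b c, a ≠ b → a ≠ c → b ≠ c → G.Adj v a → G.Adj v b → G.Adj v c →
      G.Adj a b → ¬ G.Adj b c)
    (htri : ∀ v, ∃ a b, G.Adj v a ∧ G.Adj v b ∧ G.Adj a b) :
    ∃ x : V → ℝ, x ≠ 0 ∧ G.adjMatrix ℝ *ᵥ x = (-2 : ℝ) • x := by
  have h3 := Matrix.mul_finrank_ker_toLin'_of_mul_self (by norm_num)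
    (triangleMatrix_mul_self hreg hno htri)
  have h2 := Matrix.mul_finrank_ker_toLin'_of_mul_self (by norm_num)
    (mateMatrix_mul_self hreg hno htri)
  rw [trace_triangleMatrix] at h3
  rw [trace_mateMatrix] at h2
  have hn : (0 : ℝ) < Fintype.card V := Nat.cast_pos.2 Fintype.card_pos
  have hdisj : ¬ Disjoint (LinearMap.ker (Matrix.toLin' G.triangleMatrix))
      (LinearMap.ker (Matrix.toLin' G.mateMatrix)) := by
    intro h
    have hle := Submodule.finrank_add_finrank_le_of_disjoint h
    rw [Module.finrank_fintype_fun_eq_card] at hle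
    have hle' : (Module.finrank ℝ (LinearMap.ker (Matrix.toLin' G.triangleMatrix)) : ℝ) +
      Module.finrank ℝ (LinearMap.ker (Matrix.toLin' G.mateMatrix)) ≤ Fintype.card V := by
      exact_mod_cast hle
    linarith
  rw [Submodule.disjoint_def] at hdisj
  push Not at hdisj
  obtain ⟨x, hx3, hx2, hx⟩ := hdisj
  rw [LinearMap.mem_ker, Matrix.toLin'_apply] at hx2 hx3
  refine ⟨x, hx, ?_⟩
  have := congrArg (· *ᵥ x) (adjMatrix_eq_mateMatrix_add_triangleMatrix (G := G))
  simp only [Matrix.add_mulVec, Matrix.smul_mulVec, Matrix.one_mulVec, hx2, hx3, add_zero] at this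
  rw [neg_smul]
  exact eq_neg_of_add_eq_zero_left this

end Triangles

section LeastEigenvalue

variable {V : Type*} [Fintype V] [DecidableEq V] {G : SimpleGraph V} [DecidableRel G.Adj]

/-- The least eigenvalue of a vertex-transitive cubic graph is at most `-2`, unless the graph is
a union of copies of `K₄`. -/
lemma IsRegularOfDegree.leastEigenvalue_le_neg_two_or [Nonempty V]
    (hreg : G.IsRegularOfDegree 3) (htrans : ∀ u v : V, ∃ φ : G ≃g G, φ u = v) {lam : ℝ}
    (hlam : IsLeast {μ : ℝ | ∃ x : V → ℝ, x ≠ 0 ∧ G.adjMatrix ℝ *ᵥ x = μ • x} lam) :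
    lam ≤ -2 ∨ lam ^ 2 ≤ 3 ∧ ∃ u v w, G.Adj u v ∧ G.Adj v w ∧ G.Adj u w := by
  have hray := (show (G.adjMatrix ℝ).IsHermitian from
    (conjTranspose_eq_transpose_of_trivial _).trans G.isSymm_adjMatrix).mul_dotProduct_self_le
    hlam.2
  by_cases hfree : ∀ u v w, G.Adj u v → G.Adj v w → ¬ G.Adj u w
  · exact Or.inl (le_neg_two_of_rayleigh_of_triangleFree hreg hray hfree (Classical.arbitrary V))
  push Not at hfree
  obtain ⟨u, v, w, huv, hvw, huw⟩ := hfree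
  by_cases hno : ∀ v a b c, a ≠ b → a ≠ c → b ≠ c → G.Adj v a → G.Adj v b → G.Adj v c →
      G.Adj a b → ¬ G.Adj b c
  · refine Or.inl (hlam.2 (exists_eigenvector_neg_two hreg hno fun x => ?_))
    obtain ⟨φ, rfl⟩ := htrans u x
    exact ⟨φ v, φ w, φ.map_adj_iff.2 huv, φ.map_adj_iff.2 huw, φ.map_adj_iff.2 hvw⟩
  · push Not at hno
    obtain ⟨t, a, b, c, hab, hac, hbc, hta, htb, htc, eab, ebc⟩ := hno
    obtain ⟨x, hx, hAx⟩ := hlam.1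
    refine Or.inr ⟨hreg.sq_le_three_of_closedNeighborhood (hreg.closedNeighborhood_eq
      fun y => ?_) (le_neg_one_of_rayleigh hray huv) hx hAx, u, v, w, huv, hvw, huw⟩
    obtain ⟨φ, rfl⟩ := htrans t y
    exact ⟨φ a, φ b, φ c, φ.injective.ne hab, φ.injective.ne hac, φ.injective.ne hbc,
      φ.map_adj_iff.2 hta, φ.map_adj_iff.2 htb, φ.map_adj_iff.2 htc, φ.map_adj_iff.2 eab,
      φ.map_adj_iff.2 ebc⟩

end LeastEigenvalue
end SimpleGraph

namespace SimpleGraph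

section EigenspaceProjection

variable {V : Type*} [Fintype V] [DecidableEq V] {G : SimpleGraph V} [DecidableRel G.Adj]

/-- The eigenspace of the adjacency matrix, as a subspace of Euclidean space. -/
def euclideanEigenspace (G : SimpleGraph V) [DecidableRel G.Adj] (lam : ℝ) :
    Submodule ℝ (EuclideanSpace ℝ V) where
  carrier := {z | ∀ v, ∑ u ∈ G.neighborFinset v, z u = lam * z v}
  add_mem' {x y} hx hy v := by
    simp only [PiLp.add_apply, Finset.sum_add_distrib, mul_add, hx v, hy v]
  zero_mem' v := by simp
  smul_mem' k x hx v := by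
    simp only [PiLp.smul_apply, smul_eq_mul, ← Finset.mul_sum, hx v]
    ring

/-- The orthogonal projection of the standard basis vector at `v` to an eigenspace. -/
noncomputable def projectedBasisVector (G : SimpleGraph V) [DecidableRel G.Adj] (lam : ℝ) (v : V) :
    EuclideanSpace ℝ V :=
  (G.euclideanEigenspace lam).starProjection (EuclideanSpace.single v 1)

lemma inner_projectedBasisVector (lam : ℝ) (v : V) (z : EuclideanSpace ℝ V) :
    inner ℝ (G.projectedBasisVector lam v) z =
      (G.euclideanEigenspace lam).starProjection z v := by
  rw [projectedBasisVector, Submodule.inner_starProjection_left_eq_right]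
  simp [EuclideanSpace.inner_single_left]

lemma inner_projectedBasisVector_of_mem {lam : ℝ} (v : V) {z : EuclideanSpace ℝ V}
    (hz : z ∈ G.euclideanEigenspace lam) : inner ℝ (G.projectedBasisVector lam v) z = z v := by
  rw [inner_projectedBasisVector, Submodule.starProjection_eq_self_iff.2 hz]

lemma projectedBasisVector_mem (lam : ℝ) (v : V) :
    G.projectedBasisVector lam v ∈ G.euclideanEigenspace lam :=
  Submodule.starProjection_apply_mem _ _

lemma sum_inner_projectedBasisVector (lam : ℝ) (v : V) (z : EuclideanSpace ℝ V) :
    ∑ u ∈ G.neighborFinset v, inner ℝ (G.projectedBasisVector lam u) z =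
      lam * inner ℝ (G.projectedBasisVector lam v) z := by
  simp only [inner_projectedBasisVector]
  exact (Submodule.starProjection_apply_mem (G.euclideanEigenspace lam) z) v

lemma sum_projectedBasisVector (lam : ℝ) (v : V) :
    ∑ u ∈ G.neighborFinset v, G.projectedBasisVector lam u =
      lam • G.projectedBasisVector lam v := by
  refine ext_inner_right ℝ fun z => ?_
  rw [sum_inner, sum_inner_projectedBasisVector, real_inner_smul_left]

lemma norm_projectedBasisVector_le (lam : ℝ) (φ : G ≃g G) (v : V) :
    ‖G.projectedBasisVector lam v‖ ≤ ‖G.projectedBasisVector lam (φ v)‖ := by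
  set p := G.projectedBasisVector lam v with hp
  have hmem : p ∈ G.euclideanEigenspace lam := projectedBasisVector_mem lam v
  let y : EuclideanSpace ℝ V := LinearIsometryEquiv.piLpCongrLeft 2 ℝ ℝ φ.toEquiv p
  have hy : ∀ u, y (φ u) = p u := fun u => by
    simp [y, LinearIsometryEquiv.piLpCongrLeft_apply, Equiv.piCongrLeft']
    exact congrArg p (φ.toEquiv.symm_apply_apply u)
  have hymem : y ∈ G.euclideanEigenspace lam := by
    intro w
    obtain ⟨w, rfl⟩ := φ.surjective w
    rw [hy, ← hmem w]
    symm
    refine Finset.sum_bij (fun u _ => φ u) (fun u hu => ?_) (fun u _ u' _ h => φ.injective h)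
      (fun u hu => ?_) (fun u _ => (hy u).symm)
    · rw [mem_neighborFinset] at hu ⊢
      exact φ.map_adj_iff.2 hu
    · obtain ⟨u, rfl⟩ := φ.surjective u
      rw [mem_neighborFinset] at hu
      exact ⟨u, (G.mem_neighborFinset w u).2 (φ.map_adj_iff.1 hu), rfl⟩
  have hyn : ‖y‖ = ‖p‖ := LinearIsometryEquiv.norm_map _ _
  have h1 : ‖p‖ * ‖p‖ = inner ℝ (G.projectedBasisVector lam (φ v)) y := by
    rw [inner_projectedBasisVector_of_mem _ hymem, hy, ← inner_projectedBasisVector_of_mem _ hmem,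
      ← hp, real_inner_self_eq_norm_mul_norm]
  have h2 := real_inner_le_norm (G.projectedBasisVector lam (φ v)) y
  rw [hyn, ← h1] at h2
  rcases (norm_nonneg p).eq_or_lt with h0 | h0
  · rw [← h0]
    exact norm_nonneg _
  · exact le_of_mul_le_mul_right h2 h0

lemma exists_norm_projectedBasisVector [Nonempty V] (htrans : ∀ u v : V, ∃ φ : G ≃g G, φ u = v)
    {lam : ℝ} {x : V → ℝ} (hx : x ≠ 0) (hAx : G.adjMatrix ℝ *ᵥ x = lam • x) :
    ∃ r > 0, ∀ v, ‖G.projectedBasisVector lam v‖ = r := by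
  obtain ⟨u, hu⟩ := Function.ne_iff.1 hx
  refine ⟨‖G.projectedBasisVector lam u‖, norm_pos_iff.2 fun h0 => hu ?_, fun v => ?_⟩
  · have hmem : WithLp.toLp 2 x ∈ G.euclideanEigenspace lam := fun v => by
      simpa [adjMatrix_mulVec_apply] using congrFun hAx v
    have := inner_projectedBasisVector_of_mem u hmem
    rw [h0, inner_zero_left] at this
    exact this.symm
  · obtain ⟨φ, rfl⟩ := htrans u v
    obtain ⟨ψ, hψ⟩ := htrans (φ u) u
    refine le_antisymm ?_ (norm_projectedBasisVector_le lam φ u)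
    simpa only [hψ] using norm_projectedBasisVector_le lam ψ (φ u)

end EigenspaceProjection

section SignedEigenvectors

variable {V : Type*} [Fintype V] [DecidableEq V] {G : SimpleGraph V} [DecidableRel G.Adj]

lemma exists_isIndepSet_of_pos (hreg : G.IsRegularOfDegree 3) {g : ℕ}
    (hodd : ∀ (v : V) (p : G.Walk v v), p.IsCycle → Odd p.length → g ≤ p.length)
    {lam : ℝ} (hlam : lam < 0) (x : V → ℝ)
    (hx : ∀ v, ∑ u ∈ G.neighborFinset v, x u = lam * x v) :
    ∃ S : Finset V, (∀ u ∈ S, ∀ w ∈ S, ¬ G.Adj u w) ∧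
      g * (Finset.univ.filter fun v => 0 < x v).card + (g + 1) *
        (Finset.univ.filter fun v => 0 < x v ∧
          ∀ u w, G.Adj v u → G.Adj v w → 0 < x u * x w).card ≤
        2 * g * S.card + (Finset.univ.filter fun v => 0 < x v).card := by
  have hneg : ∀ v, 0 < x v → ∃ u, G.Adj v u ∧ x u < 0 := by
    intro v hv
    by_contra! h
    have h1 := Finset.sum_nonneg fun u hu => h u ((G.mem_neighborFinset v u).1 hu)
    rw [hx v] at h1
    exact h1.not_gt (mul_neg_of_neg_of_pos hlam hv)
  obtain ⟨S, -, hS, hle⟩ := exists_isIndepSet_subset_of_degree_le_two hodd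
    (Finset.univ.filter fun v => 0 < x v) fun v hv => by
      obtain ⟨u, hvu, hu⟩ := hneg v (Finset.mem_filter.1 hv).2
      have hlt : ((Finset.univ.filter fun v => 0 < x v).filter (G.Adj v)).card <
          (G.neighborFinset v).card := by
        refine Finset.card_lt_card (Finset.ssubset_iff_of_subset (fun w hw => ?_) |>.2
          ⟨u, by simpa using hvu, fun h => ?_⟩)
        · simpa using (Finset.mem_filter.1 hw).2
        · simp [hu.not_gt] at h
      rw [card_neighborFinset_eq_degree, hreg v] at hlt
      lia
  refine ⟨S, hS, le_trans (Nat.add_le_add_left (Nat.mul_le_mul_left _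
    (Finset.card_le_card fun v hv => ?_)) _) hle⟩
  obtain ⟨hv0, hv⟩ := (Finset.mem_filter.1 hv).2
  obtain ⟨w, hvw, hw⟩ := hneg v hv0
  simp only [Finset.mem_filter, Finset.mem_univ, true_and]
  exact ⟨hv0, fun u hu hvu => (hv u w hvu hvw).not_gt (mul_neg_of_pos_of_neg hu hw)⟩

lemma exists_isIndepSet_of_signs (hreg : G.IsRegularOfDegree 3) {g : ℕ}
    (hodd : ∀ (v : V) (p : G.Walk v v), p.IsCycle → Odd p.length → g ≤ p.length)
    {lam : ℝ} (hlam : lam < 0) (x : V → ℝ) (hx0 : ∀ v, x v ≠ 0)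
    (hx : ∀ v, ∑ u ∈ G.neighborFinset v, x u = lam * x v) :
    ∃ S : Finset V, (∀ u ∈ S, ∀ w ∈ S, ¬ G.Adj u w) ∧
      g * Fintype.card V + (g + 1) *
        (Finset.univ.filter fun v => ∀ u w, G.Adj v u → G.Adj v w → 0 < x u * x w).card ≤
        4 * g * S.card + Fintype.card V := by
  obtain ⟨S, hS, h1⟩ := exists_isIndepSet_of_pos hreg hodd hlam x hx
  obtain ⟨T, hT, h2⟩ := exists_isIndepSet_of_pos hreg hodd hlam (-x) (by simp [hx])
  have hsplit : ∀ P : V → Prop, [DecidablePred P] → (Finset.univ.filter P).card =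
      (Finset.univ.filter fun v => 0 < x v ∧ P v).card +
      (Finset.univ.filter fun v => 0 < (-x) v ∧ P v).card := by
    intro P _
    rw [← Finset.card_union_of_disjoint, ← Finset.filter_or]
    · refine congrArg _ (Finset.filter_congr fun v _ => ?_)
      have := (hx0 v).lt_or_gt
      simp only [Pi.neg_apply, neg_pos]
      tauto
    · refine Finset.disjoint_filter.2 fun v _ h h' => ?_
      have := h'.1
      simp only [Pi.neg_apply, neg_pos] at this
      exact this.not_gt h.1
  have e1 := hsplit fun v => True
  have e2 := hsplit fun v => ∀ u w, G.Adj v u → G.Adj v w → 0 < x u * x w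
  simp only [Finset.filter_true, Finset.card_univ, and_true] at e1
  simp only [Pi.neg_apply, neg_mul_neg] at h2 e1 e2
  rw [e1, e2]
  rcases le_total S.card T.card with h | h
  · refine ⟨T, hT, ?_⟩
    have := Nat.mul_le_mul_left (2 * g) h
    nlinarith
  · refine ⟨S, hS, ?_⟩
    have := Nat.mul_le_mul_left (2 * g) h
    nlinarith

end SignedEigenvectors

section Greedy

variable {V : Type*} [Fintype V] [DecidableEq V] {G : SimpleGraph V} [DecidableRel G.Adj]

lemma IsRegularOfDegree.exists_isIndepSet_card_le {d : ℕ} (hreg : G.IsRegularOfDegree d) :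
    ∃ S : Finset V, (∀ u ∈ S, ∀ w ∈ S, ¬ G.Adj u w) ∧ Fintype.card V ≤ S.card * (d + 1) := by
  obtain ⟨S, hS, hmax⟩ :=
    (Set.toFinite {S : Finset V | ∀ u ∈ S, ∀ w ∈ S, ¬ G.Adj u w}).exists_maximal ⟨∅, by simp⟩
  refine ⟨S, hS, ?_⟩
  have hcover : Finset.univ ⊆ S.biUnion fun v => insert v (G.neighborFinset v) := by
    intro v _
    by_contra hv
    have hv' : ∀ u ∈ S, ¬ G.Adj u v := fun u hu h =>
      hv (Finset.mem_biUnion.2 ⟨u, hu, by simp [h]⟩)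
    have hvS : v ∉ S := fun h => hv (Finset.mem_biUnion.2 ⟨v, h, by simp⟩)
    refine hvS (hmax (y := insert v S) ?_ (Finset.subset_insert v S) (Finset.mem_insert_self v S))
    intro a ha b hb hab
    rcases Finset.mem_insert.1 ha with rfl | ha' <;> rcases Finset.mem_insert.1 hb with rfl | hb'
    · exact hab.ne rfl
    · exact hv' _ hb' hab.symm
    · exact hv' _ ha' hab
    · exact hS a ha' b hb' hab
  refine (Finset.card_le_card hcover).trans (Finset.card_biUnion_le_card_mul _ _ _ fun v _ => ?_)
  rw [Finset.card_insert_of_notMem (by simp), card_neighborFinset_eq_degree, hreg v]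

end Greedy

end SimpleGraph

/-- Let `G` be a finite, `3`-regular, vertex-transitive simple graph
containing an odd cycle, with least adjacency-matrix eigenvalue `lam` and odd-girth `g`
(the length of a shortest odd cycle, encoded by `IsLeast`). Then the independence ratio
of `G` is at least `(5g−3)/(16g) + ((g+1)/(2g))·(3/(4π))·arcsin((lam² − 3)/6)`. -/
theorem independence_ratio_ge_of_cubic_odd_girth
    {V : Type*} [Fintype V] [DecidableEq V] (G : SimpleGraph V) [DecidableRel G.Adj]
    (hreg : G.IsRegularOfDegree 3)
    (htrans : ∀ u v : V, ∃ φ : G ≃g G, φ u = v)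
    (lam : ℝ)
    (hlam : IsLeast {μ : ℝ | ∃ x : V → ℝ, x ≠ 0 ∧ G.adjMatrix ℝ *ᵥ x = μ • x} lam)
    (g : ℕ)
    (hg : IsLeast {n : ℕ | Odd n ∧ ∃ (v : V) (w : G.Walk v v), w.IsCycle ∧ w.length = n} g) :
    ∃ S : Finset V, (∀ u ∈ S, ∀ v ∈ S, ¬ G.Adj u v) ∧
      ((5 * (g : ℝ) - 3) / (16 * g)
          + ((g : ℝ) + 1) / (2 * g) * (3 / (4 * Real.pi)) * Real.arcsin ((lam ^ 2 - 3) / 6))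
        * (Fintype.card V : ℝ) ≤ (S.card : ℝ) := by
  classical
  obtain ⟨⟨hgodd, v₀, w₀, hw₀, hw₀g⟩, hgmin⟩ := hg
  have : Nonempty V := ⟨v₀⟩
  have hg3 : 3 ≤ g := hw₀g ▸ hw₀.three_le_length
  have hcyc : ∀ (v : V) (p : G.Walk v v), p.IsCycle → Odd p.length → g ≤ p.length :=
    fun v p hp hodd => hgmin ⟨hodd, v, p, hp, rfl⟩
  have hgpos : (0 : ℝ) < g := by exact_mod_cast (by lia : 0 < g)
  have hn : (0 : ℝ) < Fintype.card V := Nat.cast_pos.2 Fintype.card_pos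
  have hpi := Real.pi_pos
  rcases hreg.leastEigenvalue_le_neg_two_or htrans hlam with hlam2 | ⟨hlam3, u, v, w, huv, hvw, huw⟩
  · obtain ⟨x, hx, hAx⟩ := hlam.1
    obtain ⟨r, hr, hnorm⟩ := SimpleGraph.exists_norm_projectedBasisVector htrans hx hAx
    choose a b c hab hac hbc hadj using hreg.exists_adj_iff
    have hnbr : ∀ v, G.neighborFinset v = {a v, b v, c v} := fun v => by
      ext w
      simp [hadj]
    obtain ⟨z, hz0, hz⟩ := exists_generic_direction hr hnorm hlam2 a b c fun v => by
      rw [← SimpleGraph.sum_projectedBasisVector, hnbr,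
        Finset.sum_insert (by simp [hab, hac]), Finset.sum_insert (by simp [hbc]),
        Finset.sum_singleton, add_assoc]
    obtain ⟨S, hS, hle⟩ := SimpleGraph.exists_isIndepSet_of_signs hreg hcyc
      (by linarith : lam < 0) (fun v => inner ℝ (G.projectedBasisVector lam v) z) hz0
      fun v => SimpleGraph.sum_inner_projectedBasisVector lam v z
    refine ⟨S, hS, ?_⟩
    have hcard := hz.trans (Nat.cast_le.2 (Finset.card_le_card
      (t := Finset.univ.filter fun v => ∀ u w, G.Adj v u → G.Adj v w →
        0 < inner ℝ (G.projectedBasisVector lam u) z * inner ℝ (G.projectedBasisVector lam w) z)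
      fun v hv => by
      simp only [Finset.mem_filter, Finset.mem_univ, true_and] at hv ⊢
      have key : ∀ α β γ : ℝ, 0 < α * β → 0 < α * γ → 0 < β * γ := fun α β γ h1 h2 => by
        have h3 := mul_pos h1 h2
        rw [show α * β * (α * γ) = α ^ 2 * (β * γ) by ring] at h3
        exact pos_of_mul_pos_right h3 (sq_nonneg α)
      have hself : ∀ u, 0 < inner ℝ (G.projectedBasisVector lam u) z *
        inner ℝ (G.projectedBasisVector lam u) z := fun u => mul_self_pos.2 (hz0 u)
      intro u w hu hw
      rw [hadj] at hu hw
      have hu' : 0 < inner ℝ (G.projectedBasisVector lam (a v)) z *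
          inner ℝ (G.projectedBasisVector lam u) z := by
        rcases hu with rfl | rfl | rfl
        exacts [hself _, hv.1, hv.2]
      have hw' : 0 < inner ℝ (G.projectedBasisVector lam (a v)) z *
          inner ℝ (G.projectedBasisVector lam w) z := by
        rcases hw with rfl | rfl | rfl
        exacts [hself _, hv.1, hv.2]
      exact key _ _ _ hu' hw'))
    have hle' := (Nat.cast_le (α := ℝ)).2 hle
    push_cast at hle'
    have hmul := mul_le_mul_of_nonneg_left hcard (by linarith : (0 : ℝ) ≤ g + 1)
    rw [Real.arccos_eq_pi_div_two_sub_arcsin] at hmul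
    refine le_of_mul_le_mul_left ?_ (by linarith : 0 < 4 * (g : ℝ))
    refine le_trans (le_of_eq ?_) (by linarith : (g + 1) * (Fintype.card V * (1 -
      3 / (2 * Real.pi) * (Real.pi / 2 - Real.arcsin ((lam ^ 2 - 3) / 6)))) + (g - 1) * (Fintype.card V : ℝ) ≤ _)
    field_simp
    ring
  · obtain ⟨S, hS, hle⟩ := hreg.exists_isIndepSet_card_le
    refine ⟨S, hS, ?_⟩
    have h3 : g = 3 := by
      refine le_antisymm ?_ hg3
      obtain ⟨y, p, hp, hlen⟩ := SimpleGraph.is3Clique_iff_exists_cycle_length_three.1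
        ⟨{u, v, w}, SimpleGraph.is3Clique_triple_iff.2 ⟨huv, huw, hvw⟩⟩
      exact hgmin ⟨by decide, y, p, hp, hlen⟩
    subst h3
    have harc : Real.arcsin ((lam ^ 2 - 3) / 6) ≤ 0 := Real.arcsin_nonpos.2 (by linarith)
    have hle' : (Fintype.card V : ℝ) ≤ S.card * 4 := by exact_mod_cast hle
    have hcoef : (((3 : ℕ) : ℝ) + 1) / (2 * (3 : ℕ)) * (3 / (4 * Real.pi)) *
        Real.arcsin ((lam ^ 2 - 3) / 6) ≤ 0 :=
      mul_nonpos_of_nonneg_of_nonpos (by positivity) harc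
    have hmul := mul_nonpos_of_nonpos_of_nonneg hcoef hn.le
    rw [add_mul]
    norm_num at hmul ⊢
    linarith
end

section
/- Let x, y, z be real numbers in [−1, 1] such that x + y + z ≥ 1/2 and 1 + 2xyz − x² − y² − z² ≥ 0. Then x ≥ −1/2, y ≥ −1/2 and z ≥ −1/2. -/
/-- If the symmetric matrix with unit diagonal and off-diagonal entries `x, y, z` has nonnegative
determinant, `-1 ≤ x` and `1 / 2 ≤ x + y + z`, then `-(1 / 2) ≤ x`. -/
theorem neg_half_le_of_det_nonneg {x y z : ℝ} (hx : -1 ≤ x)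
    (hsum : 1 / 2 ≤ x + y + z)
    (hdet : 0 ≤ 1 + 2 * x * y * z - x ^ 2 - y ^ 2 - z ^ 2) :
    -(1 / 2) ≤ x := by
  by_contra! h
  have hprod : 0 ≤ (1 - x) * (1 + x - (y + z) ^ 2 / 2) := by
    have := mul_nonneg (neg_le_iff_add_nonneg.mp hx) (sq_nonneg (y - z))
    linear_combination hdet + this / 2
  have hsq : 0 ≤ 1 + x - (y + z) ^ 2 / 2 :=
    nonneg_of_mul_nonneg_right hprod (by linarith)
  nlinarith

/-- If `x, y, z ∈ [−1, 1]` satisfy `x + y + z ≥ 1/2` and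
`1 + 2xyz − x² − y² − z² ≥ 0` (nonnegativity of the determinant of the `3×3`
correlation matrix), then `x, y, z ≥ −1/2`. -/
theorem correlations_ge_neg_half
    (x y z : ℝ) (hx : x ∈ Set.Icc (-1 : ℝ) 1) (hy : y ∈ Set.Icc (-1 : ℝ) 1)
    (hz : z ∈ Set.Icc (-1 : ℝ) 1)
    (hsum : 1 / 2 ≤ x + y + z)
    (hdet : 0 ≤ 1 + 2 * x * y * z - x ^ 2 - y ^ 2 - z ^ 2) :
    -(1 / 2) ≤ x ∧ -(1 / 2) ≤ y ∧ -(1 / 2) ≤ z := by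
  exact ⟨neg_half_le_of_det_nonneg hx.1 hsum hdet,
    neg_half_le_of_det_nonneg (y := x) (z := z) hy.1 (by linarith) (by linarith),
    neg_half_le_of_det_nonneg (y := x) (z := y) hz.1 (by linarith) (by linarith)⟩
end

section
/- Let λ ∈ [−3, −2] and define f(t) = arcsin((1/2 − λ + λ²/2 + (1−λ)t) / (1/2 − 2λ + λ²/2 + t)). If c₁, c₂, c₃ ∈ [−1/2, 1] satisfy c₁ + c₂ + c₃ = (λ² − 3)/2, then f(c₁) + f(c₂) + f(c₃) ≥ 3·f((λ² − 3)/6). -/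
/-- The function `f(t) = arcsin((1/2 − λ + λ²/2 + (1−λ)t) / (1/2 − 2λ + λ²/2 + t))`. -/
noncomputable def tangentF (lam t : ℝ) : ℝ :=
  Real.arcsin ((1 / 2 - lam + lam ^ 2 / 2 + (1 - lam) * t)
      / (1 / 2 - 2 * lam + lam ^ 2 / 2 + t))

/-- Trapezoid upper bound for increments of `arcsin`, whose derivative is convex on `[0, 1)`. -/
theorem arcsin_sub_le_trapezoid {a b : ℝ} (ha : 0 ≤ a) (hab : a ≤ b) (hb : b < 1) :
    Real.arcsin b - Real.arcsin a ≤ (b - a) * (1 / √(1 - a ^ 2) + 1 / √(1 - b ^ 2)) / 2 := by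
  rw [← Real.cos_arcsin, ← Real.cos_arcsin]
  have hsa : Real.sin (Real.arcsin a) = a := Real.sin_arcsin (by linarith) (by linarith)
  have hsb : Real.sin (Real.arcsin b) = b := Real.sin_arcsin (by linarith) (by linarith)
  have h0 : 0 ≤ Real.arcsin a := Real.arcsin_nonneg.2 ha
  have h1 : Real.arcsin a ≤ Real.arcsin b := Real.monotone_arcsin hab
  have h2 : Real.arcsin b < Real.pi / 2 := Real.arcsin_lt_pi_div_two.2 hb
  generalize Real.arcsin a = α at *
  generalize Real.arcsin b = β at *
  subst hsa hsb
  obtain ⟨δ, hδ⟩ : ∃ δ, δ = (β - α) / 2 := ⟨_, rfl⟩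
  obtain ⟨σ, hσ⟩ : ∃ σ, σ = (β + α) / 2 := ⟨_, rfl⟩
  obtain rfl : β = σ + δ := by linarith
  obtain rfl : α = σ - δ := by linarith
  have hcα : 0 < Real.cos (σ - δ) := Real.cos_pos_of_mem_Ioo ⟨by linarith, by linarith⟩
  have hcβ : 0 < Real.cos (σ + δ) := Real.cos_pos_of_mem_Ioo ⟨by linarith, by linarith⟩
  have hcδ : 0 < Real.cos δ := Real.cos_pos_of_mem_Ioo ⟨by linarith, by linarith⟩
  have hsδ : 0 ≤ Real.sin δ := Real.sin_nonneg_of_nonneg_of_le_pi (by linarith) (by linarith)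
  have htan : δ ≤ Real.sin δ / Real.cos δ := by
    rw [← Real.tan_eq_sin_div_cos]
    exact Real.le_tan (by linarith) (by linarith)
  have hkey : Real.sin δ / Real.cos δ ≤
      (Real.sin (σ + δ) - Real.sin (σ - δ)) *
        (1 / Real.cos (σ - δ) + 1 / Real.cos (σ + δ)) / 4 := by
    have hprod : Real.cos (σ - δ) * Real.cos (σ + δ) = Real.cos σ ^ 2 - Real.sin δ ^ 2 := by
      rw [Real.cos_sub, Real.cos_add]
      linear_combination (Real.cos σ ^ 2) * Real.sin_sq_add_cos_sq δ
        - (Real.sin δ ^ 2) * Real.sin_sq_add_cos_sq σ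
    have hpos : 0 < Real.cos σ ^ 2 - Real.sin δ ^ 2 := hprod ▸ mul_pos hcα hcβ
    have hrw : (Real.sin (σ + δ) - Real.sin (σ - δ)) *
        (1 / Real.cos (σ - δ) + 1 / Real.cos (σ + δ)) / 4 =
        Real.sin δ * Real.cos δ * Real.cos σ ^ 2 / (Real.cos σ ^ 2 - Real.sin δ ^ 2) := by
      rw [← hprod, div_add_div _ _ hcα.ne' hcβ.ne', mul_div_assoc', div_div,
        div_eq_div_iff (by positivity) (by positivity)]
      simp only [Real.cos_sub, Real.cos_add, Real.sin_add, Real.sin_sub]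
      ring
    rw [hrw, div_le_div_iff₀ hcδ hpos]
    have hcos : Real.cos δ ^ 2 = 1 - Real.sin δ ^ 2 := Real.cos_sq' δ
    have : Real.cos σ ^ 2 - Real.sin δ ^ 2 ≤ Real.cos σ ^ 2 * Real.cos δ ^ 2 := by
      rw [hcos]
      nlinarith [mul_nonneg (sq_nonneg (Real.sin δ)) (sub_nonneg.2 (Real.cos_sq_le_one σ))]
    nlinarith [mul_le_mul_of_nonneg_left this hsδ]
  linarith

/-- Second-order Taylor lower bound for increments of `arcsin` on `[0, 1]`. -/
theorem taylor_le_arcsin_sub {a b : ℝ} (hb : 0 ≤ b) (hba : b ≤ a) (ha : a ≤ 1) (hb1 : b < 1) :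
    (a - b) / √(1 - b ^ 2) * (1 + (a - b) * b / (2 * (1 - b ^ 2))) ≤
      Real.arcsin a - Real.arcsin b := by
  have hC : 0 < √(1 - b ^ 2) := Real.sqrt_pos.2 (by nlinarith)
  have hC2 : √(1 - b ^ 2) ^ 2 = 1 - b ^ 2 := Real.sq_sqrt (by nlinarith)
  have hsa : Real.sin (Real.arcsin a) = a := Real.sin_arcsin (by linarith) ha
  have hsb : Real.sin (Real.arcsin b) = b := Real.sin_arcsin (by linarith) (by linarith)
  have hcb : Real.cos (Real.arcsin b) = √(1 - b ^ 2) := Real.cos_arcsin b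
  have h1 : Real.arcsin b ≤ Real.arcsin a := Real.monotone_arcsin hba
  obtain ⟨δ, hδ⟩ : ∃ δ, δ = Real.arcsin a - Real.arcsin b := ⟨_, rfl⟩
  have hsum : a = b * Real.cos δ + √(1 - b ^ 2) * Real.sin δ := by
    have hadd := Real.sin_add (Real.arcsin b) δ
    rwa [hsb, hcb, hδ, add_sub_cancel, hsa, ← hδ] at hadd
  rw [← hδ]
  generalize √(1 - b ^ 2) = C at *
  rw [← hC2]
  obtain ⟨x, hx⟩ : ∃ x, x = (a - b) / C := ⟨_, rfl⟩
  obtain ⟨T, hT⟩ : ∃ T, T = b / C := ⟨_, rfl⟩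
  have hx0 : 0 ≤ x := hx ▸ div_nonneg (by linarith) hC.le
  have hT0 : 0 ≤ T := hT ▸ div_nonneg hb hC.le
  have hxT : x = Real.sin δ - T * (1 - Real.cos δ) := by
    rw [hx, hT, hsum]
    field_simp
    ring
  have hrw : (a - b) / C * (1 + (a - b) * b / (2 * C ^ 2)) = x + T * x ^ 2 / 2 := by
    rw [hx, hT]
    field_simp
  rw [hrw]
  have hcos : 0 ≤ 1 - Real.cos δ := sub_nonneg.2 (Real.cos_le_one δ)
  have hxle : x ≤ Real.sin δ := by nlinarith [mul_nonneg hT0 hcos]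
  have hx2 : x ^ 2 ≤ (1 - Real.cos δ) * (1 + Real.cos δ) := by
    nlinarith [Real.sin_sq_add_cos_sq δ]
  have hsin : Real.sin δ ≤ δ := Real.sin_le (by linarith)
  nlinarith [mul_le_mul_of_nonneg_left hx2 hT0, mul_nonneg hT0 (sq_nonneg (1 - Real.cos δ))]

/-- The polynomial inequality behind the tangent line bound to the left of the mean. -/
theorem tangentF_poly_ineq {lam t : ℝ} (h2 : lam ≤ -2) (ht : -(1 / 2) ≤ t)
    (htm : t ≤ (lam ^ 2 - 3) / 6) :
    (1 - (lam ^ 2 - 3) / 6) * (1 - 3 * lam + lam ^ 2 + (2 - lam) * ((lam ^ 2 - 3) / 6)) *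
        (1 / 2 - 2 * lam + lam ^ 2 / 2 + t) ^ 2 ≤
      (2 * (1 / 2 - 2 * lam + lam ^ 2 / 2 + t) -
          (1 / 2 - 2 * lam + lam ^ 2 / 2 + (lam ^ 2 - 3) / 6)) ^ 2 *
        ((1 - t) * (1 - 3 * lam + lam ^ 2 + (2 - lam) * t)) := by
  obtain ⟨v, rfl⟩ : ∃ v, lam = -(2 + v) := ⟨-lam - 2, by ring⟩
  obtain ⟨r, rfl⟩ : ∃ r, t = r - 1 / 2 := ⟨t + 1 / 2, by ring⟩
  have hv0 : 0 ≤ v := by linarith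
  have hr : 0 ≤ r := by linarith
  obtain ⟨m, hm⟩ : ∃ m, m = ((2 + v) ^ 2 - 3) / 6 := ⟨_, rfl⟩
  obtain ⟨w, hw⟩ : ∃ w, w = 4 + v := ⟨_, rfl⟩
  obtain ⟨p, hp⟩ : ∃ p, p = 1 - m := ⟨_, rfl⟩
  obtain ⟨q, hq⟩ : ∃ q, q = 1 + 3 * (2 + v) + (2 + v) ^ 2 + w * m := ⟨_, rfl⟩
  obtain ⟨D, hD⟩ : ∃ D, D = 1 / 2 + 2 * (2 + v) + (2 + v) ^ 2 / 2 + m := ⟨_, rfl⟩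
  obtain ⟨S, hS⟩ : ∃ S, S = (2 + v) ^ 2 / 6 := ⟨_, rfl⟩
  obtain ⟨k₁, hk₁⟩ : ∃ k, k = -w * D ^ 2 - 4 * D * (q - p * w) + 3 * p * q := ⟨_, rfl⟩
  obtain ⟨E, hE⟩ : ∃ E, E = 4 * w * D + 4 * (q - p * w) - 4 * w * S := ⟨_, rfl⟩
  have hE0 : 0 ≤ E := by
    subst hE hk₁ hS hD hq hp hw hm
    ring_nf
    positivity
  have hslope : 0 ≤ -(k₁ + 2 * E * S) := by
    subst hE hk₁ hS hD hq hp hw hm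
    ring_nf
    positivity
  have hend : 0 ≤ D ^ 2 * (q - p * w) - 2 * D * p * q + k₁ * S + E * S ^ 2 := by
    subst hE hk₁ hS hD hq hp hw hm
    ring_nf
    positivity
  have hs : 0 ≤ S - r := by
    rw [hS]
    linarith
  have hw0 : 0 ≤ w := by linarith
  have hbracket := mul_nonneg hs (add_nonneg (add_nonneg (add_nonneg hend
    (mul_nonneg hslope hr)) (mul_nonneg hE0 (sq_nonneg r)))
    (mul_nonneg (mul_nonneg hw0 hr) (sq_nonneg (2 * (S - r)))))
  rw [← sub_nonneg]
  refine hbracket.trans_eq ?_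
  subst hE hk₁ hS hD hq hp hw hm
  ring

/-- A trapezoid increment of `arcsin` along a Möbius map is at most the tangent increment. -/
theorem trapezoid_le_slope {K D₀ D A C s : ℝ} (hK : 0 ≤ K) (hD₀ : 0 < D₀) (hD : 0 < D)
    (hA : 0 < A) (hC : 0 < C) (hs : 0 ≤ s) (h : C * D₀ ≤ (2 * D - D₀) * A) :
    K * s / (D₀ * D) * (1 / A + 1 / C) / 2 ≤ K / (D₀ ^ 2 * C) * s := by
  have hmean : (1 / A + 1 / C) / (2 * D) ≤ 1 / (C * D₀) := by
    rw [div_add_div _ _ hA.ne' hC.ne', div_div, div_le_div_iff₀ (by positivity) (by positivity)]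
    nlinarith [mul_le_mul_of_nonneg_left h hC.le]
  calc K * s / (D₀ * D) * (1 / A + 1 / C) / 2
      = K * s / D₀ * ((1 / A + 1 / C) / (2 * D)) := by field_simp
    _ ≤ K * s / D₀ * (1 / (C * D₀)) := by gcongr
    _ = K / (D₀ ^ 2 * C) * s := by field_simp

/-- A second-order Taylor increment of `arcsin` along a Möbius map is at least the tangent
increment. -/
theorem slope_le_taylor {K D₀ D C E b s : ℝ} (hK : 0 ≤ K) (hD₀ : 0 < D₀) (hD : 0 < D)
    (hC : 0 < C) (hE : 0 < E) (hs : 0 ≤ s) (hDs : D = D₀ + s) (h : 2 * (D * E) ≤ K * b) :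
    K / (D₀ ^ 2 * C) * s ≤ K * s / (D * D₀) / C * (1 + K * s / (D * D₀) * b / (2 * E)) := by
  have hratio : D / D₀ ≤ 1 + K * s / (D * D₀) * b / (2 * E) := by
    have hone : 1 ≤ K * b / (2 * (D * E)) := (one_le_div (by positivity)).2 h
    calc D / D₀ = 1 + s / D₀ * 1 := by
          rw [hDs]
          field_simp
      _ ≤ 1 + s / D₀ * (K * b / (2 * (D * E))) := by gcongr
      _ = _ := by field_simp
  calc K / (D₀ ^ 2 * C) * s = K * s / (D * D₀) / C * (D / D₀) := by field_simp
    _ ≤ _ := by gcongr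

/-- `tangentF` lies above its tangent line at the mean `(λ² − 3)/6`. -/
theorem tangentF_tangent_line {lam : ℝ} (h3 : -3 < lam) (h2 : lam ≤ -2) :
    ∃ L : ℝ, ∀ t ∈ Set.Icc (-(1 / 2) : ℝ) 1,
      tangentF lam ((lam ^ 2 - 3) / 6) + L * (t - (lam ^ 2 - 3) / 6) ≤ tangentF lam t := by
  obtain ⟨m, hm⟩ : ∃ m, m = (lam ^ 2 - 3) / 6 := ⟨_, rfl⟩
  obtain ⟨D, hD⟩ : ∃ D : ℝ → ℝ, D = fun t => 1 / 2 - 2 * lam + lam ^ 2 / 2 + t := ⟨_, rfl⟩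
  obtain ⟨g, hg⟩ : ∃ g : ℝ → ℝ,
      g = fun t => (1 / 2 - lam + lam ^ 2 / 2 + (1 - lam) * t) / D t := ⟨_, rfl⟩
  obtain ⟨K, hK⟩ : ∃ K, K = -lam * (1 - lam) * (3 - lam) / 2 := ⟨_, rfl⟩
  have hf : ∀ t, tangentF lam t = Real.arcsin (g t) := fun t => by simp only [hg, hD, tangentF]
  have hmlo : 1 / 6 ≤ m := by nlinarith
  have hm1 : m < 1 := by nlinarith
  have hKpos : 0 < K := by
    rw [hK]
    have := mul_pos (mul_pos (show 0 < -lam by linarith) (show 0 < 1 - lam by linarith))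
      (show 0 < 3 - lam by linarith)
    linarith
  have hDpos : ∀ t, -(1 / 2) ≤ t → 0 < D t := fun t ht => by
    simp only [hD]
    nlinarith
  have hsub : ∀ s t, -(1 / 2) ≤ s → -(1 / 2) ≤ t → g s - g t = K * (s - t) / (D s * D t) := by
    intro s t hs ht
    have h1 := (hDpos s hs).ne'
    have h2 := (hDpos t ht).ne'
    simp only [hg]
    rw [div_sub_div _ _ h1 h2, hK]
    congr 1
    simp only [hD]
    ring
  have hg0 : ∀ t, -(1 / 2) ≤ t → 0 ≤ g t := fun t ht => by
    simp only [hg]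
    exact div_nonneg (by nlinarith) (hDpos t ht).le
  have hg1 : g 1 = 1 := by
    have := (hDpos 1 (by norm_num)).ne'
    simp only [hg]
    rw [div_eq_one_iff_eq this, hD]
    ring
  have hsq : ∀ t, -(1 / 2) ≤ t → 1 - g t ^ 2 =
      -lam * ((1 - t) * (1 - 3 * lam + lam ^ 2 + (2 - lam) * t)) / D t ^ 2 := by
    intro t ht
    have h1 := (hDpos t ht).ne'
    simp only [hg]
    rw [div_pow, eq_div_iff (by positivity), sub_mul, div_mul_cancel₀ _ (by positivity)]
    simp only [hD]
    ring
  have hmono : ∀ s t, -(1 / 2) ≤ s → s ≤ t → g s ≤ g t := fun s t hs hst => by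
    have h1 := hDpos s hs
    have h2 := hDpos t (hs.trans hst)
    have : 0 ≤ g t - g s := by
      rw [hsub t s (hs.trans hst) hs]
      exact div_nonneg (mul_nonneg hKpos.le (by linarith)) (by positivity)
    linarith
  have hDm := hDpos m (by linarith)
  have hbm : g m < 1 := by
    have : 0 < g 1 - g m := by
      rw [hsub 1 m (by norm_num) (by linarith)]
      exact div_pos (mul_pos hKpos (by linarith)) (mul_pos (hDpos 1 (by norm_num)) hDm)
    linarith
  have hC2 : 0 < 1 - g m ^ 2 := by nlinarith [hg0 m (by linarith)]
  have hC : 0 < √(1 - g m ^ 2) := Real.sqrt_pos.2 hC2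
  refine ⟨K / (D m ^ 2 * √(1 - g m ^ 2)), fun t ht => ?_⟩
  obtain ⟨ht0, ht1⟩ := ht
  have hDt := hDpos t ht0
  rw [← hm, hf, hf]
  rcases le_total t m with htm | hmt
  · have htrap := arcsin_sub_le_trapezoid (hg0 t ht0) (hmono t m ht0 htm) hbm
    have hA2 : 0 < 1 - g t ^ 2 := by nlinarith [hg0 t ht0, hmono t m ht0 htm]
    have hA : 0 < √(1 - g t ^ 2) := Real.sqrt_pos.2 hA2
    have hroot : √(1 - g m ^ 2) * D m ≤ (2 * D t - D m) * √(1 - g t ^ 2) := by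
      have hpos : 0 ≤ 2 * D t - D m := by
        simp only [hD]
        nlinarith
      refine le_of_sq_le_sq ?_ (mul_nonneg hpos hA.le)
      rw [mul_pow, mul_pow, Real.sq_sqrt hC2.le, Real.sq_sqrt hA2.le, hsq m (by linarith),
        hsq t ht0, div_mul_cancel₀ _ (by positivity), mul_div_assoc', le_div_iff₀ (by positivity)]
      have := tangentF_poly_ineq h2 ht0 (hm ▸ htm)
      rw [← hm] at this
      simp only [hD]
      nlinarith [mul_le_mul_of_nonneg_left this (show 0 ≤ -lam by linarith)]
    have hstep : (g m - g t) * (1 / √(1 - g t ^ 2) + 1 / √(1 - g m ^ 2)) / 2 ≤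
        K / (D m ^ 2 * √(1 - g m ^ 2)) * (m - t) := by
      rw [hsub m t (by linarith) ht0]
      exact trapezoid_le_slope hKpos.le hDm hDt hA hC (by linarith) hroot
    linarith
  · have htay := taylor_le_arcsin_sub (hg0 m (by linarith)) (hmono m t (by linarith) hmt)
      ((hmono t 1 ht0 ht1).trans_eq hg1) hbm
    have hb : 3 / 4 ≤ g m := by
      simp only [hg]
      rw [le_div_iff₀ hDm]
      simp only [hD]
      nlinarith
    have hDK : -lam * D t ≤ K := by
      rw [hK]
      simp only [hD]
      nlinarith
    have hcurv : 2 * (D t * (1 - g m ^ 2)) ≤ K * g m := by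
      have h4 : 2 * (1 - g m ^ 2) ≤ -lam * g m := by nlinarith
      linarith [mul_le_mul_of_nonneg_left h4 hDt.le,
        mul_le_mul_of_nonneg_right hDK (hg0 m (by linarith))]
    have hstep : K / (D m ^ 2 * √(1 - g m ^ 2)) * (t - m) ≤
        (g t - g m) / √(1 - g m ^ 2) * (1 + (g t - g m) * g m / (2 * (1 - g m ^ 2))) := by
      rw [hsub t m ht0 (by linarith)]
      refine slope_le_taylor hKpos.le hDm hDt hC hC2 (by linarith) ?_ hcurv
      simp only [hD]
      ring
    linarith

/-- For `λ ∈ [−3, −2]` and `c₁, c₂, c₃ ∈ [−1/2, 1]` with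
`c₁ + c₂ + c₃ = (λ² − 3)/2`, one has `f(c₁) + f(c₂) + f(c₃) ≥ 3·f((λ² − 3)/6)`. -/
theorem sum_f_ge_three_f_mean
    (lam : ℝ) (hlam : lam ∈ Set.Icc (-3 : ℝ) (-2))
    (c₁ c₂ c₃ : ℝ)
    (hc₁ : c₁ ∈ Set.Icc (-(1 / 2) : ℝ) 1) (hc₂ : c₂ ∈ Set.Icc (-(1 / 2) : ℝ) 1)
    (hc₃ : c₃ ∈ Set.Icc (-(1 / 2) : ℝ) 1)
    (hsum : c₁ + c₂ + c₃ = (lam ^ 2 - 3) / 2) :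
    3 * tangentF lam ((lam ^ 2 - 3) / 6)
      ≤ tangentF lam c₁ + tangentF lam c₂ + tangentF lam c₃ := by
  rcases hlam.1.eq_or_lt with rfl | h3
  · have e₁ : c₁ = 1 := by linarith [hc₁.2, hc₂.2, hc₃.2]
    have e₂ : c₂ = 1 := by linarith [hc₁.2, hc₂.2, hc₃.2]
    have e₃ : c₃ = 1 := by linarith [hc₁.2, hc₂.2, hc₃.2]
    rw [e₁, e₂, e₃, show ((-3 : ℝ) ^ 2 - 3) / 6 = 1 by norm_num]
    linarith
  · obtain ⟨L, hL⟩ := tangentF_tangent_line h3 hlam.2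
    have hlin : L * (c₁ - (lam ^ 2 - 3) / 6) + L * (c₂ - (lam ^ 2 - 3) / 6)
        + L * (c₃ - (lam ^ 2 - 3) / 6) = 0 := by
      linear_combination L * hsum
    linarith [hL c₁ hc₁, hL c₂ hc₂, hL c₃ hc₃]
end

section
/- Let G be an infinite, d-regular, vertex-transitive simple graph with vertex set V and fixed vertex x, and let A be the adjacency operator of G on ℓ²(V), i.e., the self-adjoint continuous linear operator with (A f)(v) = Σ_{u adjacent to v} f(u) for all f ∈ ℓ²(V) and v ∈ V. Then for every ε > 0 and every λ in the spectrum of A there exists α ∈ ℓ²(V) with ‖α‖ = 1 such that α is invariant under every automorphism of G fixing x (i.e., α(Φ(u)) = α(u) for all u ∈ V and every automorphism Φ with Φ(x) = x) and ‖A α − λ α‖ ≤ ε. -/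
open scoped InnerProductSpace

theorem geometric_growth_le {a : ℕ → ℝ} {C r : ℝ} (ha : ∀ n, 0 ≤ a n) (hr : 0 < r)
    (hlog : ∀ n, a (n + 1) ^ 2 ≤ a n * a (n + 2)) (hC : ∀ n, a n ≤ C * r ^ n) :
    a 1 ≤ r * a 0 := by
  by_contra! h
  have h0 : 0 < a 0 := by
    rcases (ha 0).lt_or_eq with h0 | h0
    · exact h0
    · have := hlog 0
      rw [← h0] at h this
      simp only [zero_add, zero_mul, mul_zero] at this h
      nlinarith
  set q := a 1 / a 0 with hq
  have hrq : r < q := by rwa [hq, lt_div_iff₀ h0]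
  have hq0 : 0 < q := hr.trans hrq
  have step : ∀ n, 0 < a n ∧ q * a n ≤ a (n + 1) := by
    intro n
    induction n with
    | zero => exact ⟨h0, by rw [hq, div_mul_cancel₀ _ h0.ne']⟩
    | succ n ih =>
      have hpos : 0 < a (n + 1) := (mul_pos hq0 ih.1).trans_le ih.2
      refine ⟨hpos, le_of_mul_le_mul_left ?_ ih.1⟩
      calc a n * (q * a (n + 1)) = (q * a n) * a (n + 1) := by ring
        _ ≤ a (n + 1) * a (n + 1) := by gcongr; exact ih.2
        _ = a (n + 1) ^ 2 := by ring
        _ ≤ a n * a (n + 1 + 1) := hlog n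
  have grow : ∀ n, q ^ n * a 0 ≤ a n := by
    intro n
    induction n with
    | zero => simp
    | succ n ih =>
      calc q ^ (n + 1) * a 0 = q * (q ^ n * a 0) := by ring
        _ ≤ q * a n := by gcongr
        _ ≤ a (n + 1) := (step n).2
  obtain ⟨n, hn⟩ := pow_unbounded_of_one_lt (C / a 0) ((one_lt_div hr).2 hrq)
  rw [div_pow, div_lt_div_iff₀ h0 (by positivity)] at hn
  linarith [grow n, hC n]

section Hilbert

variable {H : Type*} [NormedAddCommGroup H] [InnerProductSpace ℝ H]

theorem LinearMap.IsSymmetric.isUnit_of_bounded_below [CompleteSpace H] {B : H →L[ℝ] H}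
    (hB : (B : H →ₗ[ℝ] H).IsSymmetric) {c : ℝ} (hc : 0 < c) (h : ∀ f, c * ‖f‖ ≤ ‖B f‖) :
    IsUnit B := by
  have hanti : AntilipschitzWith (⟨c, hc.le⟩ : NNReal)⁻¹ B := by
    refine B.antilipschitz_of_bound fun f => ?_
    change ‖f‖ ≤ c⁻¹ * ‖B f‖
    rw [← div_eq_inv_mul, le_div_iff₀ hc, mul_comm]
    exact h f
  rw [ContinuousLinearMap.isUnit_iff_bijective,
    ContinuousLinearMap.bijective_iff_dense_range_and_antilipschitz]
  refine ⟨?_, _, hanti⟩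
  rw [Submodule.topologicalClosure_eq_top_iff]
  exact hB.orthogonal_range.trans (LinearMap.ker_eq_bot.2 hanti.injective)

/-- The vectors having a backward `B`-orbit of growth rate at most `r`. -/
def backwardOrbitSubmodule (B : H →L[ℝ] H) (r : ℝ) : Submodule ℝ H where
  carrier := {f | ∃ (C : ℝ) (g : ℕ → H), g 0 = f ∧ (∀ n, B (g (n + 1)) = g n) ∧
    ∀ n, ‖g n‖ ≤ C * r ^ n}
  zero_mem' := ⟨0, 0, by simp⟩
  add_mem' := by
    rintro _ _ ⟨C, g, rfl, hg, hC⟩ ⟨C', g', rfl, hg', hC'⟩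
    refine ⟨C + C', g + g', rfl, fun n => by simp [hg, hg'], fun n => ?_⟩
    rw [add_mul]
    exact norm_add_le_of_le (hC n) (hC' n)
  smul_mem' := by
    rintro a _ ⟨C, g, rfl, hg, hC⟩
    refine ⟨|a| * C, a • g, rfl, fun n => by simp [hg], fun n => ?_⟩
    rw [Pi.smul_apply, norm_smul, Real.norm_eq_abs, mul_assoc]
    gcongr
    exact hC n

theorem mem_backwardOrbitSubmodule_of_mem {B : H →L[ℝ] H}
    (hB : (B : H →ₗ[ℝ] H).IsSymmetric) {c : ℝ} (hc : 0 < c) {K : Submodule ℝ H}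
    [CompleteSpace K] (hK : Set.MapsTo B K K) (hbound : ∀ f ∈ K, c * ‖f‖ ≤ ‖B f‖)
    {f : H} (hf : f ∈ K) : f ∈ backwardOrbitSubmodule B c⁻¹ := by
  have hunit : IsUnit (B.restrict hK) :=
    LinearMap.IsSymmetric.isUnit_of_bounded_below (hB.restrict_invariant hK) hc
      fun f => hbound f f.2
  choose g hg using (ContinuousLinearMap.isUnit_iff_bijective.1 hunit).surjective
  have hBg : ∀ k : K, B (g k) = k := fun k => congrArg Subtype.val (hg k)
  refine ⟨‖f‖, fun n => (g^[n] ⟨f, hf⟩ : K), rfl, fun n => ?_, fun n => ?_⟩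
  · simp only [Function.iterate_succ_apply']
    exact hBg _
  · induction n with
    | zero => simp
    | succ n ih =>
      simp only [Function.iterate_succ_apply']
      have := hbound _ (g (g^[n] ⟨f, hf⟩)).2
      rw [hBg] at this
      rw [pow_succ, ← mul_assoc, ← div_eq_mul_inv, le_div_iff₀ hc, mul_comm]
      exact this.trans ih

theorem LinearMap.IsSymmetric.exists_preimage_norm_le {B : H →L[ℝ] H}
    (hB : (B : H →ₗ[ℝ] H).IsSymmetric) {r : ℝ} (hr : 0 < r) {f : H}
    (hf : f ∈ backwardOrbitSubmodule B r) : ∃ g, B g = f ∧ ‖g‖ ≤ r * ‖f‖ := by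
  obtain ⟨C, g, rfl, hg, hC⟩ := hf
  refine ⟨g 1, hg 0, geometric_growth_le (a := fun n => ‖g n‖) (fun n => norm_nonneg _) hr
    (fun n => ?_) hC⟩
  calc ‖g (n + 1)‖ ^ 2 = ⟪g (n + 1), B (g (n + 2))⟫_ℝ := by
        rw [hg, real_inner_self_eq_norm_sq]
    _ = ⟪B (g (n + 1)), g (n + 2)⟫_ℝ := (hB _ _).symm
    _ = ⟪g n, g (n + 2)⟫_ℝ := by rw [hg]
    _ ≤ ‖g n‖ * ‖g (n + 2)‖ := real_inner_le_norm _ _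

theorem LinearMap.IsSymmetric.isUnit_of_dense_backwardOrbitSubmodule [CompleteSpace H]
    {B : H →L[ℝ] H} (hB : (B : H →ₗ[ℝ] H).IsSymmetric) {r : ℝ} (hr : 0 < r)
    (hd : Dense (backwardOrbitSubmodule B r : Set H)) : IsUnit B := by
  refine hB.isUnit_of_bounded_below (inv_pos.2 hr) fun h => ?_
  have key : ∀ f : H, ⟪h, f⟫_ℝ ≤ ‖B h‖ * (r * ‖f‖) := by
    refine fun f => hd.induction (P := fun f => ⟪h, f⟫_ℝ ≤ ‖B h‖ * (r * ‖f‖)) ?_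
      (isClosed_le (by fun_prop) (by fun_prop)) f
    intro f hf
    obtain ⟨g, rfl, hg⟩ := hB.exists_preimage_norm_le hr hf
    calc ⟪h, B g⟫_ℝ = ⟪B h, g⟫_ℝ := (hB h g).symm
      _ ≤ ‖B h‖ * ‖g‖ := real_inner_le_norm _ _
      _ ≤ _ := by gcongr
  have := key h
  rw [real_inner_self_eq_norm_sq] at this
  rw [inv_mul_le_iff₀ hr]
  rcases (norm_nonneg h).eq_or_lt with h0 | h0
  · rw [← h0]; positivity
  · nlinarith

end Hilbert

section Sequences

variable {V : Type*}

/-- Precomposition of a square-summable function with a permutation. -/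
def lp.compEquiv (e : V ≃ V) (f : lp (fun _ : V => ℝ) 2) : lp (fun _ : V => ℝ) 2 :=
  ⟨fun v => f (e v), by
    have := (memℓp_gen_iff (by simp)).1 f.2
    exact (memℓp_gen_iff (by simp)).2 (e.summable_iff.2 this)⟩

theorem lp.compEquiv_apply (e : V ≃ V) (f : lp (fun _ : V => ℝ) 2) (v : V) :
    lp.compEquiv e f v = f (e v) := rfl

theorem lp.norm_compEquiv (e : V ≃ V) (f : lp (fun _ : V => ℝ) 2) :
    ‖lp.compEquiv e f‖ = ‖f‖ := by
  rw [lp.norm_eq_tsum_rpow (by simp), lp.norm_eq_tsum_rpow (by simp) f]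
  congr 1
  exact e.tsum_eq fun v => ‖f v‖ ^ (2 : ENNReal).toReal

theorem lp.dense_of_single_mem [DecidableEq V] {W : Submodule ℝ (lp (fun _ : V => ℝ) 2)}
    (h : ∀ v, lp.single 2 v (1 : ℝ) ∈ W) : Dense (W : Set (lp (fun _ : V => ℝ) 2)) := by
  rw [Submodule.dense_iff_topologicalClosure_eq_top, Submodule.topologicalClosure_eq_top_iff,
    Submodule.eq_bot_iff]
  intro f hf
  ext v
  have := (Submodule.mem_orthogonal W f).1 hf _ (h v)
  rw [lp.inner_single_left] at this
  simpa using this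

end Sequences

namespace SimpleGraph

variable {V : Type*} (G : SimpleGraph V)

/-- The square-summable functions invariant under all automorphisms fixing `v`. -/
def stabilizerInvariant (v : V) : Submodule ℝ (lp (fun _ : V => ℝ) 2) where
  carrier := {f | ∀ φ : G ≃g G, φ v = v → ∀ u, f (φ u) = f u}
  zero_mem' := fun _ _ _ => rfl
  add_mem' := fun {f g} hf hg φ hφ u => by
    rw [lp.coeFn_add, Pi.add_apply, Pi.add_apply, hf φ hφ, hg φ hφ]
  smul_mem' := fun a f hf φ hφ u => by
    rw [lp.coeFn_smul, Pi.smul_apply, Pi.smul_apply, hf φ hφ]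

theorem isClosed_stabilizerInvariant (v : V) :
    IsClosed (G.stabilizerInvariant v : Set (lp (fun _ : V => ℝ) 2)) := by
  have hcont : ∀ u, Continuous fun f : lp (fun _ : V => ℝ) 2 => f u := fun u =>
    (lp.lipschitzWith_one_eval 2 u).continuous
  have : (G.stabilizerInvariant v : Set (lp (fun _ : V => ℝ) 2)) =
      ⋂ (φ : G ≃g G) (_ : φ v = v) (u : V), {f | f (φ u) = f u} := by
    ext f
    simp only [Set.mem_iInter]
    rfl
  rw [this]
  exact isClosed_iInter fun φ => isClosed_iInter fun _ => isClosed_iInter fun u =>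
    isClosed_eq (hcont _) (hcont _)

theorem single_mem_stabilizerInvariant [DecidableEq V] (v : V) :
    lp.single 2 v (1 : ℝ) ∈ G.stabilizerInvariant v := by
  intro φ hφ u
  have : φ u = v ↔ u = v := by
    simpa only [hφ] using φ.injective.eq_iff (a := u) (b := v)
  simp only [lp.single_apply, Pi.single_apply, this]

theorem sum_neighborFinset_iso [∀ v, Fintype (G.neighborSet v)] (φ : G ≃g G) (f : V → ℝ) (v : V) :
    ∑ u ∈ G.neighborFinset (φ v), f u = ∑ u ∈ G.neighborFinset v, f (φ u) := by
  refine (Finset.sum_equiv φ.toEquiv (fun u => ?_) fun u _ => rfl).symm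
  simpa using (φ.map_adj_iff (v := v) (w := u)).symm

end SimpleGraph

/-- Let `G` be an infinite, `d`-regular, vertex-transitive simple
graph with a fixed vertex `x`, and let `A` be the (self-adjoint, bounded) adjacency
operator on `ℓ²(V)`, i.e. `(A f)(v) = Σ_{u ∈ N(v)} f(u)`. Then for every `ε > 0` and
every `λ` in the spectrum of `A` there is a unit vector `α ∈ ℓ²(V)` which is invariant
under every automorphism of `G` fixing `x` and satisfies `‖A α − λ α‖ ≤ ε`. -/
theorem exists_stabilizer_invariant_approximate_eigenvector
    {V : Type*} [Infinite V] (G : SimpleGraph V) [∀ v, Fintype (G.neighborSet v)]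
    (d : ℕ) (hreg : G.IsRegularOfDegree d)
    (htrans : ∀ u v : V, ∃ φ : G ≃g G, φ u = v)
    (x : V)
    (A : lp (fun _ : V => ℝ) 2 →L[ℝ] lp (fun _ : V => ℝ) 2)
    (hA : ∀ (f : lp (fun _ : V => ℝ) 2) (v : V),
      (A f : ∀ _ : V, ℝ) v = ∑ u ∈ G.neighborFinset v, (f : ∀ _ : V, ℝ) u)
    (hAsa : IsSelfAdjoint A)
    (ε : ℝ) (hε : 0 < ε) (lam : ℝ) (hlam : lam ∈ spectrum ℝ A) :
    ∃ α : lp (fun _ : V => ℝ) 2, ‖α‖ = 1 ∧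
      (∀ φ : G ≃g G, φ x = x → ∀ u : V, (α : ∀ _ : V, ℝ) (φ u) = (α : ∀ _ : V, ℝ) u) ∧
      ‖A α - lam • α‖ ≤ ε := by
  classical
  by_contra! hcon
  let B : lp (fun _ : V => ℝ) 2 →L[ℝ] lp (fun _ : V => ℝ) 2 := A - algebraMap ℝ _ lam
  have hB : ∀ f, B f = A f - lam • f := fun f => rfl
  have hBsa : IsSelfAdjoint B := hAsa.sub (IsSelfAdjoint.algebraMap _ (.all lam))
  have hBsymm := ContinuousLinearMap.isSelfAdjoint_iff_isSymmetric.1 hBsa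
  have hcomm : ∀ (φ : G ≃g G) f, B (lp.compEquiv φ.toEquiv f) = lp.compEquiv φ.toEquiv (B f) := by
    intro φ f
    ext v
    simp only [hB, lp.coeFn_sub, lp.coeFn_smul, Pi.sub_apply, Pi.smul_apply, hA,
      lp.compEquiv_apply]
    exact congrArg (· - _) (G.sum_neighborFinset_iso φ f v).symm
  have hboundx : ∀ f ∈ G.stabilizerInvariant x, ε * ‖f‖ ≤ ‖B f‖ := by
    intro f hf
    rcases (norm_nonneg f).eq_or_lt with h0 | h0
    · rw [← h0, mul_zero]; exact norm_nonneg _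
    · have := hcon (‖f‖⁻¹ • f) (by rw [norm_smul, norm_inv, norm_norm, inv_mul_cancel₀ h0.ne'])
        ((G.stabilizerInvariant x).smul_mem _ hf)
      rw [← hB, map_smul, norm_smul, norm_inv, norm_norm, ← div_eq_inv_mul, lt_div_iff₀ h0] at this
      exact this.le
  have hbound : ∀ v, ∀ f ∈ G.stabilizerInvariant v, ε * ‖f‖ ≤ ‖B f‖ := by
    intro v f hf
    obtain ⟨φ, hφ⟩ := htrans x v
    rw [← lp.norm_compEquiv φ.toEquiv f, ← lp.norm_compEquiv φ.toEquiv (B f), ← hcomm]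
    refine hboundx _ fun ψ hψ u => ?_
    have := hf ((φ.symm.trans ψ).trans φ) (by simp [← hφ, hψ]) (φ u)
    simpa [lp.compEquiv_apply] using this
  have hmaps : ∀ v, Set.MapsTo B (G.stabilizerInvariant v) (G.stabilizerInvariant v) := by
    intro v f hf φ hφ u
    have : lp.compEquiv φ.toEquiv f = f := lp.ext (funext (hf φ hφ))
    have h := hcomm φ f
    rw [this] at h
    exact (congrArg (fun g : lp (fun _ : V => ℝ) 2 => g u) h).symm
  have hunit : IsUnit B := by
    refine hBsymm.isUnit_of_dense_backwardOrbitSubmodule (inv_pos.2 hε)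
      (lp.dense_of_single_mem fun v => ?_)
    have : CompleteSpace (G.stabilizerInvariant v) :=
      (G.isClosed_stabilizerInvariant v).completeSpace_coe
    exact mem_backwardOrbitSubmodule_of_mem hBsymm hε (hmaps v) (hbound v)
      (G.single_mem_stabilizerInvariant v)
  refine spectrum.mem_iff.1 hlam ?_
  rw [← IsUnit.neg_iff, neg_sub]
  exact hunit
end

section
/- Let G be an infinite, connected, d-regular, vertex-transitive simple graph with vertex set V, let A be the adjacency operator of G on ℓ²(V), and let λ_max be the supremum of the spectrum of A. Then λ_max is not an eigenvalue of A: there is no nonzero f ∈ ℓ²(V) with A f = λ_max·f. -/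
open scoped InnerProductSpace

section Rayleigh

variable {E : Type*} [NormedAddCommGroup E] [InnerProductSpace ℝ E] [CompleteSpace E]

theorem norm_apply_sq_le_of_nonneg_form (B : E →L[ℝ] E) (hB : IsSelfAdjoint B)
    (hpos : ∀ x, 0 ≤ ⟪B x, x⟫_ℝ) (x : E) : ‖B x‖ ^ 2 ≤ ‖B‖ * ⟪B x, x⟫_ℝ := by
  have hsymm : ∀ x y, ⟪B x, y⟫_ℝ = ⟪x, B y⟫_ℝ := hB.isSymmetric
  rcases (norm_nonneg B).eq_or_lt with h0 | h0
  · simp [norm_eq_zero.mp h0.symm]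
  have h1 := hpos (‖B‖ • x - B x)
  have h2 : ⟪B (B x), B x⟫_ℝ ≤ ‖B‖ * ‖B x‖ ^ 2 :=
    (real_inner_le_norm _ _).trans (by nlinarith [B.le_opNorm (B x), norm_nonneg (B x)])
  have h3 : ⟪B (B x), x⟫_ℝ = ‖B x‖ ^ 2 := by rw [hsymm, real_inner_self_eq_norm_sq]
  simp only [map_sub, map_smul, inner_sub_left, inner_sub_right, real_inner_smul_left,
    real_inner_smul_right, h3, real_inner_self_eq_norm_sq] at h1
  have h4 : 0 ≤ ‖B‖ * (‖B‖ * ⟪B x, x⟫_ℝ - ‖B x‖ ^ 2) := by nlinarith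
  linarith [nonneg_of_mul_nonneg_right h4 h0]

theorem inner_apply_self_le_sSup_spectrum (A : E →L[ℝ] E) (hA : IsSelfAdjoint A) (x : E) :
    ⟪A x, x⟫_ℝ ≤ sSup (spectrum ℝ A) * ‖x‖ ^ 2 := by
  rcases eq_or_ne x 0 with rfl | hx
  · simp
  set S : Set ℝ := {m | ∀ y, ⟪A y, y⟫_ℝ ≤ m * ‖y‖ ^ 2}
  have hne : S.Nonempty := ⟨‖A‖, fun y =>
    (real_inner_le_norm _ _).trans (by nlinarith [A.le_opNorm y, norm_nonneg y])⟩
  have hxpos : 0 < ‖x‖ ^ 2 := by positivity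
  have hbdd : BddBelow S := ⟨⟪A x, x⟫_ℝ / ‖x‖ ^ 2, fun m hm => (div_le_iff₀ hxpos).mpr (hm x)⟩
  have hmem : sInf S ∈ S := by
    intro y
    rcases eq_or_ne y 0 with rfl | hy
    · simp
    have hypos : 0 < ‖y‖ ^ 2 := by positivity
    exact (div_le_iff₀ hypos).mp (le_csInf hne fun m hm => (div_le_iff₀ hypos).mpr (hm y))
  have hspec : sInf S ∈ spectrum ℝ A := by
    intro hunit
    set B : E →L[ℝ] E := algebraMap ℝ (E →L[ℝ] E) (sInf S) - A with hBdef
    have hBapp : ∀ y, B y = sInf S • y - A y := fun y => by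
      simp [hBdef, Algebra.algebraMap_eq_smul_one]
    have hBform : ∀ y, ⟪B y, y⟫_ℝ = sInf S * ‖y‖ ^ 2 - ⟪A y, y⟫_ℝ := fun y => by
      rw [hBapp, inner_sub_left, real_inner_smul_left, real_inner_self_eq_norm_sq]
    have hBsa : IsSelfAdjoint B := (IsSelfAdjoint.algebraMap _ (IsSelfAdjoint.all _)).sub hA
    have hbound := norm_apply_sq_le_of_nonneg_form B hBsa
      fun y => by rw [hBform]; linarith [hmem y]
    obtain ⟨u, hu⟩ := hunit
    set C : E →L[ℝ] E := ↑u⁻¹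
    have hCB : ∀ y, C (B y) = y := fun y => by
      rw [hBdef, ← hu, ← mul_apply_eq_comp, Units.inv_mul, one_apply_eq_self]
    set K : ℝ := ‖C‖ ^ 2 * ‖B‖ + 1
    have hK : 0 < K := by positivity
    have hcoer : ∀ y, ‖y‖ ^ 2 ≤ K * ⟪B y, y⟫_ℝ := fun y => by
      have h1 : ‖y‖ ≤ ‖C‖ * ‖B y‖ := by simpa [hCB] using C.le_opNorm (B y)
      have h2 : ‖y‖ ^ 2 ≤ ‖C‖ ^ 2 * ‖B y‖ ^ 2 := by
        rw [← mul_pow]; exact pow_le_pow_left₀ (norm_nonneg _) h1 2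
      have h3 := mul_le_mul_of_nonneg_left (hbound y) (sq_nonneg ‖C‖)
      have h4 : 0 ≤ ⟪B y, y⟫_ℝ := by rw [hBform]; linarith [hmem y]
      linarith
    have hlt : sInf S - K⁻¹ ∈ S := fun y => by
      have h1 := hcoer y
      rw [hBform, ← inv_mul_le_iff₀ hK] at h1
      linarith
    linarith [csInf_le hbdd hlt, inv_pos.mpr hK]
  exact (hmem x).trans (mul_le_mul_of_nonneg_right
    (le_csSup (spectrum.isBounded A).bddAbove hspec) hxpos.le)

theorem apply_eq_sSup_spectrum_smul_of_le (A : E →L[ℝ] E) (hA : IsSelfAdjoint A) (x : E)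
    (hx : sSup (spectrum ℝ A) * ‖x‖ ^ 2 ≤ ⟪A x, x⟫_ℝ) : A x = sSup (spectrum ℝ A) • x := by
  set m := sSup (spectrum ℝ A)
  set B : E →L[ℝ] E := algebraMap ℝ (E →L[ℝ] E) m - A with hBdef
  have hBapp : ∀ y, B y = m • y - A y := fun y => by
    simp [hBdef, Algebra.algebraMap_eq_smul_one]
  have hBform : ∀ y, ⟪B y, y⟫_ℝ = m * ‖y‖ ^ 2 - ⟪A y, y⟫_ℝ := fun y => by
    rw [hBapp, inner_sub_left, real_inner_smul_left, real_inner_self_eq_norm_sq]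
  have hBsa : IsSelfAdjoint B := (IsSelfAdjoint.algebraMap _ (IsSelfAdjoint.all _)).sub hA
  have hbound := norm_apply_sq_le_of_nonneg_form B hBsa
    (fun y => by rw [hBform]; linarith [inner_apply_self_le_sSup_spectrum A hA y]) x
  have h0 : ‖B x‖ ^ 2 ≤ 0 := hbound.trans
    (mul_nonpos_of_nonneg_of_nonpos (norm_nonneg _) (by rw [hBform]; linarith))
  have h1 : B x = 0 := by simpa using le_antisymm h0 (sq_nonneg _)
  rw [hBapp, sub_eq_zero] at h1
  exact h1.symm

end Rayleigh

theorem inner_self_eq_tsum_sq {V : Type*} (f : lp (fun _ : V => ℝ) 2) :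
    ⟪f, f⟫_ℝ = ∑' v, f v ^ 2 := by
  rw [lp.inner_eq_tsum]
  simp [sq]

theorem exists_lp_abs {V : Type*} (f : lp (fun _ : V => ℝ) 2) :
    ∃ g : lp (fun _ : V => ℝ) 2, ∀ v, g v = |f v| :=
  ⟨⟨fun v => |f v|, (memℓp_gen_iff (by norm_num)).mpr <| by
    simpa using (memℓp_gen_iff (by norm_num)).mp (lp.memℓp f)⟩, fun _ => rfl⟩

theorem exists_lp_comp_equiv {V : Type*} (f : lp (fun _ : V => ℝ) 2) (e : V ≃ V) :
    ∃ g : lp (fun _ : V => ℝ) 2, ∀ v, g v = f (e v) :=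
  ⟨⟨fun v => f (e v), (memℓp_gen_iff (by norm_num)).mpr <|
    e.summable_iff.mpr ((memℓp_gen_iff (by norm_num)).mp (lp.memℓp f))⟩, fun _ => rfl⟩

/-- An eigenvector at the top of the spectrum of the adjacency operator of a connected graph
vanishes nowhere, unless it is zero. -/
theorem eq_zero_of_apply_eq_zero {V : Type*} (G : SimpleGraph V)
    [∀ v, Fintype (G.neighborSet v)] (hconn : G.Connected)
    (A : lp (fun _ : V => ℝ) 2 →L[ℝ] lp (fun _ : V => ℝ) 2)
    (hA : ∀ (f : lp (fun _ : V => ℝ) 2) (v : V),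
      (A f : ∀ _ : V, ℝ) v = ∑ u ∈ G.neighborFinset v, (f : ∀ _ : V, ℝ) u)
    (hAsa : IsSelfAdjoint A) (f : lp (fun _ : V => ℝ) 2)
    (hev : A f = sSup (spectrum ℝ A) • f) (v : V) (hv : f v = 0) : f = 0 := by
  obtain ⟨g, hg⟩ := exists_lp_abs f
  have hnorm : ‖g‖ ^ 2 = ‖f‖ ^ 2 := by
    rw [← real_inner_self_eq_norm_sq, ← real_inner_self_eq_norm_sq, inner_self_eq_tsum_sq,
      inner_self_eq_tsum_sq]
    simp [hg]
  have hform : ⟪A f, f⟫_ℝ ≤ ⟪A g, g⟫_ℝ := by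
    rw [lp.inner_eq_tsum, lp.inner_eq_tsum]
    refine (lp.summable_inner (𝕜 := ℝ) (A f) f).tsum_le_tsum (fun w => ?_)
      (lp.summable_inner (𝕜 := ℝ) (A g) g)
    simp only [RCLike.inner_apply, conj_trivial, hA, hg]
    calc f w * ∑ u ∈ G.neighborFinset w, f u
        ≤ |f w| * |∑ u ∈ G.neighborFinset w, f u| := by
          rw [← abs_mul]; exact le_abs_self _
      _ ≤ |f w| * ∑ u ∈ G.neighborFinset w, |f u| :=
          mul_le_mul_of_nonneg_left (Finset.abs_sum_le_sum_abs _ _) (abs_nonneg _)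
  have hgev : A g = sSup (spectrum ℝ A) • g := by
    refine apply_eq_sSup_spectrum_smul_of_le A hAsa g ?_
    rw [hnorm]
    refine le_trans (le_of_eq ?_) hform
    rw [hev, real_inner_smul_left, real_inner_self_eq_norm_sq]
  have hstep : ∀ u w, G.Adj u w → f u = 0 → f w = 0 := by
    intro u w huw hu
    have h1 : (A g) u = sSup (spectrum ℝ A) * g u := by rw [hgev]; rfl
    rw [hA, hg, hu, abs_zero, mul_zero,
      Finset.sum_eq_zero_iff_of_nonneg fun i _ => by rw [hg]; exact abs_nonneg _] at h1
    simpa [hg] using h1 w (by simpa using huw)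
  ext w
  obtain ⟨p⟩ := hconn.preconnected v w
  induction p with
  | nil => simpa using hv
  | cons hadj _ ih => exact ih (hstep _ _ hadj hv)

/-- Let `G` be an infinite, connected, `d`-regular, vertex-transitive
simple graph, `A` its (self-adjoint, bounded) adjacency operator on `ℓ²(V)`, and
`λ_max = sSup (spectrum ℝ A)` the supremum of the spectrum of `A`. Then `λ_max` is
not an eigenvalue of `A`: no nonzero `f ∈ ℓ²(V)` satisfies `A f = λ_max • f`. -/
theorem sup_spectrum_not_eigenvalue
    {V : Type*} [Infinite V] (G : SimpleGraph V) [∀ v, Fintype (G.neighborSet v)]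
    (hconn : G.Connected)
    (d : ℕ) (hreg : G.IsRegularOfDegree d)
    (htrans : ∀ u v : V, ∃ φ : G ≃g G, φ u = v)
    (A : lp (fun _ : V => ℝ) 2 →L[ℝ] lp (fun _ : V => ℝ) 2)
    (hA : ∀ (f : lp (fun _ : V => ℝ) 2) (v : V),
      (A f : ∀ _ : V, ℝ) v = ∑ u ∈ G.neighborFinset v, (f : ∀ _ : V, ℝ) u)
    (hAsa : IsSelfAdjoint A) :
    ¬ ∃ f : lp (fun _ : V => ℝ) 2, f ≠ 0 ∧ A f = sSup (spectrum ℝ A) • f := by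
  rintro ⟨f, hf, hev⟩
  have hne : ∀ v, f v ≠ 0 := fun v hv =>
    hf (eq_zero_of_apply_eq_zero G hconn A hA hAsa f hev v hv)
  obtain ⟨v₀⟩ := hconn.nonempty
  have habs : ∀ v, f v ^ 2 = f v₀ ^ 2 := by
    intro v
    obtain ⟨φ, hφ⟩ := htrans v₀ v
    obtain ⟨g, hg⟩ : ∃ g : lp (fun _ : V => ℝ) 2, ∀ w, g w = f (φ w) :=
      exists_lp_comp_equiv f φ.toEquiv
    have hgev : A g = sSup (spectrum ℝ A) • g := by
      ext w
      have h1 : (A f) (φ w) = sSup (spectrum ℝ A) * f (φ w) := by rw [hev]; rfl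
      rw [hA] at h1
      rw [hA, lp.coeFn_smul, Pi.smul_apply, smul_eq_mul, hg, ← h1]
      refine Finset.sum_equiv φ.toEquiv (fun u => ?_) (fun u _ => hg u)
      simpa using φ.map_adj_iff.symm
    have hcomb : g - (f v / f v₀) • f = 0 := by
      refine eq_zero_of_apply_eq_zero G hconn A hA hAsa _ ?_ v₀ ?_
      · rw [map_sub, map_smul, hev, hgev, smul_sub, smul_comm]
      · change g v₀ - f v / f v₀ * f v₀ = 0
        rw [hg, hφ, div_mul_cancel₀ _ (hne v₀), sub_self]
    have hgf : inner ℝ g g = inner ℝ f f := by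
      rw [inner_self_eq_tsum_sq, inner_self_eq_tsum_sq]
      simp only [hg]
      exact φ.toEquiv.tsum_eq fun w => f w ^ 2
    rw [sub_eq_zero.mp hcomb, inner_smul_left, inner_smul_right, ← mul_assoc] at hgf
    have h2 : (f v / f v₀) * (f v / f v₀) = 1 :=
      mul_right_cancel₀ (inner_self_ne_zero.mpr hf) (by simpa using hgf)
    have h3 := hne v₀
    field_simp at h2
    linarith
  have hs : Summable fun v => f v ^ 2 := by
    simpa [sq] using lp.summable_inner (𝕜 := ℝ) f f
  simp only [habs, summable_const_iff] at hs
  exact hne v₀ (by simpa using hs)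
end

section
/- Let G be an infinite, countable, d-regular, vertex-transitive simple graph with vertex set V, let A be the adjacency operator of G on ℓ²(V), and let λ be a point of the spectrum of A. Then there exists a probability measure μ on the product space ℝ^V (with the product σ-algebra) such that: (i) μ is invariant under the coordinate-permutation action of every automorphism of G; (ii) for every finitely supported function c : V → ℝ, the pushforward of μ under the map f ↦ Σ_v c(v)·f(v) is a centered Gaussian measure on ℝ; (iii) for every vertex v, the pushforward of μ under the coordinate evaluation f ↦ f(v) is the standard Gaussian measure (mean 0, variance 1); and (iv) for μ-almost every f ∈ ℝ^V one has Σ_{u adjacent to v} f(u) = λ·f(v) for every vertex v. -/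
open MeasureTheory ProbabilityTheory

section Hilbert

open scoped InnerProductSpace

variable {E : Type*} [NormedAddCommGroup E] [InnerProductSpace ℝ E]

theorem norm_sq_pow_succ_le {S : E →L[ℝ] E} (hS : ∀ x y, ⟪S x, y⟫_ℝ = ⟪x, S y⟫_ℝ) (n : ℕ) (y : E) :
    ‖(S ^ (n + 1)) y‖ ^ 2 ≤ ‖(S ^ n) y‖ * ‖(S ^ (n + 2)) y‖ := by
  have h : ⟪(S ^ (n + 1)) y, (S ^ (n + 1)) y⟫_ℝ = ⟪(S ^ n) y, (S ^ (n + 2)) y⟫_ℝ := by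
    rw [pow_succ' S (n + 1), mul_apply_eq_comp, ← hS, pow_succ' S n,
      mul_apply_eq_comp]
  rw [← real_inner_self_eq_norm_sq, h]
  exact real_inner_le_norm _ _

theorem norm_apply_le_of_norm_pow_apply_le {S : E →L[ℝ] E}
    (hS : ∀ x y, ⟪S x, y⟫_ℝ = ⟪x, S y⟫_ℝ) {y : E} {C s : ℝ} (hs : 0 < s)
    (h : ∀ n : ℕ, ‖(S ^ n) y‖ ≤ C * s ^ n) : ‖S y‖ ≤ s * ‖y‖ := by
  by_contra! hlt
  have hy : 0 < ‖y‖ := by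
    rw [norm_pos_iff]
    rintro rfl
    simp at hlt
  set t := ‖S y‖ / ‖y‖ with ht
  have hst : s < t := by rwa [ht, lt_div_iff₀ hy]
  have key : ∀ n : ℕ, 0 < ‖(S ^ n) y‖ ∧ t * ‖(S ^ n) y‖ ≤ ‖(S ^ (n + 1)) y‖ := by
    intro n
    induction n with
    | zero => simp [hy, ht, hy.ne']
    | succ n ih =>
      obtain ⟨h0, h1⟩ := ih
      have h2 : 0 < ‖(S ^ (n + 1)) y‖ := lt_of_lt_of_le (mul_pos (hs.trans hst) h0) h1
      refine ⟨h2, ?_⟩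
      have h3 := norm_sq_pow_succ_le hS n y
      refine le_of_mul_le_mul_left (?_ : ‖(S ^ n) y‖ * _ ≤ ‖(S ^ n) y‖ * _) h0
      nlinarith
  have grow : ∀ n : ℕ, t ^ n * ‖y‖ ≤ ‖(S ^ n) y‖ := by
    intro n
    induction n with
    | zero => simp
    | succ n ih =>
      refine le_trans ?_ (key n).2
      rw [pow_succ', mul_assoc]
      gcongr
  obtain ⟨n, hn⟩ := pow_unbounded_of_one_lt (C / ‖y‖) ((one_lt_div hs).2 hst)
  have h1 := (grow n).trans (h n)
  rw [div_pow, div_lt_div_iff₀ hy (by positivity)] at hn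
  linarith

theorem norm_one_sub_smul_sq_apply_sq_le {B : E →L[ℝ] E} (hB : ∀ x y, ⟪B x, y⟫_ℝ = ⟪x, B y⟫_ℝ)
    {c : ℝ} (hc : 0 ≤ c) (hcB : c * ‖B‖ ^ 2 ≤ 1) (x : E) :
    ‖(1 - c • B ^ 2 : E →L[ℝ] E) x‖ ^ 2 ≤ ‖x‖ ^ 2 - c * ‖B x‖ ^ 2 := by
  have h1 : (1 - c • B ^ 2 : E →L[ℝ] E) x = x - c • B (B x) := by
    simp [pow_two]
  have h2 : ‖B (B x)‖ ^ 2 ≤ ‖B‖ ^ 2 * ‖B x‖ ^ 2 := by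
    rw [← mul_pow]
    gcongr
    exact B.le_opNorm _
  rw [h1, norm_sub_sq_real, real_inner_smul_right, ← hB, real_inner_self_eq_norm_sq, norm_smul,
    mul_pow, Real.norm_eq_abs, sq_abs]
  have h3 : c ^ 2 * ‖B (B x)‖ ^ 2 ≤ c * ‖B x‖ ^ 2 := by
    calc c ^ 2 * ‖B (B x)‖ ^ 2 ≤ c ^ 2 * (‖B‖ ^ 2 * ‖B x‖ ^ 2) := by gcongr
      _ = c * ‖B x‖ ^ 2 * (c * ‖B‖ ^ 2) := by ring
      _ ≤ c * ‖B x‖ ^ 2 * 1 := by gcongr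
      _ = _ := mul_one _
  linarith

/-- If all the vectors `x v` of a family with dense span have the same norm under all the powers of
`P = 1 - c • B ^ 2`, and the self-adjoint operator `B` is not invertible, then some power of `P`
maps all of them simultaneously to approximate elements of the kernel of `B`. -/
theorem exists_pow_one_sub_smul_sq_approx_ker [CompleteSpace E] {V : Type*} [Nonempty V]
    {B P : E →L[ℝ] E} (hB : ∀ x y, ⟪B x, y⟫_ℝ = ⟪x, B y⟫_ℝ) (hunit : ¬ IsUnit B)
    {c : ℝ} (hc : 0 < c) (hcB : c * ‖B‖ ^ 2 ≤ 1) (hP : P = 1 - c • B ^ 2)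
    {x : V → E}
    (hx : Dense (Submodule.span ℝ (Set.range x) : Set E))
    (heq : ∀ (n : ℕ) (u v : V), ‖(P ^ n) (x u)‖ = ‖(P ^ n) (x v)‖)
    {ε : ℝ} (hε : 0 < ε) :
    ∃ n : ℕ, ∀ v, 0 < ‖(P ^ n) (x v)‖ ∧
      ‖B ((P ^ n) (x v))‖ ≤ ε * ‖(P ^ n) (x v)‖ := by
  have hPs : ∀ x y, ⟪P x, y⟫_ℝ = ⟪x, P y⟫_ℝ := fun x y => by
    simp [hP, pow_two, inner_sub_left, inner_sub_right, real_inner_smul_left,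
      real_inner_smul_right, hB]
  set q : ℝ := 1 / (1 + c * ε ^ 2) with hq
  have hq0 : 0 < q := by positivity
  have hq1 : q < 1 := by
    rw [hq, div_lt_one (by positivity)]
    have : 0 < c * ε ^ 2 := by positivity
    linarith
  have hqε : 1 - q ≤ c * ε ^ 2 := by
    have : q * (1 + c * ε ^ 2) = 1 := by rw [hq]; field_simp
    nlinarith [mul_nonneg hc.le (sq_nonneg ε)]
  have hstep : ∀ y, ‖P y‖ ^ 2 ≤ ‖y‖ ^ 2 - c * ‖B y‖ ^ 2 :=
    hP ▸ norm_one_sub_smul_sq_apply_sq_le hB hc.le hcB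
  obtain ⟨o⟩ := ‹Nonempty V›
  by_contra! hcon
  have hdec : ∀ n : ℕ, ‖(P ^ (n + 1)) (x o)‖ ^ 2 ≤ q * ‖(P ^ n) (x o)‖ ^ 2 := by
    intro n
    by_contra! hlt
    obtain ⟨v, hv⟩ := hcon n
    rw [heq n o v, heq (n + 1) o v, pow_succ' P, mul_apply_eq_comp] at hlt
    have h1 := hstep ((P ^ n) (x v))
    have hpos : 0 < ‖(P ^ n) (x v)‖ := by
      by_contra! h0
      have h0' : ‖(P ^ n) (x v)‖ = 0 := le_antisymm h0 (norm_nonneg _)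
      rw [h0'] at h1 hlt
      nlinarith [mul_nonneg hc.le (sq_nonneg ‖B ((P ^ n) (x v))‖)]
    have h2 := hv hpos
    have h3 : (ε * ‖(P ^ n) (x v)‖) ^ 2 < ‖B ((P ^ n) (x v))‖ ^ 2 := by gcongr
    have h4 := mul_lt_mul_of_pos_left h3 hc
    nlinarith [mul_le_mul_of_nonneg_right hqε (sq_nonneg ‖(P ^ n) (x v)‖)]
  set s := √q with hs
  have hs0 : 0 < s := Real.sqrt_pos.2 hq0
  have hs1 : s < 1 := by rw [hs, Real.sqrt_lt' one_pos]; simpa using hq1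
  have hdec' : ∀ (n : ℕ) (v : V), ‖(P ^ n) (x v)‖ ≤ ‖x o‖ * s ^ n := by
    intro n v
    rw [heq n v o]
    induction n with
    | zero => simp
    | succ n ih =>
      have h1 : ‖(P ^ (n + 1)) (x o)‖ ≤ s * ‖(P ^ n) (x o)‖ := by
        refine abs_le_of_sq_le_sq' ?_ (by positivity) |>.2
        rw [mul_pow, hs, Real.sq_sqrt hq0.le]
        exact hdec n
      calc _ ≤ s * ‖(P ^ n) (x o)‖ := h1
        _ ≤ s * (‖x o‖ * s ^ n) := by gcongr
        _ = _ := by ring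
  have hspan : ∀ y ∈ Submodule.span ℝ (Set.range x), ∃ C : ℝ, ∀ n : ℕ, ‖(P ^ n) y‖ ≤ C * s ^ n := by
    intro y hy
    induction hy using Submodule.span_induction with
    | mem y hy =>
      obtain ⟨v, rfl⟩ := hy
      exact ⟨_, fun n => hdec' n v⟩
    | zero => exact ⟨0, by simp⟩
    | add y z _ _ hy hz =>
      obtain ⟨C, hC⟩ := hy
      obtain ⟨D, hD⟩ := hz
      refine ⟨C + D, fun n => ?_⟩
      rw [map_add, add_mul]
      exact (norm_add_le _ _).trans (add_le_add (hC n) (hD n))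
    | smul a y _ hy =>
      obtain ⟨C, hC⟩ := hy
      refine ⟨‖a‖ * C, fun n => ?_⟩
      rw [map_smul, norm_smul, mul_assoc]
      gcongr
      exact hC n
  have hle : ∀ y, ‖P y‖ ≤ s * ‖y‖ := by
    have hcl : IsClosed {y | ‖P y‖ ≤ s * ‖y‖} :=
      isClosed_le (by fun_prop) (by fun_prop)
    intro y
    refine hcl.closure_subset_iff.2 (fun z hz => ?_) (hx y)
    obtain ⟨C, hC⟩ := hspan z hz
    exact norm_apply_le_of_norm_pow_apply_le hPs hs0 hC
  have hPn : ‖P‖ < 1 := (P.opNorm_le_bound hs0.le hle).trans_lt hs1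
  have hu : IsUnit (1 - P) := (Units.oneSub P hPn).isUnit
  have hu2 : IsUnit (B ^ 2) := by
    have : B ^ 2 = c⁻¹ • (1 - P) := by
      rw [hP, sub_sub_cancel, smul_smul, inv_mul_cancel₀ hc.ne', one_smul]
    rw [this]
    exact (hu.smul (Units.mk0 c⁻¹ (inv_ne_zero hc.ne')))
  exact hunit ((isUnit_pow_iff two_ne_zero).1 hu2)

/-- The coordinates of a sequence in its Gram-Schmidt family form a triangular matrix that
determines all inner products. -/
theorem exists_triangular_coordinates (x : ℕ → E) :
    ∃ g : ℕ → E, (∀ k, ‖g k‖ ≤ 1) ∧ (∀ n k, n < k → ⟪g k, x n⟫_ℝ = 0) ∧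
      ∀ n y, ⟪x n, y⟫_ℝ = ∑ k ∈ Finset.range (n + 1), ⟪g k, x n⟫_ℝ * ⟪g k, y⟫_ℝ := by
  set g := InnerProductSpace.gramSchmidtNormed ℝ x with hg
  have hg1 : ∀ k, g k = 0 ∨ ‖g k‖ = 1 := fun k => by
    by_cases h : g k = 0
    · exact Or.inl h
    · exact Or.inr (InnerProductSpace.gramSchmidtNormed_unit_length' h)
  have horth : ∀ i j, i ≠ j → ⟪g i, g j⟫_ℝ = 0 := fun i j hij => by
    simp [hg, InnerProductSpace.gramSchmidtNormed, real_inner_smul_left, real_inner_smul_right,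
      InnerProductSpace.gramSchmidt_orthogonal ℝ x hij]
  have hmem : ∀ n, x n ∈ Submodule.span ℝ (g '' Set.Iic n) := fun n => by
    rw [hg, InnerProductSpace.span_gramSchmidtNormed, InnerProductSpace.span_gramSchmidt_Iic]
    exact Submodule.subset_span ⟨n, Set.mem_Iic.2 le_rfl, rfl⟩
  refine ⟨g, fun k => ?_, fun n k hnk => ?_, fun n y => ?_⟩
  · rcases hg1 k with h | h <;> simp [h]
  · have : ∀ y ∈ Submodule.span ℝ (g '' Set.Iic n), ⟪g k, y⟫_ℝ = 0 := fun y hy => by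
      induction hy using Submodule.span_induction with
      | mem y hy =>
        obtain ⟨j, hj, rfl⟩ := hy
        exact horth k j (by have := Set.mem_Iic.1 hj; omega)
      | zero => simp
      | add y z _ _ hy hz => rw [inner_add_right, hy, hz, add_zero]
      | smul a y _ hy => rw [real_inner_smul_right, hy, mul_zero]
    exact this _ (hmem n)
  · have : ∀ z ∈ Submodule.span ℝ (g '' Set.Iic n),
        ⟪z, y⟫_ℝ = ∑ k ∈ Finset.range (n + 1), ⟪g k, z⟫_ℝ * ⟪g k, y⟫_ℝ := fun z hz => by
      induction hz using Submodule.span_induction with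
      | mem z hz =>
        obtain ⟨j, hj, rfl⟩ := hz
        rw [Finset.sum_eq_single j]
        · rcases hg1 j with h | h <;> simp [h]
        · intro k _ hkj
          rw [horth k j hkj, zero_mul]
        · intro h
          exact absurd (Finset.mem_range.2 (Nat.lt_succ_of_le hj)) h
      | zero => simp
      | add a b _ _ ha hb =>
        simp only [inner_add_left, inner_add_right, add_mul, Finset.sum_add_distrib, ha, hb]
      | smul a b _ hb =>
        simp only [real_inner_smul_left, real_inner_smul_right, hb, Finset.mul_sum, mul_assoc]
    exact this _ (hmem n)

end Hilbert

section Equivariance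

open scoped InnerProductSpace

variable {V : Type*}

/-- An operator on `ℓ²(V)` is equivariant under a permutation `σ` of `V` if it commutes with the
induced permutation of coordinates. -/
def IsEquivariant (σ : V ≃ V) (T : lp (fun _ : V => ℝ) 2 →L[ℝ] lp (fun _ : V => ℝ) 2) : Prop :=
  ∀ f g : lp (fun _ : V => ℝ) 2, (∀ w, g (σ w) = f w) → ∀ w, T g (σ w) = T f w

variable {σ : V ≃ V} {S T : lp (fun _ : V => ℝ) 2 →L[ℝ] lp (fun _ : V => ℝ) 2}

theorem IsEquivariant.one : IsEquivariant σ 1 := fun _ _ h => h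

theorem IsEquivariant.mul (hS : IsEquivariant σ S) (hT : IsEquivariant σ T) :
    IsEquivariant σ (S * T) := fun f g h => hS (T f) (T g) (hT f g h)

theorem IsEquivariant.pow (hT : IsEquivariant σ T) (n : ℕ) : IsEquivariant σ (T ^ n) := by
  induction n with
  | zero => exact .one
  | succ n ih => exact pow_succ T n ▸ ih.mul hT

theorem IsEquivariant.sub (hS : IsEquivariant σ S) (hT : IsEquivariant σ T) :
    IsEquivariant σ (S - T) := fun f g h w => by
  simp [hS f g h w, hT f g h w]

theorem IsEquivariant.smul (hT : IsEquivariant σ T) (a : ℝ) : IsEquivariant σ (a • T) :=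
  fun f g h w => by simp [hT f g h w]

theorem IsEquivariant.inner_single [DecidableEq V] (hT : IsEquivariant σ T) (u v : V) :
    ⟪T (lp.single 2 (σ u) 1), T (lp.single 2 (σ v) 1)⟫_ℝ =
      ⟪T (lp.single 2 u 1), T (lp.single 2 v 1)⟫_ℝ := by
  have h : ∀ u w, T (lp.single 2 (σ u) 1) (σ w) = T (lp.single 2 u 1) w := fun u =>
    hT _ _ fun w => by
      by_cases hw : w = u
      · subst hw; simp
      · simp [hw]
  rw [lp.inner_eq_tsum, lp.inner_eq_tsum, ← σ.tsum_eq]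
  simp_rw [h]

end Equivariance

section Graph

open scoped InnerProductSpace

variable {V : Type*} {G : SimpleGraph V} [∀ v, Fintype (G.neighborSet v)]
  {A : lp (fun _ : V => ℝ) 2 →L[ℝ] lp (fun _ : V => ℝ) 2}

theorem SimpleGraph.Iso.sum_neighborFinset {M : Type*} [AddCommMonoid M] (φ : G ≃g G) (f : V → M)
    (v : V) : ∑ u ∈ G.neighborFinset (φ v), f u = ∑ u ∈ G.neighborFinset v, f (φ u) :=
  (Finset.sum_equiv φ.toEquiv (fun i => by simpa using (φ.map_adj_iff (v := v) (w := i)).symm)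
    (by simp)).symm

theorem isEquivariant_adjacency
    (hA : ∀ (f : lp (fun _ : V => ℝ) 2) (v : V), A f v = ∑ u ∈ G.neighborFinset v, f u)
    (φ : G ≃g G) : IsEquivariant φ.toEquiv A := fun f g h w => by
  rw [hA]
  refine (φ.sum_neighborFinset _ w).trans ?_
  rw [hA]
  exact Finset.sum_congr rfl fun u _ => h u

theorem adjacency_single [DecidableEq V]
    (hA : ∀ (f : lp (fun _ : V => ℝ) 2) (v : V), A f v = ∑ u ∈ G.neighborFinset v, f u) (v : V) :
    A (lp.single 2 v 1) = ∑ u ∈ G.neighborFinset v, lp.single 2 u (1 : ℝ) := by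
  ext w
  rw [hA, lp.coeFn_sum, Finset.sum_apply]
  have hmem : v ∈ G.neighborFinset w ↔ w ∈ G.neighborFinset v := by
    simp only [SimpleGraph.mem_neighborFinset, G.adj_comm w v]
  simp [Pi.single_apply, -SimpleGraph.mem_neighborFinset, hmem]

theorem dense_span_range_single [DecidableEq V] :
    Dense (Submodule.span ℝ (Set.range fun v : V => lp.single (E := fun _ : V => ℝ) 2 v 1) :
      Set (lp (fun _ : V => ℝ) 2)) := by
  intro f
  have h := lp.hasSum_single (E := fun _ : V => ℝ) ENNReal.ofNat_ne_top f
  refine mem_closure_of_tendsto h (Filter.Eventually.of_forall fun s => ?_)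
  refine Submodule.sum_mem _ fun v _ => ?_
  have : lp.single (E := fun _ : V => ℝ) 2 v (f v) = f v • lp.single 2 v (1 : ℝ) := by
    rw [← lp.single_smul, smul_eq_mul, mul_one]
  rw [this]
  exact Submodule.smul_mem _ _ (Submodule.subset_span ⟨v, rfl⟩)

/-- Invariant families of unit vectors that approximately satisfy the eigenvector equation. -/
theorem exists_invariant_approx_eigenvectors [Nonempty V]
    (htrans : ∀ u v : V, ∃ φ : G ≃g G, φ u = v)
    (hA : ∀ (f : lp (fun _ : V => ℝ) 2) (v : V), A f v = ∑ u ∈ G.neighborFinset v, f u)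
    (hAsa : IsSelfAdjoint A) {lam : ℝ} (hlam : lam ∈ spectrum ℝ A) {ε : ℝ} (hε : 0 < ε) :
    ∃ h : V → lp (fun _ : V => ℝ) 2, (∀ v, ‖h v‖ = 1) ∧
      (∀ (φ : G ≃g G) u v, ⟪h (φ u), h (φ v)⟫_ℝ = ⟪h u, h v⟫_ℝ) ∧
      ∀ v, ‖∑ u ∈ G.neighborFinset v, h u - lam • h v‖ ≤ ε := by
  classical
  set B : lp (fun _ : V => ℝ) 2 →L[ℝ] lp (fun _ : V => ℝ) 2 := A - lam • 1 with hBdef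
  have hB : ∀ x y, ⟪B x, y⟫_ℝ = ⟪x, B y⟫_ℝ := fun x y => by
    have hAs : ⟪A x, y⟫_ℝ = ⟪x, A y⟫_ℝ := hAsa.isSymmetric x y
    simp [hBdef, inner_sub_left, inner_sub_right, real_inner_smul_left, real_inner_smul_right, hAs]
  have hunit : ¬ IsUnit B := by
    rw [spectrum.mem_iff, Algebra.algebraMap_eq_smul_one, ← IsUnit.neg_iff, neg_sub] at hlam
    exact hlam
  obtain ⟨c, hc, hcB⟩ : ∃ c : ℝ, 0 < c ∧ c * ‖B‖ ^ 2 ≤ 1 := by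
    refine ⟨(‖B‖ ^ 2 + 1)⁻¹, by positivity, ?_⟩
    rw [inv_mul_le_one₀ (by positivity)]
    linarith
  set P : lp (fun _ : V => ℝ) 2 →L[ℝ] lp (fun _ : V => ℝ) 2 := 1 - c • B ^ 2 with hP
  have hequiv : ∀ (φ : G ≃g G) (n : ℕ), IsEquivariant φ.toEquiv (P ^ n) := fun φ n =>
    (IsEquivariant.one.sub ((((isEquivariant_adjacency hA φ).sub
      (IsEquivariant.one.smul lam)).pow 2).smul c)).pow n
  have hinner : ∀ (φ : G ≃g G) (n : ℕ) (u v : V),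
      ⟪(P ^ n) (lp.single 2 (φ u) 1), (P ^ n) (lp.single 2 (φ v) 1)⟫_ℝ =
        ⟪(P ^ n) (lp.single 2 u 1), (P ^ n) (lp.single 2 v 1)⟫_ℝ :=
    fun φ n u v => (hequiv φ n).inner_single u v
  have hnorm : ∀ (n : ℕ) (u v : V),
      ‖(P ^ n) (lp.single 2 u 1)‖ = ‖(P ^ n) (lp.single 2 v 1)‖ := fun n u v => by
    obtain ⟨φ, rfl⟩ := htrans u v
    rw [norm_eq_sqrt_real_inner, norm_eq_sqrt_real_inner, hinner]
  obtain ⟨n, hn⟩ := exists_pow_one_sub_smul_sq_approx_ker hB hunit hc hcB hP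
    dense_span_range_single hnorm hε
  obtain ⟨o⟩ := ‹Nonempty V›
  set r := ‖(P ^ n) (lp.single 2 o 1)‖ with hr
  have hr0 : 0 < r := (hn o).1
  have hcomm : Commute (P ^ n) B :=
    (((Commute.one_left B).sub_left (((Commute.refl B).pow_left 2).smul_left c))).pow_left n
  refine ⟨fun v => r⁻¹ • (P ^ n) (lp.single 2 v 1), fun v => ?_, fun φ u v => ?_, fun v => ?_⟩
  · rw [norm_smul, norm_inv, Real.norm_of_nonneg hr0.le, hnorm n v o, inv_mul_cancel₀ hr0.ne']
  · simp only [real_inner_smul_left, real_inner_smul_right, hinner]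
  · have : ∑ u ∈ G.neighborFinset v, r⁻¹ • (P ^ n) (lp.single 2 u 1) -
        lam • r⁻¹ • (P ^ n) (lp.single 2 v 1) = r⁻¹ • B ((P ^ n) (lp.single 2 v 1)) := by
      rw [← mul_apply_eq_comp B, ← hcomm.eq, mul_apply_eq_comp, hBdef, smul_comm lam,
        ← Finset.smul_sum, ← smul_sub, ← map_sum, ← adjacency_single hA,
        ← map_smul, ← map_sub]
      simp
    rw [this, norm_smul, norm_inv, Real.norm_of_nonneg hr0.le, inv_mul_le_iff₀ hr0, mul_comm, hr,
      hnorm n o v]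
    exact (hn v).2

end Graph

section Gaussian

theorem map_sum_infinitePi_gaussianReal {ι : Type*} (s : Finset ι) (a : ι → ℝ) :
    (Measure.infinitePi fun _ : ι => gaussianReal 0 1).map (fun ξ => ∑ k ∈ s, a k * ξ k) =
      gaussianReal 0 (∑ k ∈ s, a k ^ 2).toNNReal := by
  have hind : iIndepFun (fun (k : ι) (ξ : ι → ℝ) => a k * ξ k)
      (Measure.infinitePi fun _ : ι => gaussianReal 0 1) :=
    iIndepFun_infinitePi (X := fun k x => a k * x) (by fun_prop)
  refine Measure.ext_of_charFun ?_
  have hm : ∀ k, Measurable fun ξ : ι → ℝ => a k * ξ k := fun k => by fun_prop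
  have hsum := (hind.restrict s).charFun_map_fun_finsetSum_eq_prod
    fun k _ => (hm k).aemeasurable
  rw [hsum]
  ext t
  have h : ∀ k, (Measure.infinitePi fun _ : ι => gaussianReal 0 1).map (fun ξ => a k * ξ k) =
      gaussianReal 0 (.mk (a k ^ 2) (sq_nonneg _)) := fun k => by
    have := Measure.infinitePi_map_eval (fun _ : ι => gaussianReal 0 1) k
    have h2 := Measure.map_map (μ := Measure.infinitePi fun _ : ι => gaussianReal 0 1)
      (g := fun x => a k * x) (f := fun ξ : ι → ℝ => ξ k) (by fun_prop) (by fun_prop)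
    rw [this, gaussianReal_map_const_mul] at h2
    simpa [Function.comp_def] using h2.symm
  simp_rw [Finset.prod_apply, h, charFun_gaussianReal, ← Complex.exp_sum]
  congr 1
  simp only [Complex.ofReal_zero, mul_zero, zero_mul, zero_sub, Finset.sum_neg_distrib]
  rw [Real.coe_toNNReal _ (Finset.sum_nonneg fun _ _ => sq_nonneg _)]
  push_cast
  rw [← Finset.sum_div, Finset.sum_mul]

theorem ext_of_map_sum_mul {V : Type*} {μ ν : Measure (V → ℝ)} [IsProbabilityMeasure μ]
    [IsProbabilityMeasure ν]
    (h : ∀ (s : Finset V) (c : V → ℝ), μ.map (fun f => ∑ v ∈ s, c v * f v) =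
      ν.map (fun f => ∑ v ∈ s, c v * f v)) : μ = ν := by
  classical
  refine IsProjectiveLimit.unique (P := fun s : Finset V => μ.map s.restrict) (fun s => rfl)
    fun s => ?_
  refine Measure.ext_of_charFunDual ?_
  ext ℓ
  rw [charFunDual_eq_charFun_map_one, charFunDual_eq_charFun_map_one,
    Measure.map_map (by fun_prop) (by fun_prop), Measure.map_map (by fun_prop) (by fun_prop)]
  have : (ℓ ∘ s.restrict : (V → ℝ) → ℝ) = fun f => ∑ v ∈ s,
      (if hv : v ∈ s then ℓ (Pi.single ⟨v, hv⟩ 1) else 0) * f v := by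
    ext f
    rw [← Finset.sum_attach, Function.comp_apply]
    conv_lhs => rw [← Finset.univ_sum_single (s.restrict f), map_sum]
    refine Finset.sum_congr rfl fun v _ => ?_
    have h1 : Pi.single v (s.restrict f v) = f v • Pi.single (M := fun _ : s => ℝ) v 1 := by
      rw [← Pi.single_smul, smul_eq_mul, mul_one]
      rfl
    rw [dif_pos v.2, mul_comm, ← smul_eq_mul, ← map_smul, h1]
  rw [this, h]

end Gaussian

section Limit

variable {V : Type*}

theorem sum_range_mul_eq_of_triangular {e : V → ℕ} {L : V → ℕ → ℝ}
    (hL : ∀ v k, e v < k → L v k = 0) {v : V} {N : ℕ} (hN : e v < N) (ξ : ℕ → ℝ) :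
    ∑ k ∈ Finset.range (e v + 1), L v k * ξ k = ∑ k ∈ Finset.range N, L v k * ξ k := by
  refine Finset.sum_subset (Finset.range_mono hN) fun k _ hk => ?_
  rw [hL v k (by simpa using hk), zero_mul]

/-- A triangular array whose rows are unit vectors, with Gram matrix invariant under the
automorphisms of `G`, and whose columns satisfy the eigenvector equation. -/
theorem exists_triangular_eigenarray [Countable V] [Nonempty V] {G : SimpleGraph V}
    [∀ v, Fintype (G.neighborSet v)]
    (htrans : ∀ u v : V, ∃ φ : G ≃g G, φ u = v)
    {A : lp (fun _ : V => ℝ) 2 →L[ℝ] lp (fun _ : V => ℝ) 2}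
    (hA : ∀ (f : lp (fun _ : V => ℝ) 2) (v : V), A f v = ∑ u ∈ G.neighborFinset v, f u)
    (hAsa : IsSelfAdjoint A) {lam : ℝ} (hlam : lam ∈ spectrum ℝ A) (e : V ≃ ℕ) :
    ∃ L : V → ℕ → ℝ, (∀ v k, e v < k → L v k = 0) ∧
      (∀ v, ∑ k ∈ Finset.range (e v + 1), L v k * L v k = 1) ∧
      (∀ (φ : G ≃g G) u v, ∑ k ∈ Finset.range (e (φ u) + 1), L (φ u) k * L (φ v) k =
        ∑ k ∈ Finset.range (e u + 1), L u k * L v k) ∧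
      ∀ v k, ∑ u ∈ G.neighborFinset v, L u k = lam * L v k := by
  have approx : ∀ m : ℕ, ∃ L : V → ℕ → ℝ, (∀ v k, L v k ∈ Set.Icc (-1 : ℝ) 1) ∧
      (∀ v k, e v < k → L v k = 0) ∧
      (∀ v, ∑ k ∈ Finset.range (e v + 1), L v k * L v k = 1) ∧
      (∀ (φ : G ≃g G) u v, ∑ k ∈ Finset.range (e (φ u) + 1), L (φ u) k * L (φ v) k =
        ∑ k ∈ Finset.range (e u + 1), L u k * L v k) ∧
      ∀ v k, |∑ u ∈ G.neighborFinset v, L u k - lam * L v k| ≤ 1 / ((m : ℝ) + 1) := by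
    intro m
    obtain ⟨h, h1, hinv, hlam⟩ := exists_invariant_approx_eigenvectors htrans hA hAsa hlam
      (ε := 1 / ((m : ℝ) + 1)) (by positivity)
    obtain ⟨g, hg1, htri, hgram⟩ := exists_triangular_coordinates fun n => h (e.symm n)
    have hgram' : ∀ u v, inner ℝ (h u) (h v) =
        ∑ k ∈ Finset.range (e u + 1), inner ℝ (g k) (h u) * inner ℝ (g k) (h v) := fun u v => by
      simpa using hgram (e u) (h v)
    have hbound : ∀ k y, |inner ℝ (g k) y| ≤ ‖y‖ := fun k y =>
      (abs_real_inner_le_norm _ _).trans (mul_le_of_le_one_left (norm_nonneg _) (hg1 k))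
    refine ⟨fun v k => inner ℝ (g k) (h v), fun v k => ?_, fun v k hk => ?_, fun v => ?_,
      fun φ u v => ?_, fun v k => ?_⟩
    · exact abs_le.1 (h1 v ▸ hbound k (h v))
    · simpa using htri (e v) k hk
    · rw [← hgram', real_inner_self_eq_norm_sq, h1, one_pow]
    · rw [← hgram', ← hgram', hinv]
    · rw [← inner_sum, ← real_inner_smul_right, ← inner_sub_right]
      exact (hbound k _).trans (hlam v)
  choose L hbd htri hone hinv hlam using approx
  obtain ⟨M, -, ψ, hψ, hM⟩ := (isCompact_univ_pi fun _ : V => isCompact_univ_pi fun _ : ℕ =>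
    isCompact_Icc (a := (-1 : ℝ)) (b := 1)).tendsto_subseq
      (x := L) fun m v _ k _ => hbd m v k
  have hlim : ∀ v k, Filter.Tendsto (fun m => L (ψ m) v k) Filter.atTop (nhds (M v k)) :=
    fun v k => tendsto_pi_nhds.1 (tendsto_pi_nhds.1 hM v) k
  have hsum : ∀ u v N, Filter.Tendsto (fun m => ∑ k ∈ Finset.range N, L (ψ m) u k * L (ψ m) v k)
      Filter.atTop (nhds (∑ k ∈ Finset.range N, M u k * M v k)) := fun u v N =>
    tendsto_finsetSum _ fun k _ => (hlim u k).mul (hlim v k)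
  refine ⟨M, fun v k hk => ?_, fun v => ?_, fun φ u v => ?_, fun v k => ?_⟩
  · exact tendsto_nhds_unique (hlim v k) (by simp [htri _ v k hk])
  · exact tendsto_nhds_unique (hsum v v _) (by simp [hone])
  · exact tendsto_nhds_unique (hsum _ _ _) (by simpa only [hinv] using hsum u v _)
  · rw [← sub_eq_zero]
    have h1 : Filter.Tendsto (fun m => ∑ u ∈ G.neighborFinset v, L (ψ m) u k - lam * L (ψ m) v k)
        Filter.atTop (nhds (∑ u ∈ G.neighborFinset v, M u k - lam * M v k)) :=
      (tendsto_finsetSum _ fun u _ => hlim u k).sub ((hlim v k).const_mul lam)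
    exact tendsto_nhds_unique h1 (squeeze_zero_norm (fun m => hlam (ψ m) v k)
      (tendsto_one_div_add_atTop_nhds_zero_nat.comp hψ.tendsto_atTop))

/-- The law of a finite linear combination of the Gaussian field with triangular array `L`. -/
theorem map_sum_triangular_gaussian {e : V → ℕ} {L : V → ℕ → ℝ}
    (hL : ∀ v k, e v < k → L v k = 0) {ι : Type*} (s : Finset ι) (c : ι → ℝ) (p : ι → V) :
    (Measure.infinitePi fun _ : ℕ => gaussianReal 0 1).map
        (fun ξ => ∑ i ∈ s, c i * ∑ k ∈ Finset.range (e (p i) + 1), L (p i) k * ξ k) =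
      gaussianReal 0 (∑ i ∈ s, ∑ j ∈ s, c i * c j *
        ∑ k ∈ Finset.range (e (p i) + 1), L (p i) k * L (p j) k).toNNReal := by
  set N := s.sup (fun i => e (p i)) + 1 with hN
  have hlt : ∀ i ∈ s, e (p i) < N := fun i hi =>
    Nat.lt_succ_of_le (Finset.le_sup (f := fun i => e (p i)) hi)
  have h1 : (fun ξ : ℕ → ℝ => ∑ i ∈ s, c i * ∑ k ∈ Finset.range (e (p i) + 1), L (p i) k * ξ k) =
      fun ξ => ∑ k ∈ Finset.range N, (∑ i ∈ s, c i * L (p i) k) * ξ k := by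
    ext ξ
    simp_rw [Finset.sum_mul]
    rw [Finset.sum_comm]
    refine Finset.sum_congr rfl fun i hi => ?_
    rw [sum_range_mul_eq_of_triangular hL (hlt i hi), Finset.mul_sum]
    simp_rw [mul_assoc]
  rw [h1, map_sum_infinitePi_gaussianReal]
  congr 2
  simp_rw [pow_two, Finset.sum_mul_sum]
  rw [Finset.sum_comm]
  refine Finset.sum_congr rfl fun i hi => ?_
  rw [Finset.sum_comm]
  refine Finset.sum_congr rfl fun j _ => ?_
  rw [sum_range_mul_eq_of_triangular hL (hlt i hi), Finset.mul_sum]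
  exact Finset.sum_congr rfl fun k _ => by ring

end Limit

/-- Let `G` be an infinite, countable, `d`-regular, vertex-transitive
simple graph, `A` its adjacency operator on `ℓ²(V)` and `λ ∈ spectrum A`. Then there is
a probability measure `μ` on `ℝ^V` (product σ-algebra) that is (i) invariant under the
coordinate-permutation action of every automorphism of `G`; (ii) pushes forward to a
centered Gaussian measure under every finitely supported linear functional; (iii) has
standard Gaussian one-dimensional marginals; and (iv) is concentrated on functions
satisfying the eigenvector equation `Σ_{u ∈ N(v)} f(u) = λ·f(v)` at every vertex. -/
theorem exists_gaussian_wave_function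
    {V : Type*} [Countable V] [Infinite V] (G : SimpleGraph V)
    [∀ v, Fintype (G.neighborSet v)]
    (d : ℕ) (hreg : G.IsRegularOfDegree d)
    (htrans : ∀ u v : V, ∃ φ : G ≃g G, φ u = v)
    (A : lp (fun _ : V => ℝ) 2 →L[ℝ] lp (fun _ : V => ℝ) 2)
    (hA : ∀ (f : lp (fun _ : V => ℝ) 2) (v : V),
      (A f : ∀ _ : V, ℝ) v = ∑ u ∈ G.neighborFinset v, (f : ∀ _ : V, ℝ) u)
    (hAsa : IsSelfAdjoint A)
    (lam : ℝ) (hlam : lam ∈ spectrum ℝ A) :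
    ∃ μ : Measure (V → ℝ), IsProbabilityMeasure μ ∧
      (∀ φ : G ≃g G, μ.map (fun f : V → ℝ => fun v => f (φ.symm v)) = μ) ∧
      (∀ c : V →₀ ℝ, ∃ σ2 : NNReal,
        μ.map (fun f : V → ℝ => ∑ v ∈ c.support, c v * f v) = gaussianReal 0 σ2) ∧
      (∀ v : V, μ.map (fun f : V → ℝ => f v) = gaussianReal 0 1) ∧
      (∀ᵐ f ∂μ, ∀ v : V, ∑ u ∈ G.neighborFinset v, f u = lam * f v) := by
  classical
  obtain ⟨e⟩ : Nonempty (V ≃ ℕ) := nonempty_equiv_of_countable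
  obtain ⟨L, hL, hone, hinv, heig⟩ := exists_triangular_eigenarray htrans hA hAsa hlam e
  let F : (ℕ → ℝ) → V → ℝ := fun ξ v => ∑ k ∈ Finset.range (e v + 1), L v k * ξ k
  have hF : Measurable F := by
    refine measurable_pi_lambda _ fun v => Finset.measurable_sum _ fun k _ => ?_
    exact (measurable_pi_apply k).const_mul _
  let μ : Measure (V → ℝ) := (Measure.infinitePi fun _ : ℕ => gaussianReal 0 1).map F
  have hμ : IsProbabilityMeasure μ := Measure.isProbabilityMeasure_map hF.aemeasurable
  have hlaw : ∀ (s : Finset V) (c : V → ℝ) (p : V → V),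
      μ.map (fun f => ∑ v ∈ s, c v * f (p v)) = gaussianReal 0 (∑ u ∈ s, ∑ v ∈ s, c u * c v *
        ∑ k ∈ Finset.range (e (p u) + 1), L (p u) k * L (p v) k).toNNReal := fun s c p => by
    rw [Measure.map_map (by fun_prop) hF]
    exact map_sum_triangular_gaussian hL s c p
  refine ⟨μ, hμ, fun φ => ?_, fun c => ⟨_, hlaw c.support c id⟩, fun v => ?_, ?_⟩
  · have hφ : Measurable fun (f : V → ℝ) v => f (φ.symm v) := by fun_prop
    have := Measure.isProbabilityMeasure_map (μ := μ) hφ.aemeasurable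
    refine ext_of_map_sum_mul fun s c => ?_
    rw [Measure.map_map (by fun_prop) hφ]
    refine (hlaw s c φ.symm).trans ?_
    simp_rw [hinv φ.symm]
    exact (hlaw s c id).symm
  · simpa [hone] using hlaw {v} 1 id
  · rw [ae_all_iff]
    intro v
    refine (ae_map_iff hF.aemeasurable (measurableSet_eq_fun (by fun_prop) (by fun_prop))).2
      (Filter.Eventually.of_forall fun ξ => ?_)
    set N := (insert v (G.neighborFinset v)).sup e + 1 with hN
    have hlt : ∀ u ∈ insert v (G.neighborFinset v), e u < N := fun u hu =>
      Nat.lt_succ_of_le (Finset.le_sup (f := e) hu)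
    have hsum : ∀ u ∈ insert v (G.neighborFinset v),
        F ξ u = ∑ k ∈ Finset.range N, L u k * ξ k := fun u hu =>
      sum_range_mul_eq_of_triangular hL (hlt u hu) ξ
    rw [hsum v (Finset.mem_insert_self _ _),
      Finset.sum_congr rfl fun u hu => hsum u (Finset.mem_insert_of_mem hu), Finset.sum_comm,
      Finset.mul_sum]
    refine Finset.sum_congr rfl fun k _ => ?_
    rw [← Finset.sum_mul, heig, mul_assoc]
end

section
/- Let d ≥ 2 be an integer and let u₁, …, u_d be unit vectors in ℝ^d with ⟨u_i, u_j⟩ = 1/2 for all i ≠ j. Then the standard Gaussian measure of the set {z ∈ ℝ^d : ⟨u_i, z⟩ > 0 for all i = 1, …, d} equals 1/(d+1). -/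
open MeasureTheory ProbabilityTheory

theorem charFun_map_pi_gaussianReal {ι κ : Type*} [Fintype ι] [Fintype κ]
    (w : κ → ι → ℝ) (t : EuclideanSpace ℝ κ) :
    charFun ((Measure.pi fun _ : ι => gaussianReal 0 1).map
      (fun z => WithLp.toLp 2 fun i => ∑ k, w i k * z k)) t =
    Complex.exp (-((∑ i, ∑ j, t i * t j * ∑ k, w i k * w j k : ℝ) : ℂ) / 2) := by
  have hnorm : ‖WithLp.toLp 2 (fun k => ∑ i, t i * w i k)‖ ^ 2 =
      ∑ i, ∑ j, t i * t j * ∑ k, w i k * w j k := by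
    simp_rw [EuclideanSpace.real_norm_sq_eq, sq, Finset.sum_mul_sum, Finset.mul_sum]
    rw [Finset.sum_comm]
    refine Finset.sum_congr rfl fun i _ => ?_
    rw [Finset.sum_comm]
    exact Finset.sum_congr rfl fun j _ => Finset.sum_congr rfl fun k _ => by ring
  rw [← hnorm, Complex.ofReal_pow, ← charFun_stdGaussian, ← map_pi_eq_stdGaussian,
    charFun_apply, charFun_apply,
    integral_map (Measurable.aemeasurable (by fun_prop))
      (Measurable.aestronglyMeasurable (by fun_prop)),
    integral_map (Measurable.aemeasurable (by fun_prop))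
      (Measurable.aestronglyMeasurable (by fun_prop))]
  congr! 5 with z
  simp only [PiLp.inner_apply, RCLike.inner_apply, conj_trivial, Finset.mul_sum, Finset.sum_mul]
  rw [Finset.sum_comm]
  exact Finset.sum_congr rfl fun j _ => Finset.sum_congr rfl fun k _ => by ring

/-- The law of a linear image of a standard Gaussian vector depends only on the Gram matrix of the
coefficient vectors. -/
theorem map_pi_gaussianReal_eq_of_gram_eq {ι ι' κ : Type*} [Fintype ι] [Fintype ι'] [Fintype κ]
    (u : κ → ι → ℝ) (v : κ → ι' → ℝ)
    (h : ∀ i j, ∑ k, u i k * u j k = ∑ k, v i k * v j k) :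
    (Measure.pi fun _ : ι => gaussianReal 0 1).map (fun z i => ∑ k, u i k * z k) =
      (Measure.pi fun _ : ι' => gaussianReal 0 1).map (fun z i => ∑ k, v i k * z k) := by
  have key : (Measure.pi fun _ : ι => gaussianReal 0 1).map
        (fun z => WithLp.toLp 2 fun i => ∑ k, u i k * z k) =
      (Measure.pi fun _ : ι' => gaussianReal 0 1).map
        (fun z => WithLp.toLp 2 fun i => ∑ k, v i k * z k) := by
    refine Measure.ext_of_charFun (E := EuclideanSpace ℝ κ) (funext fun t => ?_)
    rw [charFun_map_pi_gaussianReal, charFun_map_pi_gaussianReal]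
    simp_rw [h]
  have := congrArg (Measure.map (WithLp.ofLp : EuclideanSpace ℝ κ → κ → ℝ)) key
  rwa [Measure.map_map (by fun_prop) (by fun_prop), Measure.map_map (by fun_prop) (by fun_prop)]
    at this

theorem pi_gaussianReal_setOf_eq_eq_zero {ι : Type*} [Fintype ι] {i j : ι} (hij : i ≠ j) :
    (Measure.pi fun _ : ι => gaussianReal 0 1) {z | z i = z j} = 0 := by
  classical
  have h := map_pi_gaussianReal_eq_of_gram_eq (κ := Unit)
    (fun _ => Pi.single i (1 : ℝ) - Pi.single j 1) (fun _ => Pi.single i √2) (by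
      intro _ _
      simp [sub_mul, Pi.single_apply, hij, hij.symm]
      norm_num)
  have hs : MeasurableSet {y : Unit → ℝ | y () = 0} :=
    measurableSet_eq_fun (by fun_prop) (by fun_prop)
  have h0 := congrArg (fun μ => μ {y : Unit → ℝ | y () = 0}) h
  simp only [Measure.map_apply (show Measurable fun (z : ι → ℝ) (_ : Unit) =>
      ∑ k, (Pi.single i (1 : ℝ) - Pi.single j 1 : ι → ℝ) k * z k by fun_prop) hs,
    Measure.map_apply (show Measurable fun (z : ι → ℝ) (_ : Unit) =>
      ∑ k, (Pi.single i √2 : ι → ℝ) k * z k by fun_prop) hs] at h0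
  have := nullSingletonClass_gaussianReal (μ := 0) (v := 1) one_ne_zero
  have hz := Measure.pi_hyperplane (fun _ : ι => gaussianReal 0 1) i 0
  simpa [Set.preimage, sub_mul, Pi.single_apply, sub_eq_zero, hz] using h0

theorem pi_gaussianReal_setOf_lt_eq {ι : Type*} [Fintype ι] (i j : ι) :
    (Measure.pi fun _ : ι => gaussianReal 0 1) {z | ∀ k, k ≠ i → z i < z k} =
      (Measure.pi fun _ : ι => gaussianReal 0 1) {z | ∀ k, k ≠ j → z j < z k} := by
  classical
  have h := (measurePreserving_piCongrLeft (fun _ : ι => gaussianReal 0 1)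
    (Equiv.swap i j)).measure_preimage_equiv {z | ∀ k, k ≠ i → z i < z k}
  rw [← h]
  congr 1
  ext z
  have hz (k : ι) : MeasurableEquiv.piCongrLeft (fun _ : ι => ℝ) (Equiv.swap i j) z k =
      z (Equiv.swap i j k) := by
    conv_lhs => rw [← Equiv.swap_apply_self i j k]
    exact Equiv.piCongrLeft_apply_apply (fun _ : ι => ℝ) (Equiv.swap i j) z _
  simp only [Set.mem_preimage, Set.mem_ofPred_eq, hz, Equiv.swap_apply_left]
  refine ⟨fun h k hk => ?_, fun h k hk => h _ ?_⟩
  · have := h (Equiv.swap i j k) (by rwa [Ne, Equiv.swap_apply_eq_iff, Equiv.swap_apply_left])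
    simpa using this
  · rwa [Ne, Equiv.swap_apply_eq_iff, Equiv.swap_apply_right]

/-- Each coordinate of a standard Gaussian vector is equally likely to be the strict minimum. -/
theorem pi_gaussianReal_setOf_lt {ι : Type*} [Fintype ι] (i : ι) :
    (Measure.pi fun _ : ι => gaussianReal 0 1) {z | ∀ k, k ≠ i → z i < z k} =
      1 / (Fintype.card ι : ENNReal) := by
  have : Nonempty ι := ⟨i⟩
  set μ := Measure.pi fun _ : ι => gaussianReal 0 1
  let A (j : ι) : Set (ι → ℝ) := {z | ∀ k, k ≠ j → z j < z k}
  have hmeas (j : ι) : MeasurableSet (A j) := by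
    simp only [A, Set.ofPred_forall]
    exact .iInter fun k => .iInter fun _ => measurableSet_lt (by fun_prop) (by fun_prop)
  have hdisj : Pairwise (Function.onFun Disjoint A) := fun j k hjk =>
    Set.disjoint_left.2 fun z hj hk => lt_asymm (hj k hjk.symm) (hk j hjk)
  have hae : ∀ᵐ z ∂μ, ∀ j k, j ≠ k → z j ≠ z k := by
    refine ae_all_iff.2 fun j => ae_all_iff.2 fun k => ?_
    by_cases hjk : j = k
    · simp [hjk]
    · filter_upwards [measure_eq_zero_iff_ae_notMem.1 (pi_gaussianReal_setOf_eq_eq_zero hjk)]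
        with z hz _ using hz
  have hunion : μ (⋃ j, A j) = 1 := by
    refine (mem_ae_iff_prob_eq_one (.iUnion hmeas)).1 ?_
    filter_upwards [hae] with z hz
    obtain ⟨j, hj⟩ := Finite.exists_min z
    exact Set.mem_iUnion.2 ⟨j, fun k hk => (hj k).lt_of_ne (hz j k hk.symm)⟩
  rw [measure_iUnion hdisj hmeas, tsum_fintype,
    Finset.sum_congr rfl fun j _ => pi_gaussianReal_setOf_lt_eq j i] at hunion
  rw [ENNReal.eq_div_iff (by simp) (by simp)]
  simpa using hunion


/-- Let `d ≥ 2` and let `u₁, …, u_d` be unit vectors in `ℝ^d` with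
pairwise inner products `⟨u_i, u_j⟩ = 1/2`. Then the standard Gaussian measure of the
cone `{z : ⟨u_i, z⟩ > 0 for all i}` equals `1/(d+1)`. -/
theorem gaussian_measure_simplicial_cone_eq
    (d : ℕ) (hd : 2 ≤ d) (u : Fin d → Fin d → ℝ)
    (hunit : ∀ i, ∑ k, u i k * u i k = 1)
    (hangle : ∀ i j, i ≠ j → ∑ k, u i k * u j k = 1 / 2) :
    Measure.pi (fun _ : Fin d => gaussianReal 0 1)
        {z : Fin d → ℝ | ∀ i, 0 < ∑ k, u i k * z k}
      = 1 / ((d : ENNReal) + 1) := by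

  have h := map_pi_gaussianReal_eq_of_gram_eq (fun i k => √2 * u i k)
    (fun (i : Fin d) => (Pi.single i.succ 1 - Pi.single 0 1 : Fin (d + 1) → ℝ)) (by
      intro i j
      have hu : ∑ k, √2 * u i k * (√2 * u j k) = 2 * ∑ k, u i k * u j k := by
        rw [Finset.mul_sum]
        refine Finset.sum_congr rfl fun k _ => ?_
        rw [mul_mul_mul_comm, Real.mul_self_sqrt (by norm_num)]
      rw [hu]
      rcases eq_or_ne i j with rfl | hij
      · rw [hunit]
        simp [sub_mul, Pi.single_apply, (Fin.succ_ne_zero _).symm]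
        norm_num
      · rw [hangle i j hij]
        simp [sub_mul, Pi.single_apply, hij, (Fin.succ_ne_zero _).symm])
  have hs : MeasurableSet {y : Fin d → ℝ | ∀ i, 0 < y i} := by
    rw [Set.ofPred_forall]
    exact .iInter fun i => measurableSet_lt (by fun_prop) (by fun_prop)
  have h0 := congrArg (fun μ => μ {y : Fin d → ℝ | ∀ i, 0 < y i}) h
  simp only [Measure.map_apply (show Measurable fun (z : Fin d → ℝ) (i : Fin d) =>
      ∑ k, √2 * u i k * z k by fun_prop) hs,
    Measure.map_apply (show Measurable fun (z : Fin (d + 1) → ℝ) (i : Fin d) =>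
      ∑ k, (Pi.single i.succ (1 : ℝ) - Pi.single 0 1 : Fin (d + 1) → ℝ) k * z k by fun_prop) hs]
    at h0
  have hmin := pi_gaussianReal_setOf_lt (0 : Fin (d + 1))
  rw [Fintype.card_fin, Nat.cast_add, Nat.cast_one] at hmin
  rw [← hmin]
  simpa [Set.preimage, sub_mul, Pi.single_apply, mul_assoc, ← Finset.mul_sum,
    Fin.forall_fin_succ (n := d)] using h0
end

section
/- Let d ≥ 3 be an integer, let λ ∈ [−d, 0], and let u₁, …, u_d be unit vectors in ℝ^d with ⟨u_i, u_j⟩ = (d − 2 − λ)/(2(d − 1)) for all i ≠ j. Then the standard Gaussian measure of the set {z ∈ ℝ^d : ⟨u_i, z⟩ > 0 for all i = 1, …, d} is at least 1/2 − (1/3)·√(λ + d). -/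
open MeasureTheory ProbabilityTheory

/-- A centred real Gaussian of variance `v` exceeds `g ≥ 0` with probability at least
`1/2 - g / √(2πv)`. -/
theorem gaussianReal_real_Ioi_ge {v : NNReal} (hv : v ≠ 0) {g : ℝ} (hg : 0 ≤ g) :
    1 / 2 - g * (√(2 * Real.pi * v))⁻¹ ≤ (gaussianReal 0 v).real (Set.Ioi g) := by
  set K := (√(2 * Real.pi * v))⁻¹ with hK
  have hK0 : 0 ≤ K := by positivity
  have hneg : (gaussianReal 0 v).real (Set.Iio (-g)) = (gaussianReal 0 v).real (Set.Ioi g) := by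
    have h := gaussianReal_map_neg (μ := 0) (v := v)
    rw [neg_zero] at h
    conv_rhs => rw [← h]
    rw [map_measureReal_apply measurable_neg measurableSet_Ioi]
    congr 1
    ext x
    simp
  have hmid : (gaussianReal 0 v).real (Set.Icc (-g) g) ≤ 2 * (g * K) := by
    rw [Measure.real, gaussianReal_apply_eq_integral _ hv]
    have hle : ∫ x in Set.Icc (-g) g, gaussianPDFReal 0 v x ≤ ∫ _ in Set.Icc (-g) g, K := by
      refine setIntegral_mono (integrable_gaussianPDFReal 0 v).integrableOn
        (by simp) fun x => ?_
      rw [gaussianPDFReal_def]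
      refine mul_le_of_le_one_right hK0 (Real.exp_le_one_iff.2 ?_)
      exact div_nonpos_of_nonpos_of_nonneg (neg_nonpos.2 (sq_nonneg _)) (by positivity)
    rw [setIntegral_const, Real.volume_real_Icc_of_le (by linarith), smul_eq_mul] at hle
    refine ENNReal.toReal_le_of_le_ofReal (by positivity) (ENNReal.ofReal_le_ofReal ?_)
    linarith
  have hcover : (Set.univ : Set ℝ) ⊆ (Set.Iio (-g) ∪ Set.Icc (-g) g) ∪ Set.Ioi g := by
    intro x _
    rcases lt_or_ge x (-g) with h | h
    · exact Or.inl (Or.inl h)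
    · rcases le_or_gt x g with h' | h'
      · exact Or.inl (Or.inr ⟨h, h'⟩)
      · exact Or.inr h'
  have h1 : (gaussianReal 0 v).real Set.univ ≤ _ := measureReal_mono hcover
  have h2 := measureReal_union_le (μ := gaussianReal 0 v) (Set.Iio (-g) ∪ Set.Icc (-g) g) (Set.Ioi g)
  have h3 := measureReal_union_le (μ := gaussianReal 0 v) (Set.Iio (-g)) (Set.Icc (-g) g)
  rw [probReal_univ] at h1
  linarith

/-- A centred Gaussian exceeds an independent nonnegative random variable `G` with probability at
least `1/2 - E[G] / √(2πv)`. -/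
theorem measureReal_lt_gaussian_ge {Ω : Type*} [MeasurableSpace Ω] {P : Measure Ω}
    [IsProbabilityMeasure P] {W G : Ω → ℝ} {v : NNReal} (hv : v ≠ 0)
    (hW : Measurable W) (hG : Measurable G) (hlaw : P.map W = gaussianReal 0 v)
    (hind : IndepFun G W P) (hG0 : ∀ ω, 0 ≤ G ω) (hGint : Integrable G P) :
    1 / 2 - (∫ ω, G ω ∂P) * (√(2 * Real.pi * v))⁻¹ ≤ P.real {ω | G ω < W ω} := by
  have hS : MeasurableSet {p : ℝ × ℝ | p.1 < p.2} := measurableSet_lt measurable_fst measurable_snd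
  have hprod := (indepFun_iff_map_prod_eq_prod_map_map hG.aemeasurable hW.aemeasurable).1 hind
  have hF : Measurable fun g => gaussianReal 0 v (Set.Ioi g) :=
    measurable_measure_prodMk_left (ν := gaussianReal 0 v) hS
  have hP : P.real {ω | G ω < W ω} = ∫ ω, (gaussianReal 0 v).real (Set.Ioi (G ω)) ∂P := by
    have h : P {ω | G ω < W ω} = ∫⁻ ω, gaussianReal 0 v (Set.Ioi (G ω)) ∂P := by
      calc P {ω | G ω < W ω}
          = P.map (fun ω => (G ω, W ω)) {p : ℝ × ℝ | p.1 < p.2} := by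
            rw [Measure.map_apply (hG.prodMk hW) hS]; rfl
        _ = ∫⁻ g, gaussianReal 0 v (Set.Ioi g) ∂(P.map G) := by
            rw [hprod, hlaw, Measure.prod_apply hS]; rfl
        _ = _ := lintegral_map hF hG
    rw [Measure.real, h]
    exact (integral_toReal (hF.comp hG).aemeasurable (.of_forall fun ω => measure_lt_top _ _)).symm
  rw [hP]
  have hI : ∫ ω, (1 / 2 - G ω * (√(2 * Real.pi * v))⁻¹) ∂P
      = 1 / 2 - (∫ ω, G ω ∂P) * (√(2 * Real.pi * v))⁻¹ := by
    rw [integral_sub (integrable_const _) (hGint.mul_const _), integral_mul_const]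
    simp
  rw [← hI]
  refine integral_mono ((integrable_const _).sub (hGint.mul_const _)) ?_
    fun ω => gaussianReal_real_Ioi_ge hv (hG0 ω)
  exact .of_bound (hF.comp hG).ennreal_toReal.aestronglyMeasurable 1
    (.of_forall fun ω => (Real.norm_of_nonneg measureReal_nonneg).trans_le measureReal_le_one)

theorem isGaussian_pi_gaussianReal {ι : Type*} [Fintype ι] :
    IsGaussian (Measure.pi fun _ : ι => gaussianReal 0 1) := by
  have h := iIndepFun.hasGaussianLaw (P := Measure.pi fun _ : ι => gaussianReal 0 1)
    (X := fun i (z : ι → ℝ) => z i) (fun i => ?_)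
    (iIndepFun_pi (X := fun _ => id) (fun _ => aemeasurable_id))
  · simpa using h.isGaussian_map
  · constructor
    rw [(measurePreserving_eval (fun _ : ι => gaussianReal 0 1) i).map_eq]
    infer_instance

/-- Linear forms `z ↦ ∑ aₖ zₖ` under the standard Gaussian have covariance `∑ aₖ bₖ`. -/
theorem covariance_sum_mul_pi_gaussianReal {ι : Type*} [Fintype ι] (a b : ι → ℝ) :
    cov[fun z : ι → ℝ => ∑ k, a k * z k, fun z => ∑ k, b k * z k;
      Measure.pi fun _ : ι => gaussianReal 0 1] = ∑ k, a k * b k := by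
  classical
  set P := Measure.pi fun _ : ι => gaussianReal 0 1
  have hmp (i : ι) := measurePreserving_eval (fun _ : ι => gaussianReal 0 1) i
  have hL (i : ι) : MemLp (fun z : ι → ℝ => z i) 2 P :=
    (IsGaussian.memLp_two_id (μ := gaussianReal 0 1)).comp_measurePreserving (hmp i)
  rw [covariance_fun_sum_fun_sum (fun i => (hL i).const_mul _) (fun i => (hL i).const_mul _)]
  refine Finset.sum_congr rfl fun i _ => ?_
  rw [Finset.sum_eq_single i]
  · rw [covariance_const_mul_left, covariance_const_mul_right, covariance_self (hL i).aemeasurable]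
    have : Var[fun z : ι → ℝ => z i; P] = Var[id; gaussianReal 0 1] := by
      rw [← (hmp i).map_eq, variance_map aemeasurable_id (hmp i).aemeasurable]; rfl
    rw [this, variance_id_gaussianReal]
    simp
  · intro j _ hj
    have hind := (iIndepFun_pi (μ := fun _ : ι => gaussianReal 0 1)
      (X := fun _ => (id : ℝ → ℝ)) (fun _ => aemeasurable_id)).indepFun hj.symm
    rw [covariance_const_mul_left, covariance_const_mul_right,
      IndepFun.covariance_eq_zero (X := fun z : ι → ℝ => z i) (Y := fun z => z j) hind
        (hL i) (hL j)]
    simp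
  · simp

theorem hasGaussianLaw_sum_mul_pi_gaussianReal {ι : Type*} [Fintype ι] (a : ι → ℝ) :
    HasGaussianLaw (fun z : ι → ℝ => ∑ k, a k * z k)
      (Measure.pi fun _ : ι => gaussianReal 0 1) := by
  have := isGaussian_pi_gaussianReal (ι := ι)
  simpa using (IsGaussian.hasGaussianLaw_id (μ := Measure.pi fun _ : ι => gaussianReal 0 1)).map_fun
    (∑ k, a k • ContinuousLinearMap.proj (R := ℝ) (φ := fun _ : ι => ℝ) k)

theorem integral_sum_mul_pi_gaussianReal {ι : Type*} [Fintype ι] (a : ι → ℝ) :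
    ∫ z : ι → ℝ, ∑ k, a k * z k ∂(Measure.pi fun _ : ι => gaussianReal 0 1) = 0 := by
  have hmp (i : ι) := measurePreserving_eval (fun _ : ι => gaussianReal 0 1) i
  rw [integral_finsetSum]
  · refine Finset.sum_eq_zero fun i _ => ?_
    have h := integral_map (hmp i).aemeasurable (f := fun x : ℝ => x) (by fun_prop)
    rw [(hmp i).map_eq, integral_id_gaussianReal] at h
    simp only [Function.eval] at h
    rw [integral_const_mul, ← h, mul_zero]
  · intro i _
    exact (((IsGaussian.memLp_two_id (μ := gaussianReal 0 1)).comp_measurePreserving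
      (hmp i)).integrable (by norm_num)).const_mul _

/-- The linear form `z ↦ ∑ aₖ zₖ` is centred Gaussian with variance `∑ aₖ²`. -/
theorem map_sum_mul_pi_gaussianReal {ι : Type*} [Fintype ι] (a : ι → ℝ) :
    (Measure.pi fun _ : ι => gaussianReal 0 1).map (fun z : ι → ℝ => ∑ k, a k * z k)
      = gaussianReal 0 (∑ k, a k * a k).toNNReal := by
  have hlin := hasGaussianLaw_sum_mul_pi_gaussianReal a
  rw [hlin.map_eq_gaussianReal, ← covariance_self hlin.aemeasurable,
    covariance_sum_mul_pi_gaussianReal, integral_sum_mul_pi_gaussianReal]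

theorem integral_sq_sum_mul_pi_gaussianReal {ι : Type*} [Fintype ι] (a : ι → ℝ) :
    ∫ z : ι → ℝ, (∑ k, a k * z k) ^ 2 ∂(Measure.pi fun _ : ι => gaussianReal 0 1)
      = ∑ k, a k * a k := by
  have hlin := hasGaussianLaw_sum_mul_pi_gaussianReal a
  rw [← covariance_sum_mul_pi_gaussianReal, covariance_self hlin.aemeasurable,
    variance_of_integral_eq_zero hlin.aemeasurable (integral_sum_mul_pi_gaussianReal a)]

/-- Linear forms orthogonal to `m` are independent of `z ↦ ∑ mₖ zₖ`. -/
theorem indepFun_sum_mul_pi_gaussianReal {ι κ : Type*} [Fintype ι] [Fintype κ] (m : ι → ℝ)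
    (b : κ → ι → ℝ) (h : ∀ i, ∑ k, b i k * m k = 0) :
    IndepFun (fun (z : ι → ℝ) i => ∑ k, b i k * z k) (fun z => ∑ k, m k * z k)
      (Measure.pi fun _ : ι => gaussianReal 0 1) := by
  set P := Measure.pi fun _ : ι => gaussianReal 0 1
  have : IsGaussian P := isGaussian_pi_gaussianReal
  have hlin := (IsGaussian.hasGaussianLaw_id (μ := P)).map_fun
    ((ContinuousLinearMap.pi fun i =>
      ∑ k, b i k • ContinuousLinearMap.proj (R := ℝ) (φ := fun _ : ι => ℝ) k).prod
    (ContinuousLinearMap.pi fun _ : Unit =>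
      ∑ k, m k • ContinuousLinearMap.proj (R := ℝ) (φ := fun _ : ι => ℝ) k))
  have hind := HasGaussianLaw.indepFun_of_covariance_eval (P := P)
    (X := fun i (z : ι → ℝ) => ∑ k, b i k * z k) (Y := fun (_ : Unit) z => ∑ k, m k * z k)
    (by convert hlin using 2 <;> ext <;> simp)
    (fun i _ => by rw [covariance_sum_mul_pi_gaussianReal, h])
  exact hind.comp (φ := id) (ψ := fun f => f ()) measurable_id
    (measurable_pi_apply (X := fun _ : Unit => ℝ) ())

/-- An entry of a vector whose coordinates sum to zero is controlled by the Euclidean norm. -/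
theorem card_mul_sq_le_of_sum_eq_zero {ι : Type*} [Fintype ι] {a : ι → ℝ} (ha : ∑ i, a i = 0)
    (i : ι) : Fintype.card ι * a i ^ 2 ≤ (Fintype.card ι - 1) * ∑ j, a j ^ 2 := by
  classical
  have h := sq_sum_le_card_mul_sum_sq (s := Finset.univ.erase i) (f := a)
  have h1 := Finset.add_sum_erase Finset.univ a (Finset.mem_univ i)
  have h2 := Finset.add_sum_erase Finset.univ (fun j => a j ^ 2) (Finset.mem_univ i)
  rw [Finset.card_erase_of_mem (Finset.mem_univ i), Finset.card_univ,
    Nat.cast_sub (Fintype.card_pos_iff.2 ⟨i⟩), Nat.cast_one] at h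
  rw [show ∑ j ∈ Finset.univ.erase i, a j = -a i by linarith,
    show ∑ j ∈ Finset.univ.erase i, a j ^ 2 = ∑ j, a j ^ 2 - a i ^ 2 by linarith] at h
  linarith

/-- Lower bound for the Gaussian measure of a simplicial cone in terms of the barycentre `m` of
its unit normals, provided `m` has the same inner product `c` with all of them. -/
theorem measureReal_simplicial_cone_ge {ι κ : Type*} [Fintype ι] [Fintype κ] [Nonempty κ]
    (u : κ → ι → ℝ) (m : ι → ℝ) {c : ℝ} (hc : 0 < c)
    (hm : ∀ k, ∑ i, u i k = Fintype.card κ * m k)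
    (hmm : ∑ k, m k * m k = c) (hum : ∀ i, ∑ k, u i k * m k = c)
    (hunit : ∀ i, ∑ k, u i k * u i k = 1) :
    1 / 2 - √((Fintype.card κ - 1) * (1 - c)) * (√(2 * Real.pi * c))⁻¹
      ≤ (Measure.pi fun _ : ι => gaussianReal 0 1).real
          {z : ι → ℝ | ∀ i, 0 < ∑ k, u i k * z k} := by
  set P := Measure.pi fun _ : ι => gaussianReal 0 1
  set n : ℝ := (Fintype.card κ : ℝ)
  have hn : 1 ≤ n := Nat.one_le_cast.2 (Fintype.card_pos (α := κ))
  set S : (ι → ℝ) → ℝ := fun z => ∑ k, m k * z k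
  set A : κ → (ι → ℝ) → ℝ := fun i z => ∑ k, (u i k - m k) * z k
  set G : (ι → ℝ) → ℝ := fun z => √((n - 1) / n * ∑ i, A i z ^ 2)
  have hA (i : κ) (z : ι → ℝ) : ∑ k, u i k * z k = A i z + S z := by
    simp only [A, S, ← Finset.sum_add_distrib]
    exact Finset.sum_congr rfl fun k _ => by ring
  have hA0 (z : ι → ℝ) : ∑ i, A i z = 0 := by
    simp only [A]
    rw [Finset.sum_comm]
    refine Finset.sum_eq_zero fun k _ => ?_
    rw [← Finset.sum_mul, Finset.sum_sub_distrib, hm]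
    simp [n]
  have horth (i : κ) : ∑ k, (u i k - m k) * m k = 0 := by
    simp only [sub_mul, Finset.sum_sub_distrib, hum, hmm, sub_self]
  have hnorm (i : κ) : ∑ k, (u i k - m k) * (u i k - m k) = 1 - c := by
    have (k : ι) : (u i k - m k) * (u i k - m k)
        = u i k * u i k - u i k * m k - (u i k - m k) * m k := by ring
    simp only [this, Finset.sum_sub_distrib, horth, hum, hunit, sub_zero]
  have hAL (i : κ) : MemLp (A i) 2 P := (hasGaussianLaw_sum_mul_pi_gaussianReal _).memLp_two
  have hG2int : Integrable (fun z => G z ^ 2) P := by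
    have : (fun z => G z ^ 2) = fun z => (n - 1) / n * ∑ i, A i z ^ 2 := by
      ext z
      exact Real.sq_sqrt (mul_nonneg (div_nonneg (by linarith) (by linarith)) (by positivity))
    rw [this]
    exact (integrable_finsetSum _ fun i _ => (hAL i).integrable_sq).const_mul _
  have hG2 : ∫ z, G z ^ 2 ∂P = (n - 1) * (1 - c) := by
    calc ∫ z, G z ^ 2 ∂P = ∫ z, (n - 1) / n * ∑ i, A i z ^ 2 ∂P := by
          refine integral_congr_ae (.of_forall fun z => ?_)
          exact Real.sq_sqrt (mul_nonneg (div_nonneg (by linarith) (by linarith)) (by positivity))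
      _ = (n - 1) / n * ∑ i : κ, (1 - c) := by
          rw [integral_const_mul, integral_finsetSum _ fun i _ => (hAL i).integrable_sq]
          congr 1
          exact Finset.sum_congr rfl fun i _ => by
            rw [integral_sq_sum_mul_pi_gaussianReal, hnorm]
      _ = (n - 1) * (1 - c) := by
          rw [Finset.sum_const, Finset.card_univ, nsmul_eq_mul]
          change (n - 1) / n * (n * (1 - c)) = _
          field_simp
  have hGmeas : Measurable G := by fun_prop
  have hGL : MemLp G 2 P := (memLp_two_iff_integrable_sq hGmeas.aestronglyMeasurable).2 hG2int
  have hEG : ∫ z, G z ∂P ≤ √((n - 1) * (1 - c)) := by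
    refine Real.le_sqrt_of_sq_le ?_
    have h := variance_nonneg G P
    rw [variance_eq_sub hGL] at h
    simp only [Pi.pow_apply] at h
    linarith
  have hind : IndepFun G S P :=
    (indepFun_sum_mul_pi_gaussianReal m (fun i k => u i k - m k) horth).comp
      (φ := fun a : κ → ℝ => √((n - 1) / n * ∑ i, a i ^ 2)) (ψ := id) (by fun_prop) measurable_id
  have hlaw : P.map S = gaussianReal 0 c.toNNReal := by
    rw [← hmm]; exact map_sum_mul_pi_gaussianReal m
  have hmain := measureReal_lt_gaussian_ge (by simpa using hc) (by fun_prop) hGmeas hlaw hind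
    (fun z => Real.sqrt_nonneg _) (hGL.integrable (by norm_num))
  rw [Real.coe_toNNReal _ hc.le] at hmain
  refine le_trans ?_ (hmain.trans (measureReal_mono fun z hz i => ?_))
  · gcongr
  · have h : -A i z ≤ G z := by
      refine Real.le_sqrt_of_sq_le ?_
      have := card_mul_sq_le_of_sum_eq_zero (hA0 z) i
      rw [neg_sq, div_mul_eq_mul_div, le_div_iff₀ (by linarith)]
      linarith
    have hz' : G z < S z := hz
    change 0 < ∑ k, u i k * z k
    rw [hA]
    linarith

/-- Let `d ≥ 3`, `λ ∈ [−d, 0]`, and let `u₁, …, u_d` be unit vectors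
in `ℝ^d` with pairwise inner products `(d − 2 − λ)/(2(d − 1))`. Then the standard
Gaussian measure of the cone `{z : ⟨u_i, z⟩ > 0 for all i}` is at least
`1/2 − (1/3)·√(λ + d)`. -/
theorem gaussian_measure_simplicial_cone_ge
    (d : ℕ) (hd : 3 ≤ d) (lam : ℝ) (hlam : lam ∈ Set.Icc (-(d : ℝ)) 0)
    (u : Fin d → Fin d → ℝ)
    (hunit : ∀ i, ∑ k, u i k * u i k = 1)
    (hangle : ∀ i j, i ≠ j →
      ∑ k, u i k * u j k = ((d : ℝ) - 2 - lam) / (2 * ((d : ℝ) - 1))) :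
    ENNReal.ofReal (1 / 2 - (1 / 3) * Real.sqrt (lam + d))
      ≤ Measure.pi (fun _ : Fin d => gaussianReal 0 1)
          {z : Fin d → ℝ | ∀ i, 0 < ∑ k, u i k * z k} := by
  have hd' : (3 : ℝ) ≤ d := by exact_mod_cast hd
  obtain ⟨hlam0, -⟩ := hlam
  rcases le_or_gt (9 / 4) (lam + d) with hbig | hsmall
  · have : 3 / 2 ≤ √(lam + d) := Real.le_sqrt_of_sq_le (by linarith)
    rw [ENNReal.ofReal_of_nonpos (by linarith)]
    exact zero_le
  have : Nonempty (Fin d) := ⟨⟨0, by omega⟩⟩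
  set c : ℝ := 1 - (lam + d) / (2 * d) with hc
  have hd0 : (d : ℝ) ≠ 0 := by linarith
  have hd1 : (d : ℝ) - 1 ≠ 0 := by linarith
  have hrow (i : Fin d) : ∑ j, ∑ k, u i k * u j k = d * c := by
    rw [← Finset.add_sum_erase _ _ (Finset.mem_univ i), hunit,
      Finset.sum_congr rfl fun j hj => hangle i j (Finset.ne_of_mem_erase hj).symm,
      Finset.sum_const, Finset.card_erase_of_mem (Finset.mem_univ i), Finset.card_univ,
      Fintype.card_fin, nsmul_eq_mul, Nat.cast_sub (by omega), Nat.cast_one, hc]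
    field_simp
    ring
  set m : Fin d → ℝ := fun k => (∑ j, u j k) / d
  have hum (i : Fin d) : ∑ k, u i k * m k = c := by
    have h : ∑ k, u i k * m k = (∑ j, ∑ k, u i k * u j k) / d := by
      rw [Finset.sum_comm, Finset.sum_div]
      exact Finset.sum_congr rfl fun k _ => by rw [← Finset.mul_sum, mul_div_assoc]
    rw [h, hrow]
    field_simp
  have hmm : ∑ k, m k * m k = c := by
    have h : ∑ k, m k * m k = (∑ i, ∑ k, u i k * m k) / d := by
      rw [Finset.sum_comm, Finset.sum_div]
      exact Finset.sum_congr rfl fun k _ => by rw [← Finset.sum_mul]; simp only [m]; ring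
    rw [h]
    simp only [hum, Finset.sum_const, Finset.card_univ, Fintype.card_fin, nsmul_eq_mul]
    field_simp
  have hdc : d * (1 - c) = (lam + d) / 2 := by rw [hc]; field_simp; ring
  have hcpos : 0 < c := by nlinarith
  have hmain := measureReal_simplicial_cone_ge u m hcpos
    (fun k => by simp only [m, Fintype.card_fin]; field_simp) hmm hum hunit
  rw [Fintype.card_fin] at hmain
  refine ENNReal.ofReal_le_of_le_toReal (le_trans ?_ hmain)
  have hkey : √((d - 1) * (1 - c)) ≤ 1 / 3 * √(lam + d) * √(2 * Real.pi * c) := by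
    refine Real.sqrt_le_iff.2 ⟨by positivity, ?_⟩
    rw [mul_pow, mul_pow, Real.sq_sqrt (by linarith), Real.sq_sqrt (by positivity)]
    have hpi : 3 * c ≤ Real.pi * c := mul_le_mul_of_nonneg_right Real.pi_gt_three.le hcpos.le
    have h1 : 1 - c = (lam + d) / (2 * d) := by rw [hc]; ring
    have h2 : ((d : ℝ) - 1) / (2 * d) ≤ 2 / 9 * (Real.pi * c) := by
      rw [div_le_iff₀ (by linarith)]
      nlinarith
    calc (d - 1) * (1 - c) = (lam + d) * (((d : ℝ) - 1) / (2 * d)) := by rw [h1]; ring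
      _ ≤ (lam + d) * (2 / 9 * (Real.pi * c)) := mul_le_mul_of_nonneg_left h2 (by linarith)
      _ = _ := by ring
  have hs : 0 < √(2 * Real.pi * c) := Real.sqrt_pos.2 (by positivity)
  have := (div_le_iff₀ hs).2 hkey
  rw [div_eq_mul_inv] at this
  linarith
end

section
/- For every real number t with 0 ≤ t ≤ 1, arccos(t) ≤ (π/2)·√(1 − t). -/
open Real in
/-- The chord of `sin` over `[0, π / 4]` lies below its graph. -/
theorem two_mul_sqrt_two_div_pi_mul_le_sin {x : ℝ} (hx₀ : 0 ≤ x) (hx : x ≤ π / 4) :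
    2 * √2 / π * x ≤ sin x := by
  have hπ := pi_pos
  have hw : 4 * x / π ≤ 1 := by rw [div_le_one hπ]; linarith
  have h := strictConcaveOn_sin_Icc.concaveOn.2
    (show (0 : ℝ) ∈ Set.Icc 0 π from ⟨le_rfl, hπ.le⟩)
    (show π / 4 ∈ Set.Icc 0 π from ⟨by positivity, by linarith⟩)
    (sub_nonneg.2 hw) (show 0 ≤ 4 * x / π by positivity) (by ring)
  have hmul : 4 * x / π * (π / 4) = x := by field_simp
  simp only [smul_eq_mul, mul_zero, sin_zero, zero_add, sin_pi_div_four, hmul] at h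
  linear_combination h

open Real in
theorem cos_le_one_sub_four_div_pi_sq_mul_sq {x : ℝ} (hx₀ : 0 ≤ x) (hx : x ≤ π / 2) :
    cos x ≤ 1 - 4 / π ^ 2 * x ^ 2 := by
  have h := two_mul_sqrt_two_div_pi_mul_le_sin (x := x / 2) (by positivity) (by linarith)
  have hsq := pow_le_pow_left₀ (by positivity) h 2
  have hchord : (2 * √2 / π * (x / 2)) ^ 2 = 2 / π ^ 2 * x ^ 2 := by
    rw [mul_pow, div_pow, mul_pow, sq_sqrt zero_le_two]
    ring
  have hcos : cos x = 1 - 2 * sin (x / 2) ^ 2 := by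
    rw [sin_sq_eq_half_sub, mul_div_cancel₀ x two_ne_zero]
    ring
  rw [hchord] at hsq
  rw [hcos]
  linear_combination 2 * hsq

/-- For every real `t` with `0 ≤ t ≤ 1`,
`arccos(t) ≤ (π/2)·√(1 − t)`. -/
theorem arccos_le_pi_div_two_mul_sqrt (t : ℝ) (h0 : 0 ≤ t) (h1 : t ≤ 1) :
    Real.arccos t ≤ Real.pi / 2 * Real.sqrt (1 - t) := by
  have h := cos_le_one_sub_four_div_pi_sq_mul_sq (Real.arccos_nonneg t)
    (Real.arccos_le_pi_div_two.2 h0)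
  rw [Real.cos_arccos (by linarith) h1] at h
  have hπ := Real.pi_pos
  have hsqrt : 2 / Real.pi * Real.arccos t ≤ √(1 - t) := by
    apply Real.le_sqrt_of_sq_le
    rw [mul_pow, div_pow]
    linarith
  calc Real.arccos t = Real.pi / 2 * (2 / Real.pi * Real.arccos t) := by field_simp
    _ ≤ Real.pi / 2 * √(1 - t) := by gcongr
end
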